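/- Let H be an N×N GOE matrix and M the matrix obtained from H by setting the diagonal to zero. Let ε>0, ε₁∈(0,1/20) and δ_f∈(0,1/20). Then there is an event of overwhelming probability on which the following holds for all N large enough: for every smooth function f: ℝ→ℝ with f = 1 on [a,b], f = 0 outside [a − N^{δ_f−1}, b + N^{δ_f−1}], ‖f^{(k)}‖_∞ ≤ C·(N^{1−δ_f})^k for k = 1,2, where a ≥ 2 − N^{−1/2} and |a−b| ≤ N^{δ_f+ε₁}/N, one has |tr f(M) − tr f(H)| ≤ N^{ε−δ_f}. -/

import Mathlib

open MeasureTheory Complex ProbabilityTheory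
open scoped RealInnerProductSpace BigOperators

noncomputable section

abbrev ESp (N : ℕ) := EuclideanSpace ℝ (Fin N)

/-- Surface (uniform, up to normalization) measure on the unit sphere of `ℝ^N`. -/
def sphereMeas (N : ℕ) : Measure (Metric.sphere (0 : ESp N) 1) :=
  (volume : Measure (ESp N)).toSphere

/-- Gibbs weight `exp((β/2)⟨σ, Mσ⟩)` where `σ = √N · x` and `x` is on the unit sphere. -/
def gibbsWeight (N : ℕ) (β : ℝ) (M : Matrix (Fin N) (Fin N) ℝ)
    (x : Metric.sphere (0 : ESp N) 1) : ℝ :=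
  Real.exp ((β * N / 2) * ⟪(x : ESp N), Matrix.toEuclideanLin M (x : ESp N)⟫)

/-- Gibbs expectation of a two-replica observable `φ` (in unit-sphere coordinates). -/
def gibbsExpect (N : ℕ) (β : ℝ) (M : Matrix (Fin N) (Fin N) ℝ)
    (φ : ESp N → ESp N → ℝ) : ℝ :=
  (∫ x, ∫ y, gibbsWeight N β M x * gibbsWeight N β M y * φ (x : ESp N) (y : ESp N)
      ∂(sphereMeas N) ∂(sphereMeas N))
   / (∫ x, gibbsWeight N β M x ∂(sphereMeas N)) ^ 2

/-- Overlap `R₁₂ = σ⁽¹⁾·σ⁽²⁾/N` in unit-sphere coordinates. -/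
def overlapFn (N : ℕ) (x y : ESp N) : ℝ := ⟪x, y⟫

/-- The function `G(z) = βz - N⁻¹ ∑ log(z - λᵢ)` (principal branch). -/
def Gfn (N : ℕ) (β : ℝ) (lam : Fin N → ℝ) (z : ℂ) : ℂ :=
  β * z - (1 / (N : ℂ)) * ∑ i, Complex.log (z - lam i)

/-- `∫_{γ-i∞}^{γ+i∞} f(z) dz` parametrized as `i ∫_ℝ f(γ+it) dt`. -/
def lineInt (γ : ℝ) (f : ℂ → ℂ) : ℂ := Complex.I * ∫ t : ℝ, f (γ + t * Complex.I)

def lineInt2 (γ : ℝ) (F : ℂ → ℂ → ℂ) : ℂ :=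
  Complex.I * Complex.I * ∫ t : ℝ, ∫ s : ℝ, F (γ + t * Complex.I) (γ + s * Complex.I)

/-- Semicircle density. -/
def rhoSC (x : ℝ) : ℝ := Real.sqrt (max (4 - x ^ 2) 0) / (2 * Real.pi)

/-- iid standard Gaussian coefficients `g_{ij}`. -/
def gMeasure (N : ℕ) : Measure (Fin N → Fin N → ℝ) :=
  Measure.pi fun _ => Measure.pi fun _ => gaussianReal 0 1

/-- GOE matrix built from iid standard Gaussians. -/
def Hmat (N : ℕ) (g : Fin N → Fin N → ℝ) : Matrix (Fin N) (Fin N) ℝ :=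
  fun i j => if i = j then Real.sqrt (2 / N) * g i i else (g i j + g j i) / Real.sqrt (2 * N)

/-- GOE matrix with zero diagonal. -/
def Mmat (N : ℕ) (g : Fin N → Fin N → ℝ) : Matrix (Fin N) (Fin N) ℝ :=
  fun i j => if i = j then 0 else (g i j + g j i) / Real.sqrt (2 * N)

lemma Hmat_isHermitian (N : ℕ) (g : Fin N → Fin N → ℝ) : (Hmat N g).IsHermitian := by
  unfold Matrix.IsHermitian
  ext i j
  simp only [Matrix.conjTranspose_apply, star_trivial, Hmat]
  by_cases h : i = j
  · subst h; rfl
  · rw [if_neg fun hh => h hh.symm, if_neg h]; ring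

lemma Mmat_isHermitian (N : ℕ) (g : Fin N → Fin N → ℝ) : (Mmat N g).IsHermitian := by
  unfold Matrix.IsHermitian
  ext i j
  simp only [Matrix.conjTranspose_apply, star_trivial, Mmat]
  by_cases h : i = j
  · subst h; rfl
  · rw [if_neg fun hh => h hh.symm, if_neg h]; ring

/-- Eigenvalues of a real symmetric matrix, in decreasing order. -/
def evalsDesc {N : ℕ} {A : Matrix (Fin N) (Fin N) ℝ} (hA : A.IsHermitian) : Fin N → ℝ :=
  fun i => - (fun j => - hA.eigenvalues j) ((Tuple.sort fun j => - hA.eigenvalues j) i)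

/-- Decreasing eigenvalues of the GOE matrix. -/
def evalsH (N : ℕ) (g : Fin N → Fin N → ℝ) : Fin N → ℝ := evalsDesc (Hmat_isHermitian N g)

/-- Decreasing eigenvalues of the zero-diagonal GOE matrix. -/
def evalsM (N : ℕ) (g : Fin N → Fin N → ℝ) : Fin N → ℝ := evalsDesc (Mmat_isHermitian N g)

/-- `m̃_N(w) = N⁻¹ ∑_{j≥2} (λ_j - w)⁻¹`. -/
def mtil (N : ℕ) (lam : Fin N → ℝ) (w : ℝ) : ℝ :=
  (1 / (N:ℝ)) * ∑ j ∈ Finset.univ.filter (fun j : Fin N => (j : ℕ) ≠ 0), 1 / (lam j - w)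

/-- `m̃_N'(w) = N⁻¹ ∑_{j≥2} (λ_j - w)⁻²`. -/
def mtil' (N : ℕ) (lam : Fin N → ℝ) (w : ℝ) : ℝ :=
  (1 / (N:ℝ)) * ∑ j ∈ Finset.univ.filter (fun j : Fin N => (j : ℕ) ≠ 0), 1 / (lam j - w) ^ 2

/-- Rigidity: `|λ_i - γ_i| ≤ N^{ε₁/10} min(i, N+1-i)^{-1/3} N^{-2/3}` (1-based `i`). -/
def rigidityCond (N : ℕ) (ε₁ : ℝ) (lam γcl : Fin N → ℝ) : Prop :=
  ∀ i : Fin N, |lam i - γcl i| ≤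
    (N:ℝ) ^ (ε₁ / 10) * ((min ((i:ℕ)+1) (N - (i:ℕ)) : ℕ) : ℝ) ^ (-(1:ℝ)/3) * (N:ℝ) ^ (-(2:ℝ)/3)

/-- Classical locations: `∫_{-2}^{γ_i} ρ_sc = i/N` (1-based `i`). -/
def classicalLoc (N : ℕ) (γcl : Fin N → ℝ) : Prop :=
  ∀ i : Fin N, ∫ x in (-2:ℝ)..(γcl i), rhoSC x = (((i:ℕ) + 1 : ℕ) : ℝ) / N

/-- Keyhole contour integral around `-b`: rays below/above `(-∞, -b-r)` plus the
counterclockwise circle of radius `r`, for an integrand `f(z)·(z+b)^s`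
(principal branch, boundary values on the rays). -/
def keyholeInt (b r : ℝ) (s : ℂ) (f : ℂ → ℂ) : ℂ :=
  (∫ x in Set.Iio (-b - r),
      f x * Complex.exp (s * Real.log (-(x + b))) * Complex.exp (-(Real.pi:ℂ) * s * Complex.I))
  + (∫ θ in (-Real.pi)..Real.pi,
      f (-b + r * Complex.exp (θ * Complex.I)) *
        Complex.exp (s * ((Real.log r : ℂ) + θ * Complex.I)) *
        (Complex.I * r * Complex.exp (θ * Complex.I)))
  - (∫ x in Set.Iio (-b - r),
      f x * Complex.exp (s * Real.log (-(x + b))) * Complex.exp ((Real.pi:ℂ) * s * Complex.I))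

/-- Integral over the contour `Γ̂ = Γ₁ ∪ Γ₃` (counterclockwise around the branch cut). -/
def hatInt (X η₀ : ℝ) (ηf ηf' : ℝ → ℝ) (F : ℂ → ℂ) : ℂ :=
  (-Complex.I) * (∫ t in (0:ℝ)..η₀, F (-X - t * Complex.I))
  + (∫ E in (-X)..(0:ℝ), F (E - ηf E * Complex.I) * (1 - ηf' E * Complex.I))
  - (∫ E in (-X)..(0:ℝ), F (E + ηf E * Complex.I) * (1 + ηf' E * Complex.I))
  - Complex.I * (∫ t in (0:ℝ)..η₀, F (-X + t * Complex.I))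

def hatInt2 (X η₀ : ℝ) (ηf ηf' : ℝ → ℝ) (F : ℂ → ℂ → ℂ) : ℂ :=
  hatInt X η₀ ηf ηf' fun z => hatInt X η₀ ηf ηf' fun w => F z w

/-- Resolvent of a real matrix at complex spectral parameter. -/
def resolventM (N : ℕ) (A : Matrix (Fin N) (Fin N) ℝ) (z : ℂ) : Matrix (Fin N) (Fin N) ℂ :=
  (A.map (fun x => (x : ℂ)) - z • (1 : Matrix (Fin N) (Fin N) ℂ))⁻¹

/-- Empirical Stieltjes transform `N⁻¹ tr (A - z)⁻¹`. -/
def stTrans (N : ℕ) (A : Matrix (Fin N) (Fin N) ℝ) (z : ℂ) : ℂ :=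
  (1 / (N:ℂ)) * Matrix.trace (resolventM N A z)

/-- Stieltjes transform of the semicircle law. -/
def mSC (z : ℂ) : ℂ := ∫ x in (-2:ℝ)..2, (rhoSC x : ℂ) / ((x:ℂ) - z)

instance gMeasure_isProbabilityMeasure (N : ℕ) : IsProbabilityMeasure (gMeasure N) := by
  unfold gMeasure; infer_instance

/-- Componentwise measure preserving maps combine into a measure preserving map of products. -/
lemma measurePreserving_pi_mix {ι α : Type*} [Fintype ι] [MeasurableSpace α]
    (ν : Measure α) [IsProbabilityMeasure ν] (φ : ι → α × α → α)
    (h : ∀ i, MeasurePreserving (φ i) (ν.prod ν) ν) :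
    MeasurePreserving (fun (p : (ι → α) × (ι → α)) i => φ i (p.1 i, p.2 i))
      ((Measure.pi fun _ : ι => ν).prod (Measure.pi fun _ : ι => ν)) (Measure.pi fun _ : ι => ν) := by
  have h1 := measurePreserving_pi (fun _ : ι => ν.prod ν) (fun _ : ι => ν) h
  have h2 := (measurePreserving_arrowProdEquivProdArrow α α ι (fun _ => ν) (fun _ => ν)).symm
  exact h1.comp h2

open Classical in
/-- Replace the entries with index in `S` by those of an independent copy. -/
def resample (N : ℕ) (S : Set (Fin N × Fin N))
    (p : (Fin N → Fin N → ℝ) × (Fin N → Fin N → ℝ)) : Fin N → Fin N → ℝ :=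
  fun i j => if (i, j) ∈ S then p.2 i j else p.1 i j

lemma measurePreserving_resample (N : ℕ) (S : Set (Fin N × Fin N)) :
    MeasurePreserving (resample N S) ((gMeasure N).prod (gMeasure N)) (gMeasure N) := by
  classical
  have h1 : ∀ i j : Fin N, MeasurePreserving
      (fun p : ℝ × ℝ => if (i, j) ∈ S then p.2 else p.1)
      ((gaussianReal 0 1).prod (gaussianReal 0 1)) (gaussianReal 0 1) := by
    intro i j
    by_cases h : (i, j) ∈ S
    · simpa [h] using measurePreserving_snd
    · simpa [h] using measurePreserving_fst
  have h2 := fun i => measurePreserving_pi_mix (gaussianReal 0 1) _ (h1 i)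
  have h3 := measurePreserving_pi_mix (Measure.pi fun _ : Fin N => gaussianReal 0 1) _ h2
  exact h3

/-- Gaussian integration by parts in one variable. -/
lemma gaussianReal_stein (F F' : ℝ → ℂ) (C : ℝ) (hF : ∀ x, HasDerivAt F (F' x) x)
    (hm' : Measurable F') (hb : ∀ x, ‖F x‖ ≤ C) (hb' : ∀ x, ‖F' x‖ ≤ C) :
    ∫ x, (x : ℂ) * F x ∂(gaussianReal 0 1) = ∫ x, F' x ∂(gaussianReal 0 1) := by
  have hFc : Continuous F := continuous_iff_continuousAt.2 fun x => (hF x).continuousAt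
  set ρ : ℝ → ℝ := gaussianPDFReal 0 1 with hρ
  have hρd : ∀ x, HasDerivAt ρ (-x * ρ x) x := by
    intro x
    rw [hρ, gaussianPDFReal_def]
    have h1 : HasDerivAt (fun x : ℝ => -(x - 0) ^ 2 / (2 * ((1 : NNReal) : ℝ))) (-x) x := by
      have := ((((hasDerivAt_id x).sub_const 0).pow 2).neg).div_const (2 * ((1 : NNReal) : ℝ))
      refine this.congr_deriv ?_
      simp; ring
    refine ((h1.exp).const_mul _).congr_deriv ?_
    ring
  have hρi : Integrable ρ := integrable_gaussianPDFReal 0 1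
  have hρx : Integrable (fun x => x * ρ x) := by
    have h := integrable_mul_exp_neg_mul_sq (b := 1 / 2) (by norm_num)
    refine (h.const_mul (√(2 * Real.pi * ((1 : NNReal) : ℝ)))⁻¹).congr (ae_of_all _ fun x => ?_)
    simp only [hρ, gaussianPDFReal_def]
    rw [show -(x - 0) ^ 2 / (2 * ((1 : NNReal) : ℝ)) = -(1 / 2) * x ^ 2 by simp; ring]
    ring
  have key := integral_mul_deriv_eq_deriv_mul_of_integrable (u := F)
    (v := fun x => ((ρ x : ℝ) : ℂ)) (u' := F') (v' := fun x => ((-x * ρ x : ℝ) : ℂ))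
    (fun x _ => hF x) (fun x _ => (hρd x).ofReal_comp) ?_ ?_ ?_
  · rw [integral_gaussianReal_eq_integral_smul one_ne_zero,
      integral_gaussianReal_eq_integral_smul one_ne_zero]
    have e1 : ∀ x : ℝ, gaussianPDFReal 0 1 x • ((x : ℂ) * F x) =
        -(F x * ((-x * ρ x : ℝ) : ℂ)) := by
      intro x; rw [Complex.real_smul]; push_cast; simp only [hρ]; ring
    have e2 : ∀ x : ℝ, gaussianPDFReal 0 1 x • (F' x) = F' x * ((ρ x : ℝ) : ℂ) := by
      intro x; rw [Complex.real_smul]; simp only [hρ]; ring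
    simp_rw [e1, e2]
    rw [integral_neg, key, neg_neg]
  · exact (Integrable.bdd_mul (c := C)
      (by simpa using hρx.neg.ofReal (𝕜 := ℂ)) hFc.aestronglyMeasurable (ae_of_all _ hb))
  · exact (Integrable.bdd_mul (c := C) hρi.ofReal hm'.aestronglyMeasurable (ae_of_all _ hb'))
  · exact (Integrable.bdd_mul (c := C) hρi.ofReal hFc.aestronglyMeasurable (ae_of_all _ hb))

/-- Replace the `(k, j)` entry of `g` by `t`. -/
def updEntry {N : ℕ} (g : Fin N → Fin N → ℝ) (k j : Fin N) (t : ℝ) : Fin N → Fin N → ℝ :=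
  fun i l => if i = k ∧ l = j then t else g i l

lemma integrable_entry (N : ℕ) (k j : Fin N) :
    Integrable (fun g : Fin N → Fin N → ℝ => g k j) (gMeasure N) := by
  have h1 : MeasurePreserving (fun g : Fin N → Fin N → ℝ => g k j) (gMeasure N)
      (gaussianReal 0 1) :=
    (measurePreserving_eval (fun _ : Fin N => gaussianReal 0 1) j).comp
      (measurePreserving_eval (fun _ : Fin N => Measure.pi fun _ : Fin N => gaussianReal 0 1) k)
  have h2 : Integrable (fun x : ℝ => x) (gaussianReal 0 1) :=
    (memLp_id_gaussianReal 1).integrable le_rfl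
  exact h1.integrable_comp_of_integrable h2

/-- Gaussian integration by parts in the entry `(k, j)`. -/
lemma gMeasure_stein (N : ℕ) (k j : Fin N) (F F' : (Fin N → Fin N → ℝ) → ℂ) (C : ℝ)
    (hF : ∀ g, HasDerivAt (fun t : ℝ => F (updEntry g k j t)) (F' g) (g k j))
    (hm : Measurable F) (hm' : Measurable F') (hb : ∀ g, ‖F g‖ ≤ C) (hb' : ∀ g, ‖F' g‖ ≤ C) :
    ∫ g, (g k j : ℂ) * F g ∂(gMeasure N) = ∫ g, F' g ∂(gMeasure N) := by
  set Φ := resample N {(k, j)} with hΦ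
  have hmp := measurePreserving_resample N {(k, j)}
  have hupd : ∀ p, Φ p = updEntry p.1 k j (p.2 k j) := by
    intro p; ext i l
    simp only [hΦ, resample, updEntry, Set.mem_singleton_iff, Prod.mk.injEq]
    split_ifs with h
    · rw [h.1, h.2]
    · rfl
  have hmk : Measurable fun g : Fin N → Fin N → ℝ => g k j := by fun_prop
  have hI : Integrable (fun g => (g k j : ℂ) * F g) (gMeasure N) :=
    (integrable_entry N k j).ofReal.mul_bdd (c := C) hm.aestronglyMeasurable (ae_of_all _ hb)
  have hI' : Integrable F' (gMeasure N) :=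
    Integrable.of_bound hm'.aestronglyMeasurable C (ae_of_all _ hb')
  have hev : MeasurePreserving (fun g : Fin N → Fin N → ℝ => g k j) (gMeasure N)
      (gaussianReal 0 1) :=
    (measurePreserving_eval (fun _ : Fin N => gaussianReal 0 1) j).comp
      (measurePreserving_eval (fun _ : Fin N => Measure.pi fun _ : Fin N => gaussianReal 0 1) k)
  have hup : ∀ g : Fin N → Fin N → ℝ, Measurable fun t : ℝ => updEntry g k j t := by
    intro g
    refine measurable_pi_lambda _ fun i => measurable_pi_lambda _ fun l => ?_
    unfold updEntry
    split_ifs <;> fun_prop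
  have e1 : ∫ g, (g k j : ℂ) * F g ∂(gMeasure N) =
      ∫ p, ((Φ p k j : ℝ) : ℂ) * F (Φ p) ∂((gMeasure N).prod (gMeasure N)) := by
    conv_lhs => rw [← hmp.map_eq]
    rw [integral_map hmp.measurable.aemeasurable]
    rw [hmp.map_eq]; exact hI.aestronglyMeasurable
  have e2 : ∫ g, F' g ∂(gMeasure N) =
      ∫ p, F' (Φ p) ∂((gMeasure N).prod (gMeasure N)) := by
    conv_lhs => rw [← hmp.map_eq]
    rw [integral_map hmp.measurable.aemeasurable]
    rw [hmp.map_eq]; exact hI'.aestronglyMeasurable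
  have hJ : Integrable (fun p => ((Φ p k j : ℝ) : ℂ) * F (Φ p))
      ((gMeasure N).prod (gMeasure N)) := hmp.integrable_comp_of_integrable hI
  have hJ' : Integrable (fun p => F' (Φ p))
      ((gMeasure N).prod (gMeasure N)) := hmp.integrable_comp_of_integrable hI'
  rw [e1, e2, integral_prod _ hJ, integral_prod _ hJ']
  congr 1
  ext g
  simp only [hupd]
  have hkk : ∀ t, updEntry g k j t k j = t := fun t => by simp [updEntry]
  have huu : ∀ t s, updEntry (updEntry g k j t) k j s = updEntry g k j s := by
    intro t s; ext i l; simp only [updEntry]; split_ifs <;> rfl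
  simp only [hkk]
  have f1 : ∫ g', ((g' k j : ℝ) : ℂ) * F (updEntry g k j (g' k j)) ∂(gMeasure N) =
      ∫ t, (t : ℂ) * F (updEntry g k j t) ∂(gaussianReal 0 1) := by
    rw [← hev.map_eq, integral_map hev.measurable.aemeasurable]
    have : Measurable fun t : ℝ => (t : ℂ) * F (updEntry g k j t) :=
      (Complex.measurable_ofReal).mul (hm.comp (hup g))
    exact this.aestronglyMeasurable
  have f2 : ∫ g', F' (updEntry g k j (g' k j)) ∂(gMeasure N) =
      ∫ t, F' (updEntry g k j t) ∂(gaussianReal 0 1) := by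
    rw [← hev.map_eq, integral_map hev.measurable.aemeasurable]
    exact (hm'.comp (hup g)).aestronglyMeasurable
  rw [f1, f2]
  refine gaussianReal_stein (fun t => F (updEntry g k j t)) (fun t => F' (updEntry g k j t)) C ?_
    (hm'.comp (hup g)) (fun t => hb _) (fun t => hb' _)
  intro t
  have := hF (updEntry g k j t)
  simpa only [huu, hkk] using this

lemma hasSubgaussianMGF_entry (N : ℕ) (i j : Fin N) :
    HasSubgaussianMGF (fun g : Fin N → Fin N → ℝ => g i j) 1 (gMeasure N) := by
  have hev : MeasurePreserving (fun g : Fin N → Fin N → ℝ => g i j) (gMeasure N)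
      (gaussianReal 0 1) :=
    (measurePreserving_eval (fun _ : Fin N => gaussianReal 0 1) j).comp
      (measurePreserving_eval (fun _ : Fin N => Measure.pi fun _ : Fin N => gaussianReal 0 1) i)
  refine ⟨fun t => ?_, fun t => ?_⟩
  · exact hev.integrable_comp_of_integrable (integrable_exp_mul_gaussianReal t)
  · rw [mgf_gaussianReal hev.map_eq]; simp

/-- Gaussian tail for a linear combination of the diagonal entries. -/
lemma gMeasure_diag_tail (N : ℕ) (v : Fin N → ℝ) (t : ℝ) (ht : 0 ≤ t) :
    (gMeasure N).real {g | t * ∑ c, v c ^ 2 < (∑ c, v c * g c c) ^ 2} ≤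
      2 * Real.exp (-t / 2) := by
  set V := ∑ c, v c ^ 2 with hV
  have hV0 : 0 ≤ V := Finset.sum_nonneg fun _ _ => sq_nonneg _
  rcases hV0.eq_or_lt with h0 | hpos
  · have hv : ∀ c, v c = 0 := by
      intro c
      have := (Finset.sum_eq_zero_iff_of_nonneg (fun c _ => sq_nonneg (v c))).1 h0.symm c
        (Finset.mem_univ c)
      simpa using this
    have : {g : Fin N → Fin N → ℝ | t * V < (∑ c, v c * g c c) ^ 2} = ∅ := by
      ext g; simp [hv, ← h0]
    rw [this]; simp; positivity
  have hind : iIndepFun (fun (c : Fin N) (g : Fin N → Fin N → ℝ) => g c c) (gMeasure N) :=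
    iIndepFun_pi (X := fun (c : Fin N) (x : Fin N → ℝ) => x c)
      (fun c => (measurable_pi_apply c).aemeasurable)
  have hind2 : iIndepFun (fun (c : Fin N) (g : Fin N → Fin N → ℝ) => v c * g c c)
      (gMeasure N) :=
    hind.comp (fun c x => v c * x) (fun c => by fun_prop)
  have hsg : HasSubgaussianMGF (fun g : Fin N → Fin N → ℝ => ∑ c, v c * g c c)
      (∑ c, (v c ^ 2).toNNReal) (gMeasure N) := by
    refine HasSubgaussianMGF.sum_of_iIndepFun hind2 (s := Finset.univ) fun c _ => ?_
    convert (hasSubgaussianMGF_entry N c c).const_mul (v c) using 1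
    apply NNReal.eq
    rw [Real.coe_toNNReal _ (sq_nonneg _)]
    exact (mul_one (v c ^ 2)).symm
  have hc : ((∑ c, (v c ^ 2).toNNReal : NNReal) : ℝ) = V := by
    rw [hV]; push_cast; exact Finset.sum_congr rfl fun c _ => Real.coe_toNNReal _ (sq_nonneg _)
  have hs : 0 ≤ √(t * V) := Real.sqrt_nonneg _
  have h1 := hsg.measure_ge_le hs
  have h2 := hsg.neg.measure_ge_le hs
  rw [hc] at h1 h2
  have he : -√(t * V) ^ 2 / (2 * V) = -t / 2 := by
    rw [Real.sq_sqrt (by positivity)]; field_simp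
  rw [he] at h1 h2
  calc _ ≤ (gMeasure N).real ({g | √(t * V) ≤ ∑ c, v c * g c c} ∪
        {g | √(t * V) ≤ (-fun g : Fin N → Fin N → ℝ => ∑ c, v c * g c c) g}) := by
        refine measureReal_mono ?_
        intro g hg
        simp only [Set.mem_ofPred_eq] at hg
        have : √(t * V) ≤ |∑ c, v c * g c c| := by
          rw [← Real.sqrt_sq_eq_abs]; exact Real.sqrt_le_sqrt hg.le
        rcases le_abs.1 this with h | h
        · exact Or.inl h
        · exact Or.inr h
    _ ≤ _ := (measureReal_union_le _ _).trans (by linarith)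

/-- Tail bound for a single entry. -/
lemma gMeasure_entry_tail (N : ℕ) (i j : Fin N) (t : ℝ) (ht : 0 ≤ t) :
    (gMeasure N).real {g | t < |g i j|} ≤ 2 * Real.exp (-t ^ 2 / 2) := by
  have hsg := hasSubgaussianMGF_entry N i j
  have h1 := hsg.measure_ge_le ht
  have h2 := hsg.neg.measure_ge_le ht
  calc _ ≤ (gMeasure N).real ({g | t ≤ g i j} ∪
        {g | t ≤ (-fun g : Fin N → Fin N → ℝ => g i j) g}) := by
        refine measureReal_mono ?_
        intro g hg
        rcases le_abs.1 (le_of_lt (show t < |g i j| from hg)) with h | h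
        · exact Or.inl h
        · exact Or.inr h
    _ ≤ _ := (measureReal_union_le _ _).trans (by norm_num at h1 h2 ⊢; linarith)

/-- Conditional Gaussian tail: the coefficients may depend on the off-diagonal entries. -/
lemma gMeasure_diag_tail_cond (N : ℕ) (v : (Fin N → Fin N → ℝ) → Fin N → ℝ)
    (hv : Measurable v)
    (hdep : ∀ g g', (∀ i j, i ≠ j → g i j = g' i j) → v g = v g') (t : ℝ) (ht : 0 ≤ t) :
    (gMeasure N).real {g | t * ∑ c, v g c ^ 2 < (∑ c, v g c * g c c) ^ 2} ≤
      2 * Real.exp (-t / 2) := by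
  have hvc : ∀ c, Measurable fun g => v g c := fun c => (measurable_pi_apply c).comp hv
  have hS : MeasurableSet {g | t * ∑ c, v g c ^ 2 < (∑ c, v g c * g c c) ^ 2} := by
    apply measurableSet_lt
    · exact (Finset.measurable_sum _ fun c _ => (hvc c).pow_const 2).const_mul t
    · exact (Finset.measurable_sum _ fun c _ => (hvc c).mul (by fun_prop)).pow_const 2
  have hmp := measurePreserving_resample N {p | p.1 = p.2}
  rw [measureReal_def, ← hmp.measure_preimage hS.nullMeasurableSet,
    Measure.prod_apply (hmp.measurable hS)]
  refine ENNReal.toReal_le_of_le_ofReal (by positivity) ?_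
  calc _ ≤ ∫⁻ _g : Fin N → Fin N → ℝ, ENNReal.ofReal (2 * Real.exp (-t / 2)) ∂(gMeasure N) := by
        refine lintegral_mono fun g => ?_
        have : (Prod.mk g ⁻¹' (resample N {p | p.1 = p.2} ⁻¹'
            {g | t * ∑ c, v g c ^ 2 < (∑ c, v g c * g c c) ^ 2})) =
            {g' | t * ∑ c, v g c ^ 2 < (∑ c, v g c * g' c c) ^ 2} := by
          ext g'
          have e : v (resample N {p | p.1 = p.2} (g, g')) = v g :=
            hdep _ _ fun i j hij => by simp [resample, hij]
          have e2 : ∀ c, resample N {p | p.1 = p.2} (g, g') c c = g' c c := by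
            intro c; simp [resample]
          simp only [Set.mem_preimage, Set.mem_ofPred_eq, e, e2]
        rw [this, ← ofReal_measureReal]
        exact ENNReal.ofReal_le_ofReal (gMeasure_diag_tail N (v g) t ht)
    _ = _ := by simp

section

/-- `u` is an orthonormal eigenbasis of `A` with eigenvalues `lam`. -/
structure SpecData {N : ℕ} (A : Matrix (Fin N) (Fin N) ℝ) (lam : Fin N → ℝ)
    (u : Fin N → Fin N → ℝ) : Prop where
  orth : ∀ j k, ∑ a, u j a * u k a = if j = k then 1 else 0
  compl : ∀ a b, ∑ j, u j a * u j b = if a = b then 1 else 0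
  spec : ∀ a b, A a b = ∑ j, lam j * (u j a * u j b)

lemma exists_specData {N : ℕ} {A : Matrix (Fin N) (Fin N) ℝ} (hA : A.IsHermitian) :
    ∃ u, SpecData A hA.eigenvalues u := by
  set U : Matrix (Fin N) (Fin N) ℝ := hA.eigenvectorUnitary.1 with hU
  have h1 : star U * U = 1 := by simp [hU]
  have h2 : U * star U = 1 := by simp [hU]
  have h3 := hA.spectral_theorem
  refine ⟨fun j a => U a j, ?_, ?_, ?_⟩
  · intro j k
    have := congrFun (congrFun h1 j) k
    simpa [Matrix.mul_apply, Matrix.star_apply, Matrix.one_apply] using this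
  · intro a b
    have := congrFun (congrFun h2 a) b
    simpa [Matrix.mul_apply, Matrix.star_apply, Matrix.one_apply] using this
  · intro a b
    have e : A = U * Matrix.diagonal hA.eigenvalues * star U := by
      conv_lhs => rw [h3]
      simp [Unitary.conjStarAlgAut_apply, hU]
    conv_lhs => rw [e]
    rw [Matrix.mul_apply]
    refine Finset.sum_congr rfl fun j _ => ?_
    rw [Matrix.mul_diagonal]
    simp [Matrix.star_apply]
    ring

namespace SpecData

variable {N : ℕ} {A : Matrix (Fin N) (Fin N) ℝ} {lam : Fin N → ℝ} {u : Fin N → Fin N → ℝ}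

/-- Functional calculus: matrix entries of `f(A)`. -/
def fc (u : Fin N → Fin N → ℝ) (f : Fin N → ℂ) (a b : Fin N) : ℂ :=
  ∑ j, ((u j a * u j b : ℝ) : ℂ) * f j

/-- Real functional calculus. -/
def fcr (u : Fin N → Fin N → ℝ) (f : Fin N → ℝ) (a b : Fin N) : ℝ :=
  ∑ j, u j a * u j b * f j

lemma fc_comm (f : Fin N → ℂ) (a b : Fin N) : fc u f a b = fc u f b a :=
  Finset.sum_congr rfl fun j _ => by rw [mul_comm (u j a)]

lemma fc_mul (h : SpecData A lam u) (f g : Fin N → ℂ) (a b : Fin N) :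
    ∑ c, fc u f a c * fc u g c b = fc u (fun j => f j * g j) a b := by
  have h1 : ∀ c, fc u f a c * fc u g c b =
      ∑ j, ∑ k, (((u j a : ℂ)) * f j * (u k b * g k)) * ((u j c * u k c : ℝ) : ℂ) := by
    intro c
    rw [fc, fc, Finset.sum_mul_sum]
    refine Finset.sum_congr rfl fun j _ => Finset.sum_congr rfl fun k _ => ?_
    push_cast; ring
  simp_rw [h1]
  rw [Finset.sum_comm]
  refine Finset.sum_congr rfl fun j _ => ?_
  rw [Finset.sum_comm]
  have h2 : ∀ k, ∑ c, (((u j a : ℂ)) * f j * (u k b * g k)) * ((u j c * u k c : ℝ) : ℂ) =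
      (((u j a : ℂ)) * f j * (u k b * g k)) * (if j = k then 1 else 0) := by
    intro k
    rw [← Finset.mul_sum, ← Complex.ofReal_sum, h.orth]
    split_ifs <;> simp
  simp_rw [h2]
  simp
  ring

lemma sum_fcr_sq (h : SpecData A lam u) (f : Fin N → ℝ) (a : Fin N) :
    ∑ c, fcr u f a c ^ 2 = ∑ j, u j a ^ 2 * f j ^ 2 := by
  have h1 : ∀ c, fcr u f a c ^ 2 =
      ∑ j, ∑ k, (u j a * f j * (u k a * f k)) * (u j c * u k c) := by
    intro c
    rw [sq, fcr, Finset.sum_mul_sum]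
    refine Finset.sum_congr rfl fun j _ => Finset.sum_congr rfl fun k _ => ?_
    ring
  simp_rw [h1]
  rw [Finset.sum_comm]
  refine Finset.sum_congr rfl fun j _ => ?_
  rw [Finset.sum_comm]
  have h2 : ∀ k, ∑ c, (u j a * f j * (u k a * f k)) * (u j c * u k c) =
      (u j a * f j * (u k a * f k)) * (if j = k then 1 else 0) := by
    intro k
    rw [← Finset.mul_sum, h.orth]
  simp_rw [h2]
  simp
  ring

lemma fc_re (f : Fin N → ℂ) (a b : Fin N) : (fc u f a b).re = fcr u (fun j => (f j).re) a b := by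
  rw [fc, Complex.re_sum, fcr]
  exact Finset.sum_congr rfl fun j _ => by rw [Complex.re_ofReal_mul]

lemma fc_im (f : Fin N → ℂ) (a b : Fin N) : (fc u f a b).im = fcr u (fun j => (f j).im) a b := by
  rw [fc, Complex.im_sum, fcr]
  exact Finset.sum_congr rfl fun j _ => by rw [Complex.im_ofReal_mul]

lemma sum_norm_fc_sq (h : SpecData A lam u) (f : Fin N → ℂ) (a : Fin N) :
    ∑ c, ‖fc u f a c‖ ^ 2 = ∑ j, u j a ^ 2 * ‖f j‖ ^ 2 := by
  have h1 : ∀ w : ℂ, ‖w‖ ^ 2 = w.re ^ 2 + w.im ^ 2 := fun w => by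
    rw [Complex.sq_norm, Complex.normSq_apply]; ring
  simp_rw [h1, Finset.sum_add_distrib, fc_re, fc_im, h.sum_fcr_sq, mul_add,
    Finset.sum_add_distrib]

lemma resolvent_mul (h : SpecData A lam u) {z : ℂ} (hz : z.im ≠ 0) :
    (A.map (fun x => (x : ℂ)) - z • (1 : Matrix (Fin N) (Fin N) ℂ)) *
      (Matrix.of (fc u fun j => ((lam j : ℂ) - z)⁻¹)) = 1 := by
  have hne : ∀ j, (lam j : ℂ) - z ≠ 0 := fun j h0 => hz (by
    have := congrArg Complex.im h0; simpa using this)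
  have h1 : (A.map (fun x => (x : ℂ)) - z • (1 : Matrix (Fin N) (Fin N) ℂ)) =
      Matrix.of (fc u fun j => (lam j : ℂ) - z) := by
    ext a b
    have e1 : ((if a = b then 1 else 0 : ℝ) : ℂ) = ∑ j, ((u j a * u j b : ℝ) : ℂ) := by
      rw [← h.compl a b]; push_cast; rfl
    simp only [Matrix.sub_apply, Matrix.map_apply, Matrix.smul_apply, Matrix.one_apply,
      Matrix.of_apply, fc, smul_eq_mul]
    rw [show (if a = b then (1 : ℂ) else 0) = ((if a = b then 1 else 0 : ℝ) : ℂ) by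
      split_ifs <;> simp, e1, h.spec a b, Finset.mul_sum, Complex.ofReal_sum,
      ← Finset.sum_sub_distrib]
    refine Finset.sum_congr rfl fun j _ => ?_
    push_cast; ring
  rw [h1]
  ext a b
  rw [Matrix.mul_apply]
  simp only [Matrix.of_apply]
  rw [h.fc_mul]
  have : (fun j => ((lam j : ℂ) - z) * ((lam j : ℂ) - z)⁻¹) = fun _ => 1 := by
    ext j; exact mul_inv_cancel₀ (hne j)
  rw [this, Matrix.one_apply, fc]
  have := congrArg (fun x : ℝ => (x : ℂ)) (h.compl a b)
  simp only [Complex.ofReal_sum] at this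
  simp only [mul_one]
  rw [this]; split_ifs <;> simp

lemma resolventM_apply (h : SpecData A lam u) {z : ℂ} (hz : z.im ≠ 0) (a b : Fin N) :
    resolventM N A z a b = fc u (fun j => ((lam j : ℂ) - z)⁻¹) a b := by
  rw [resolventM, Matrix.inv_eq_right_inv (h.resolvent_mul hz)]
  rfl

lemma sum_sq_one (h : SpecData A lam u) (a : Fin N) : ∑ j, u j a ^ 2 = 1 := by
  have := h.compl a a
  simpa [sq] using this

lemma sum_sq_one' (h : SpecData A lam u) (j : Fin N) : ∑ a, u j a ^ 2 = 1 := by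
  have := h.orth j j
  simpa [sq] using this

lemma stTrans_eq (h : SpecData A lam u) {z : ℂ} (hz : z.im ≠ 0) :
    stTrans N A z = (1 / (N : ℂ)) * ∑ j, ((lam j : ℂ) - z)⁻¹ := by
  rw [stTrans, Matrix.trace]
  congr 1
  simp only [Matrix.diag_apply, h.resolventM_apply hz, fc]
  rw [Finset.sum_comm]
  refine Finset.sum_congr rfl fun j _ => ?_
  rw [← Finset.sum_mul, ← Complex.ofReal_sum]
  have := h.orth j j
  simp only [if_true] at this
  rw [this]; simp

end SpecData

lemma inv_sub_im (x : ℝ) (z : ℂ) :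
    (((x : ℂ) - z)⁻¹).im = z.im / ((x - z.re) ^ 2 + z.im ^ 2) := by
  rw [Complex.inv_im, Complex.normSq_apply]; simp; ring

lemma inv_sub_re (x : ℝ) (z : ℂ) :
    (((x : ℂ) - z)⁻¹).re = (x - z.re) / ((x - z.re) ^ 2 + z.im ^ 2) := by
  rw [Complex.inv_re, Complex.normSq_apply]; simp; ring

lemma norm_inv_sub_sq (x : ℝ) (z : ℂ) :
    ‖((x : ℂ) - z)⁻¹‖ ^ 2 = ((x - z.re) ^ 2 + z.im ^ 2)⁻¹ := by
  rw [norm_inv, inv_pow, Complex.sq_norm, Complex.normSq_apply]; simp; ring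

lemma norm_inv_sub_le (x : ℝ) {z : ℂ} (hz : 0 < z.im) : ‖((x : ℂ) - z)⁻¹‖ ≤ 1 / z.im := by
  rw [norm_inv, one_div]
  refine inv_anti₀ hz ?_
  have := Complex.abs_im_le_norm ((x : ℂ) - z)
  simp at this
  exact (le_abs_self _).trans this

section resolvent

variable {N : ℕ} {A : Matrix (Fin N) (Fin N) ℝ} {z : ℂ}

lemma resolventM_symm (hA : A.IsHermitian) (hz : 0 < z.im) (a b : Fin N) :
    resolventM N A z a b = resolventM N A z b a := by
  obtain ⟨u, h⟩ := exists_specData hA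
  rw [h.resolventM_apply hz.ne', h.resolventM_apply hz.ne', SpecData.fc_comm]

lemma resolventM_ward (hA : A.IsHermitian) (hz : 0 < z.im) (a : Fin N) :
    ∑ b, ‖resolventM N A z a b‖ ^ 2 = (resolventM N A z a a).im / z.im := by
  obtain ⟨u, h⟩ := exists_specData hA
  simp_rw [h.resolventM_apply hz.ne']
  rw [h.sum_norm_fc_sq, SpecData.fc_im, SpecData.fcr, Finset.sum_div]
  refine Finset.sum_congr rfl fun j _ => ?_
  rw [inv_sub_im, norm_inv_sub_sq]
  have : (0:ℝ) < (hA.eigenvalues j - z.re) ^ 2 + z.im ^ 2 := by positivity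
  field_simp

lemma resolventM_im_nonneg (hA : A.IsHermitian) (hz : 0 < z.im) (a : Fin N) :
    0 ≤ (resolventM N A z a a).im := by
  have h1 := resolventM_ward hA hz a
  have h2 : 0 ≤ ∑ b, ‖resolventM N A z a b‖ ^ 2 := by positivity
  rw [h1] at h2
  by_contra! h
  exact absurd (div_neg_of_neg_of_pos h hz) (not_lt.2 h2)

lemma resolventM_norm_le (hA : A.IsHermitian) (hz : 0 < z.im) (a b : Fin N) :
    ‖resolventM N A z a b‖ ≤ 1 / z.im := by
  obtain ⟨u, h⟩ := exists_specData hA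
  have h1 : ‖resolventM N A z a b‖ ^ 2 ≤ (1 / z.im) ^ 2 := by
    calc _ ≤ ∑ c, ‖resolventM N A z a c‖ ^ 2 :=
          Finset.single_le_sum (f := fun c => ‖resolventM N A z a c‖ ^ 2)
            (fun c _ => by positivity) (Finset.mem_univ b)
      _ = ∑ j, u j a ^ 2 * ‖((hA.eigenvalues j : ℂ) - z)⁻¹‖ ^ 2 := by
          simp_rw [h.resolventM_apply hz.ne']
          rw [h.sum_norm_fc_sq]
      _ ≤ ∑ j, u j a ^ 2 * (1 / z.im) ^ 2 := by
          gcongr with j _; exact norm_inv_sub_le _ hz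
      _ = _ := by rw [← Finset.sum_mul, h.sum_sq_one, one_mul]
  exact le_of_sq_le_sq h1 (by positivity)

lemma resolventM_sq_bound (hA : A.IsHermitian) (hz : 0 < z.im) (a : Fin N) :
    ∑ b, ‖(resolventM N A z * resolventM N A z) a b‖ ^ 2 ≤
      (resolventM N A z a a).im / z.im * (1 / z.im) ^ 2 := by
  rw [← resolventM_ward hA hz]
  obtain ⟨u, h⟩ := exists_specData hA
  simp_rw [Matrix.mul_apply, h.resolventM_apply hz.ne', h.fc_mul, h.sum_norm_fc_sq]
  rw [Finset.sum_mul]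
  refine Finset.sum_le_sum fun j _ => ?_
  rw [norm_mul, mul_pow, mul_assoc]
  gcongr
  exact norm_inv_sub_le _ hz

/-- `∑_b |G_{ab}| |(G²)_{ab}| ≤ Im G_{aa} / η²`. -/
lemma resolventM_mul_sq_bound (hA : A.IsHermitian) (hz : 0 < z.im) (a : Fin N) :
    ∑ b, ‖resolventM N A z a b‖ * ‖(resolventM N A z * resolventM N A z) a b‖ ≤
      (resolventM N A z a a).im / z.im ^ 2 := by
  have h0 := resolventM_im_nonneg hA hz a
  refine (Real.sum_mul_le_sqrt_mul_sqrt _ _ _).trans ?_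
  rw [resolventM_ward hA hz, ← Real.sqrt_mul (by positivity)]
  refine Real.sqrt_le_iff.2 ⟨by positivity, ?_⟩
  calc _ ≤ (resolventM N A z a a).im / z.im *
        ((resolventM N A z a a).im / z.im * (1 / z.im) ^ 2) := by
        gcongr; exact resolventM_sq_bound hA hz a
    _ = _ := by field_simp

lemma resolventM_mul_left (hA : A.IsHermitian) (hz : 0 < z.im) :
    (A.map (fun x => (x : ℂ)) - z • (1 : Matrix (Fin N) (Fin N) ℂ)) * resolventM N A z = 1 := by
  obtain ⟨u, h⟩ := exists_specData hA
  rw [resolventM, Matrix.inv_eq_right_inv (h.resolvent_mul hz.ne')]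
  exact h.resolvent_mul hz.ne'

lemma resolventM_mul_right (hA : A.IsHermitian) (hz : 0 < z.im) :
    resolventM N A z * (A.map (fun x => (x : ℂ)) - z • (1 : Matrix (Fin N) (Fin N) ℂ)) = 1 :=
  mul_eq_one_comm.1 (resolventM_mul_left hA hz)

/-- `(A G)_{kk} = 1 + z G_{kk}`. -/
lemma sum_mul_resolventM (hA : A.IsHermitian) (hz : 0 < z.im) (k : Fin N) :
    ∑ j, (A k j : ℂ) * resolventM N A z j k = 1 + z * resolventM N A z k k := by
  have h := congrFun (congrFun (resolventM_mul_left hA hz) k) k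
  rw [Matrix.sub_mul, Matrix.sub_apply, Matrix.mul_apply, Matrix.smul_mul, Matrix.one_mul] at h
  simp only [Matrix.map_apply, Matrix.smul_apply, Matrix.one_apply_eq, smul_eq_mul] at h
  rw [← h]; ring

/-- The symmetric direction `E_{kj} + E_{jk}`. -/
def symDir (N : ℕ) (k j : Fin N) : Matrix (Fin N) (Fin N) ℝ :=
  Matrix.single k j 1 + Matrix.single j k 1

lemma symDir_isHermitian (k j : Fin N) : (symDir N k j).IsHermitian := by
  unfold symDir Matrix.IsHermitian
  simp [add_comm]

lemma add_smul_symDir_isHermitian (hA : A.IsHermitian) (k j : Fin N) (s : ℝ) :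
    (A + s • symDir N k j).IsHermitian :=
  hA.add ((symDir_isHermitian k j).smul (by simp [IsSelfAdjoint]))

lemma resolventM_diff (hA : A.IsHermitian) (hz : 0 < z.im) (k j : Fin N) (s : ℝ) (a b : Fin N) :
    resolventM N (A + s • symDir N k j) z a b = resolventM N A z a b +
      (s : ℂ) * (-(resolventM N (A + s • symDir N k j) z a k * resolventM N A z j b +
        resolventM N (A + s • symDir N k j) z a j * resolventM N A z k b)) := by
  have hB := add_smul_symDir_isHermitian hA k j s
  set R := resolventM N (A + s • symDir N k j) z
  set G := resolventM N A z with hG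
  have e : (A + s • symDir N k j).map (fun x => (x : ℂ)) - z • (1 : Matrix (Fin N) (Fin N) ℂ) =
      (A.map (fun x => (x : ℂ)) - z • (1 : Matrix (Fin N) (Fin N) ℂ)) +
      (s : ℂ) • ((Matrix.single k j 1 + Matrix.single j k 1 : Matrix (Fin N) (Fin N) ℂ)) := by
    ext x y
    simp only [symDir, Matrix.sub_apply, Matrix.add_apply, Matrix.map_apply, Matrix.smul_apply,
      Matrix.single_apply, smul_eq_mul]
    split_ifs <;> push_cast <;> ring
  have h1 : R * ((A.map (fun x => (x : ℂ)) - z • (1 : Matrix (Fin N) (Fin N) ℂ)) +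
      (s : ℂ) • ((Matrix.single k j 1 + Matrix.single j k 1 : Matrix (Fin N) (Fin N) ℂ))) * G = G := by
    rw [← e, resolventM_mul_right hB hz, Matrix.one_mul]
  rw [Matrix.mul_add, Matrix.add_mul, Matrix.mul_assoc, resolventM_mul_left hA hz,
    Matrix.mul_one] at h1
  have h2 := congrFun (congrFun h1 a) b
  rw [← h2]
  have h3 : (R * ((s : ℂ) • (Matrix.single k j 1 + Matrix.single j k 1 :
      Matrix (Fin N) (Fin N) ℂ)) * G) a b =
      (s : ℂ) * (R a k * G j b + R a j * G k b) := by
    rw [Matrix.mul_smul, Matrix.smul_mul, Matrix.smul_apply, Matrix.mul_add, Matrix.add_mul,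
      Matrix.add_apply, smul_eq_mul]
    congr 2
    · rw [Matrix.mul_apply, Finset.sum_eq_single j]
      · simp
      · intro c _ hc; simp [Matrix.mul_single_apply_of_ne, hc]
      · simp
    · rw [Matrix.mul_apply, Finset.sum_eq_single k]
      · simp
      · intro c _ hc; simp [Matrix.mul_single_apply_of_ne, hc]
      · simp
  rw [Matrix.add_apply, h3]
  ring

lemma resolventM_hasDerivAt (hA : A.IsHermitian) (hz : 0 < z.im) (k j a b : Fin N) :
    HasDerivAt (fun s : ℝ => resolventM N (A + s • symDir N k j) z a b)
      (-(resolventM N A z a k * resolventM N A z j b +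
        resolventM N A z a j * resolventM N A z k b)) 0 := by
  have hcont : ∀ c, Filter.Tendsto (fun s : ℝ => resolventM N (A + s • symDir N k j) z a c)
      (nhds 0) (nhds (resolventM N A z a c)) := by
    intro c
    have h1 : (fun s : ℝ => resolventM N (A + s • symDir N k j) z a c) = fun s : ℝ =>
        resolventM N A z a c + (s : ℂ) *
        (-(resolventM N (A + s • symDir N k j) z a k * resolventM N A z j c +
          resolventM N (A + s • symDir N k j) z a j * resolventM N A z k c)) :=
      funext fun s => resolventM_diff hA hz k j s a c
    rw [h1]
    have h2 : Filter.Tendsto (fun s : ℝ => (s : ℂ) *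
        (-(resolventM N (A + s • symDir N k j) z a k * resolventM N A z j c +
          resolventM N (A + s • symDir N k j) z a j * resolventM N A z k c)))
        (nhds 0) (nhds 0) := by
      have h3 : Filter.Tendsto (fun s : ℝ => (s : ℂ)) (nhds 0) (nhds 0) := by
        have := Complex.continuous_ofReal.tendsto 0
        simpa using this
      refine NormedField.tendsto_zero_smul_of_tendsto_zero_of_bounded h3 ?_
      refine ⟨1 / z.im * (1 / z.im) + 1 / z.im * (1 / z.im), ?_⟩
      rw [Filter.eventually_map]
      refine Filter.Eventually.of_forall fun s => ?_
      have hB := add_smul_symDir_isHermitian hA k j s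
      simp only [Function.comp, norm_neg]
      refine (norm_add_le _ _).trans ?_
      rw [norm_mul, norm_mul]
      gcongr <;> first | exact resolventM_norm_le hB hz _ _ | exact resolventM_norm_le hA hz _ _
    simpa using tendsto_const_nhds.add h2
  rw [hasDerivAt_iff_tendsto_slope]
  have h4 : Filter.Tendsto (fun s : ℝ =>
      (-(resolventM N (A + s • symDir N k j) z a k * resolventM N A z j b +
          resolventM N (A + s • symDir N k j) z a j * resolventM N A z k b)))
      (nhdsWithin 0 {0}ᶜ) (nhds (-(resolventM N A z a k * resolventM N A z j b +
        resolventM N A z a j * resolventM N A z k b))) :=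
    ((((hcont k).mul_const _).add ((hcont j).mul_const _)).neg).mono_left nhdsWithin_le_nhds
  refine h4.congr' ?_
  filter_upwards [self_mem_nhdsWithin] with s hs
  have hs0 : (s : ℂ) ≠ 0 := by simpa using hs
  rw [slope_def_module, resolventM_diff hA hz k j s a b]
  simp only [zero_smul, add_zero, sub_zero, add_sub_cancel_left, Complex.real_smul,
    Complex.ofReal_inv]
  rw [inv_mul_cancel_left₀ hs0]

lemma stTrans_hasDerivAt (hA : A.IsHermitian) (hz : 0 < z.im) (k j : Fin N) :
    HasDerivAt (fun s : ℝ => stTrans N (A + s • symDir N k j) z)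
      (-(2 / (N : ℂ)) * (resolventM N A z * resolventM N A z) k j) 0 := by
  have h1 : HasDerivAt (fun s : ℝ => stTrans N (A + s • symDir N k j) z)
      ((1 / (N : ℂ)) * ∑ a, (-(resolventM N A z a k * resolventM N A z j a +
        resolventM N A z a j * resolventM N A z k a))) 0 :=
    (HasDerivAt.fun_sum fun a _ => resolventM_hasDerivAt hA hz k j a a).const_mul _
  refine h1.congr_deriv ?_
  rw [Matrix.mul_apply]
  have : ∀ a, (-(resolventM N A z a k * resolventM N A z j a +
      resolventM N A z a j * resolventM N A z k a)) =
      -2 * (resolventM N A z k a * resolventM N A z a j) := by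
    intro a
    rw [resolventM_symm hA hz a k, resolventM_symm hA hz j a]; ring
  simp_rw [this]
  rw [← Finset.mul_sum]; ring

lemma stTrans_norm_le (hA : A.IsHermitian) (hz : 0 < z.im) : ‖stTrans N A z‖ ≤ 1 / z.im := by
  rcases Nat.eq_zero_or_pos N with h0 | hpos
  · subst h0
    have : stTrans 0 A z = 0 := by simp [stTrans]
    rw [this]; simp; positivity
  rw [stTrans, norm_mul]
  have : ‖(resolventM N A z).trace‖ ≤ N * (1 / z.im) := by
    rw [Matrix.trace]
    refine (norm_sum_le _ _).trans ?_
    refine (Finset.sum_le_sum fun a _ => resolventM_norm_le hA hz a a).trans ?_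
    simp
  have hN : (0 : ℝ) < N := by exact_mod_cast hpos
  calc _ ≤ ‖(1 / (N : ℂ))‖ * (N * (1 / z.im)) := by gcongr
    _ = _ := by simp; field_simp

lemma stTrans_im_nonneg (hA : A.IsHermitian) (hz : 0 < z.im) : 0 ≤ (stTrans N A z).im := by
  have : (1 / (N : ℂ)) = ((1 / N : ℝ) : ℂ) := by push_cast; rfl
  rw [stTrans, this, Complex.im_ofReal_mul, Matrix.trace, Complex.im_sum]
  exact mul_nonneg (by positivity)
    (Finset.sum_nonneg fun a _ => resolventM_im_nonneg hA hz a)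

end resolvent

lemma measurable_resolventM (N : ℕ) (z : ℂ) (a b : Fin N) :
    Measurable fun g : Fin N → Fin N → ℝ => resolventM N (Mmat N g) z a b := by
  set B : (Fin N → Fin N → ℝ) → Matrix (Fin N) (Fin N) ℂ := fun g =>
    (Mmat N g).map (fun x => (x : ℂ)) - z • (1 : Matrix (Fin N) (Fin N) ℂ) with hB
  have hc : Continuous B := by
    refine continuous_matrix fun i j => ?_
    simp only [hB, Matrix.sub_apply, Matrix.map_apply, Mmat]
    refine Continuous.sub ?_ continuous_const
    split_ifs
    · exact continuous_const
    · refine Complex.continuous_ofReal.comp ?_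
      fun_prop
  have h1 : (fun g : Fin N → Fin N → ℝ => resolventM N (Mmat N g) z a b) =
      fun g => (B g).det⁻¹ * (B g).adjugate a b := by
    ext g
    rw [resolventM, Matrix.inv_def, Matrix.smul_apply, Ring.inverse_eq_inv', smul_eq_mul]
  rw [h1]
  exact (hc.matrix_det.measurable.inv).mul (hc.matrix_adjugate.matrix_elem a b).measurable

lemma measurable_stTrans (N : ℕ) (z : ℂ) :
    Measurable fun g : Fin N → Fin N → ℝ => stTrans N (Mmat N g) z := by
  unfold stTrans Matrix.trace
  exact (Finset.measurable_sum _ fun a _ => measurable_resolventM N z a a).const_mul _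

end

section

/-- Functions of the matrix that are measurable and bounded on symmetric matrices. -/
def BddMeas (N : ℕ) (F : Matrix (Fin N) (Fin N) ℝ → ℂ) : Prop :=
  Measurable (fun g => F (Mmat N g)) ∧ ∃ C : ℝ, ∀ A : Matrix (Fin N) (Fin N) ℝ,
    A.IsHermitian → ‖F A‖ ≤ C

namespace BddMeas

variable {N : ℕ} {F G : Matrix (Fin N) (Fin N) ℝ → ℂ}

lemma const (c : ℂ) : BddMeas N fun _ => c := ⟨measurable_const, ‖c‖, fun _ _ => le_rfl⟩

lemma add (hF : BddMeas N F) (hG : BddMeas N G) : BddMeas N fun A => F A + G A := by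
  obtain ⟨h1, C, hC⟩ := hF
  obtain ⟨h2, D, hD⟩ := hG
  exact ⟨h1.add h2, C + D, fun A hA => (norm_add_le _ _).trans (add_le_add (hC A hA) (hD A hA))⟩

lemma mul (hF : BddMeas N F) (hG : BddMeas N G) : BddMeas N fun A => F A * G A := by
  obtain ⟨h1, C, hC⟩ := hF
  obtain ⟨h2, D, hD⟩ := hG
  refine ⟨h1.mul h2, C * D, fun A hA => ?_⟩
  rw [norm_mul]
  exact mul_le_mul (hC A hA) (hD A hA) (norm_nonneg _) ((norm_nonneg _).trans (hC A hA))

lemma neg (hF : BddMeas N F) : BddMeas N fun A => -F A := by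
  simpa using (const (-1)).mul hF

lemma pow (hF : BddMeas N F) (n : ℕ) : BddMeas N fun A => F A ^ n := by
  induction n with
  | zero => simpa using const 1
  | succ n ih => simpa [pow_succ] using ih.mul hF

lemma conj (hF : BddMeas N F) : BddMeas N fun A => (starRingEnd ℂ) (F A) := by
  obtain ⟨h1, C, hC⟩ := hF
  exact ⟨Complex.continuous_conj.measurable.comp h1, C, fun A hA => by simpa using hC A hA⟩

lemma sum {ι : Type*} (s : Finset ι) {F : ι → Matrix (Fin N) (Fin N) ℝ → ℂ}
    (h : ∀ i ∈ s, BddMeas N (F i)) : BddMeas N fun A => ∑ i ∈ s, F i A := by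
  classical
  induction s using Finset.induction_on with
  | empty => simpa using const 0
  | insert a s ha ih =>
    simp only [Finset.sum_insert ha]
    exact (h a (by simp)).add (ih fun i hi => h i (by simp [hi]))

lemma integrable (hF : BddMeas N F) : Integrable (fun g => F (Mmat N g)) (gMeasure N) := by
  obtain ⟨h1, C, hC⟩ := hF
  exact Integrable.of_bound h1.aestronglyMeasurable C
    (ae_of_all _ fun g => hC _ (Mmat_isHermitian N g))

lemma integrable_of_real {f : Matrix (Fin N) (Fin N) ℝ → ℝ}
    (hF : BddMeas N fun A => (f A : ℂ)) : Integrable (fun g => f (Mmat N g)) (gMeasure N) := by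
  simpa using hF.integrable.re

lemma norm (hF : BddMeas N F) : BddMeas N fun A => ((‖F A‖ : ℝ) : ℂ) := by
  obtain ⟨h1, C, hC⟩ := hF
  exact ⟨Complex.measurable_ofReal.comp h1.norm, C, fun A hA => by simpa using hC A hA⟩

lemma im (hF : BddMeas N F) : BddMeas N fun A => (((F A).im : ℝ) : ℂ) := by
  obtain ⟨h1, C, hC⟩ := hF
  refine ⟨Complex.measurable_ofReal.comp (Complex.measurable_im.comp h1), C, fun A hA => ?_⟩
  simpa using (Complex.abs_im_le_norm _).trans (hC A hA)

lemma resolvent {z : ℂ} (hz : 0 < z.im) (a b : Fin N) :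
    BddMeas N fun A => resolventM N A z a b :=
  ⟨measurable_resolventM N z a b, 1 / z.im, fun _ hA => resolventM_norm_le hA hz a b⟩

lemma stieltjes {z : ℂ} (hz : 0 < z.im) : BddMeas N fun A => stTrans N A z :=
  ⟨measurable_stTrans N z, 1 / z.im, fun _ hA => stTrans_norm_le hA hz⟩

end BddMeas

lemma Mmat_updEntry (N : ℕ) (g : Fin N → Fin N → ℝ) {k j : Fin N} (hkj : k ≠ j) (t : ℝ) :
    Mmat N (updEntry g k j t) =
      Mmat N g + ((t - g k j) / √(2 * N)) • symDir N k j := by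
  ext a b
  simp only [Mmat, updEntry, symDir, Matrix.add_apply, Matrix.smul_apply, Matrix.single_apply,
    smul_eq_mul]
  by_cases hab : a = b
  · subst hab
    have h1 : ¬ (k = a ∧ j = a) := fun h => hkj (h.1.trans h.2.symm)
    have h2 : ¬ (j = a ∧ k = a) := fun h => hkj (h.2.trans h.1.symm)
    simp [h1, h2]
  · rw [if_neg hab, if_neg hab]
    by_cases h1 : a = k ∧ b = j
    · obtain ⟨rfl, rfl⟩ := h1
      simp [hab, Ne.symm hab]; ring
    · by_cases h2 : a = j ∧ b = k
      · obtain ⟨rfl, rfl⟩ := h2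
        simp [hab, Ne.symm hab]; ring
      · rw [if_neg h1, if_neg (fun h => h2 ⟨h.2, h.1⟩), if_neg (fun h => h1 ⟨h.1.symm, h.2.symm⟩),
          if_neg (fun h => h2 ⟨h.1.symm, h.2.symm⟩)]
        simp

lemma symDir_comm (N : ℕ) (k j : Fin N) : symDir N k j = symDir N j k := add_comm _ _

/-- Gaussian integration by parts for the matrix entry `M_{kj}`. -/
lemma Mmat_stein {N : ℕ} {k j : Fin N} (hkj : k ≠ j) {φ φ' : Matrix (Fin N) (Fin N) ℝ → ℂ}
    (hφ : ∀ A, A.IsHermitian → HasDerivAt (fun s : ℝ => φ (A + s • symDir N k j)) (φ' A) 0)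
    (hb : BddMeas N φ) (hb' : BddMeas N φ') :
    ∫ g, (Mmat N g k j : ℂ) * φ (Mmat N g) ∂(gMeasure N) =
      (1 / (N : ℂ)) * ∫ g, φ' (Mmat N g) ∂(gMeasure N) := by
  have hN : (0 : ℝ) < N := by exact_mod_cast (k.pos)
  set w : ℝ := √(2 * N) with hw
  have hw0 : 0 < w := Real.sqrt_pos.2 (by positivity)
  have hw2 : w ^ 2 = 2 * N := Real.sq_sqrt (by positivity)
  obtain ⟨hm, C, hC⟩ := id hb
  obtain ⟨hm', C', hC'⟩ := id hb'
  have key : ∀ k' j' : Fin N, k' ≠ j' → symDir N k' j' = symDir N k j →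
      ∫ g, (g k' j' : ℂ) * φ (Mmat N g) ∂(gMeasure N) =
        ((1 / w : ℝ) : ℂ) * ∫ g, φ' (Mmat N g) ∂(gMeasure N) := by
    intro k' j' hne hs
    rw [← integral_const_mul]
    refine gMeasure_stein N k' j' (fun g => φ (Mmat N g))
      (fun g => ((1 / w : ℝ) : ℂ) * φ' (Mmat N g)) (max C (1 / w * C')) ?_ hm (hm'.const_mul _)
      (fun g => (hC _ (Mmat_isHermitian N g)).trans (le_max_left _ _)) ?_
    · intro g
      have e : (fun t : ℝ => φ (Mmat N (updEntry g k' j' t))) =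
          fun t : ℝ => φ (Mmat N g + ((t - g k' j') / w) • symDir N k j) := by
        ext t; rw [Mmat_updEntry N g hne, hs]
      rw [e]
      have h1 := hφ _ (Mmat_isHermitian N g)
      have h2 : HasDerivAt (fun t : ℝ => (t - g k' j') / w) (1 / w) (g k' j') :=
        ((hasDerivAt_id _).sub_const _).div_const w
      have h3 : HasDerivAt (fun s : ℝ => φ (Mmat N g + s • symDir N k j)) (φ' (Mmat N g))
          ((g k' j' - g k' j') / w) := by simpa using h1
      have h4 := HasDerivAt.scomp (g k' j') h3 h2
      rw [Complex.real_smul] at h4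
      exact h4
    · intro g
      refine le_trans ?_ (le_max_right _ _)
      rw [norm_mul, Complex.norm_real, Real.norm_of_nonneg (by positivity)]
      gcongr
      exact hC' _ (Mmat_isHermitian N g)
  have e1 : ∀ g : Fin N → Fin N → ℝ, (Mmat N g k j : ℂ) * φ (Mmat N g) =
      ((1 / w : ℝ) : ℂ) * ((g k j : ℂ) * φ (Mmat N g)) +
      ((1 / w : ℝ) : ℂ) * ((g j k : ℂ) * φ (Mmat N g)) := by
    intro g
    have : Mmat N g k j = (g k j + g j k) / w := by simp [Mmat, hkj, hw]
    rw [this]; push_cast; ring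
  have hi : ∀ k' j' : Fin N, Integrable (fun g => (g k' j' : ℂ) * φ (Mmat N g)) (gMeasure N) :=
    fun k' j' => (integrable_entry N k' j').ofReal.mul_bdd (c := C) hm.aestronglyMeasurable
      (ae_of_all _ fun g => hC _ (Mmat_isHermitian N g))
  simp_rw [e1]
  rw [integral_add ((hi k j).const_mul _) ((hi j k).const_mul _), integral_const_mul,
    integral_const_mul, key k j hkj rfl, key j k hkj.symm (symDir_comm N j k)]
  have : (((1 / w : ℝ) : ℂ)) * ((1 / w : ℝ) : ℂ) = 1 / (2 * (N : ℂ)) := by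
    rw [← Complex.ofReal_mul, show 1 / w * (1 / w) = 1 / w ^ 2 by field_simp, hw2]
    push_cast; rfl
  rw [← mul_assoc, this]
  have hNc : (N : ℂ) ≠ 0 := by exact_mod_cast hN.ne'
  field_simp
  ring

/-- The self-consistent-equation error of the diagonal entry `G_{kk}`. -/
def errDiag (N : ℕ) (z : ℂ) (k : Fin N) (A : Matrix (Fin N) (Fin N) ℝ) : ℂ :=
  1 + (z + stTrans N A z) * resolventM N A z k k

/-- The self-consistent-equation error of the Stieltjes transform. -/
def errTrace (N : ℕ) (z : ℂ) (A : Matrix (Fin N) (Fin N) ℝ) : ℂ :=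
  1 + z * stTrans N A z + stTrans N A z ^ 2

lemma errDiag_integral_bound {N : ℕ} {z : ℂ} (hz : 0 < z.im) (k : Fin N)
    {F : Matrix (Fin N) (Fin N) ℝ → ℂ} {F' : Fin N → Matrix (Fin N) (Fin N) ℝ → ℂ}
    (hF : ∀ j A, A.IsHermitian → HasDerivAt (fun s : ℝ => F (A + s • symDir N k j)) (F' j A) 0)
    (hb : BddMeas N F) (hb' : ∀ j, BddMeas N (F' j)) :
    ‖∫ g, errDiag N z k (Mmat N g) * F (Mmat N g) ∂(gMeasure N)‖ ≤
      ∫ g, (1 / (N * z.im) * (resolventM N (Mmat N g) z k k).im * ‖F (Mmat N g)‖ +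
        1 / N * ∑ j, ‖resolventM N (Mmat N g) z k j‖ * ‖F' j (Mmat N g)‖) ∂(gMeasure N) := by
  classical
  have hNn : 0 < N := k.pos
  have hN : (0 : ℝ) < N := by exact_mod_cast hNn
  have hNc : (N : ℂ) ≠ 0 := by exact_mod_cast hN.ne'
  set G : Matrix (Fin N) (Fin N) ℝ → Fin N → Fin N → ℂ := fun A => resolventM N A z with hG
  have bG : ∀ a b, BddMeas N fun A => G A a b := fun a b => BddMeas.resolvent hz a b
  -- integration by parts in each entry of row `k`
  have hst : ∀ j ∈ Finset.univ.erase k,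
      ∫ g, (Mmat N g k j : ℂ) * (G (Mmat N g) j k * F (Mmat N g)) ∂(gMeasure N) =
      ∫ g, (1 / (N : ℂ)) * (-(G (Mmat N g) j k * G (Mmat N g) j k +
        G (Mmat N g) j j * G (Mmat N g) k k) * F (Mmat N g) +
        G (Mmat N g) j k * F' j (Mmat N g)) ∂(gMeasure N) := by
    intro j hj
    have hkj : k ≠ j := (Finset.ne_of_mem_erase hj).symm
    rw [integral_const_mul]
    refine Mmat_stein hkj (φ := fun A => G A j k * F A)
      (φ' := fun A => -(G A j k * G A j k + G A j j * G A k k) * F A + G A j k * F' j A) ?_ ?_ ?_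
    · intro A hA
      have h1 := (resolventM_hasDerivAt hA hz k j j k).mul (hF j A hA)
      simp only [zero_smul, add_zero] at h1
      exact h1
    · exact (bG j k).mul hb
    · exact ((((bG j k).mul (bG j k)).add ((bG j j).mul (bG k k))).neg.mul hb).add
        ((bG j k).mul (hb' j))
  have hiM : ∀ j, Integrable (fun g => (Mmat N g k j : ℂ) *
      (G (Mmat N g) j k * F (Mmat N g))) (gMeasure N) := by
    intro j
    obtain ⟨h1, C, hC⟩ := (bG j k).mul hb
    have : Integrable (fun g => Mmat N g k j) (gMeasure N) := by
      unfold Mmat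
      split_ifs
      · exact integrable_const _
      · exact ((integrable_entry N k j).add (integrable_entry N j k)).div_const _
    exact this.ofReal.mul_bdd (c := C) h1.aestronglyMeasurable
      (ae_of_all _ fun g => hC _ (Mmat_isHermitian N g))
  have hiR : ∀ j, Integrable (fun g => (1 / (N : ℂ)) * (-(G (Mmat N g) j k * G (Mmat N g) j k +
        G (Mmat N g) j j * G (Mmat N g) k k) * F (Mmat N g) +
        G (Mmat N g) j k * F' j (Mmat N g))) (gMeasure N) := by
    intro j
    exact ((BddMeas.const (1 / (N : ℂ))).mul
      (((((bG j k).mul (bG j k)).add ((bG j j).mul (bG k k))).neg.mul hb).add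
        ((bG j k).mul (hb' j)))).integrable
  have e1 : ∀ g, errDiag N z k (Mmat N g) * F (Mmat N g) =
      (∑ j ∈ Finset.univ.erase k, (Mmat N g k j : ℂ) * (G (Mmat N g) j k * F (Mmat N g))) +
        stTrans N (Mmat N g) z * G (Mmat N g) k k * F (Mmat N g) := by
    intro g
    have h1 := sum_mul_resolventM (Mmat_isHermitian N g) hz k
    rw [← Finset.add_sum_erase _ _ (Finset.mem_univ k)] at h1
    have h2 : Mmat N g k k = 0 := by simp [Mmat]
    rw [h2] at h1
    have h3 : (∑ j ∈ Finset.univ.erase k, (Mmat N g k j : ℂ) *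
        (G (Mmat N g) j k * F (Mmat N g))) =
        (1 + z * G (Mmat N g) k k) * F (Mmat N g) := by
      simp only [hG]
      rw [← h1, Complex.ofReal_zero, zero_mul, zero_add, Finset.sum_mul]
      exact Finset.sum_congr rfl fun j _ => by ring
    rw [h3, errDiag]
    simp only [hG]; ring
  have hiT : Integrable (fun g => stTrans N (Mmat N g) z * G (Mmat N g) k k * F (Mmat N g))
      (gMeasure N) := (((BddMeas.stieltjes hz).mul (bG k k)).mul hb).integrable
  have e2 : ∫ g, errDiag N z k (Mmat N g) * F (Mmat N g) ∂(gMeasure N) =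
      ∫ g, ((∑ j ∈ Finset.univ.erase k, (1 / (N : ℂ)) * (-(G (Mmat N g) j k * G (Mmat N g) j k +
        G (Mmat N g) j j * G (Mmat N g) k k) * F (Mmat N g) +
        G (Mmat N g) j k * F' j (Mmat N g))) +
        stTrans N (Mmat N g) z * G (Mmat N g) k k * F (Mmat N g)) ∂(gMeasure N) := by
    simp_rw [e1]
    rw [integral_add (integrable_finsetSum _ fun j _ => hiM j) hiT,
      integral_add (integrable_finsetSum _ fun j _ => hiR j) hiT,
      integral_finsetSum _ fun j _ => hiM j, integral_finsetSum _ fun j _ => hiR j,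
      Finset.sum_congr rfl hst]
  rw [e2]
  refine norm_integral_le_of_norm_le ?_ (ae_of_all _ fun g => ?_)
  · refine BddMeas.integrable_of_real (f := fun A => 1 / (N * z.im) * (resolventM N A z k k).im *
      ‖F A‖ + 1 / N * ∑ j, ‖resolventM N A z k j‖ * ‖F' j A‖) ?_
    push_cast
    exact (((BddMeas.const _).mul (bG k k).im).mul hb.norm).add ((BddMeas.const _).mul
      (BddMeas.sum _ fun j _ => (bG k j).norm.mul (hb' j).norm))
  · have hA := Mmat_isHermitian N g
    generalize Mmat N g = A at hA
    have hsym : ∀ a b, G A a b = G A b a := resolventM_symm hA hz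
    have hw : ∑ b, ‖G A k b‖ ^ 2 = (G A k k).im / z.im := resolventM_ward hA hz k
    have htr : stTrans N A z = (1 / (N : ℂ)) * (∑ j, G A j j) := by
      rw [stTrans, Matrix.trace]; rfl
    have e3 : (∑ j ∈ Finset.univ.erase k, (1 / (N : ℂ)) * (-(G A j k * G A j k +
        G A j j * G A k k) * F A + G A j k * F' j A)) + stTrans N A z * G A k k * F A =
        (1 / (N : ℂ)) * ((G A k k ^ 2 - ∑ j ∈ Finset.univ.erase k, G A j k ^ 2) * F A +
          ∑ j ∈ Finset.univ.erase k, G A j k * F' j A) := by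
      rw [htr, ← Finset.add_sum_erase _ _ (Finset.mem_univ k), ← Finset.mul_sum,
        Finset.sum_add_distrib, ← Finset.sum_mul, Finset.sum_neg_distrib, Finset.sum_add_distrib,
        ← Finset.sum_mul]
      simp_rw [← sq]
      ring
    rw [e3, norm_mul]
    have n1 : ‖G A k k ^ 2 - ∑ j ∈ Finset.univ.erase k, G A j k ^ 2‖ ≤ (G A k k).im / z.im := by
      rw [← hw, ← Finset.add_sum_erase _ _ (Finset.mem_univ k)]
      refine (norm_sub_le _ _).trans (add_le_add (norm_pow _ _).le ?_)
      refine (norm_sum_le _ _).trans (Finset.sum_le_sum fun j _ => ?_)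
      rw [norm_pow, hsym j k]
    have n2 : ‖∑ j ∈ Finset.univ.erase k, G A j k * F' j A‖ ≤ ∑ j, ‖G A k j‖ * ‖F' j A‖ := by
      refine (norm_sum_le _ _).trans ?_
      refine (Finset.sum_le_univ_sum_of_nonneg fun j => norm_nonneg _).trans
        (Finset.sum_le_sum fun j _ => ?_)
      rw [norm_mul, hsym j k]
    have n3 : ‖(1 / (N : ℂ))‖ = 1 / N := by simp
    rw [n3]
    calc _ ≤ 1 / (N : ℝ) * ((G A k k).im / z.im * ‖F A‖ + ∑ j, ‖G A k j‖ * ‖F' j A‖) := by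
          gcongr
          refine (norm_add_le _ _).trans (add_le_add ?_ n2)
          rw [norm_mul]
          gcongr
      _ = _ := by simp only [hG]; field_simp

/-- Derivative of `P ^ n * conj P ^ (n+1)`. -/
lemma hasDerivAt_pow_mul_conj_pow {f : ℝ → ℂ} {f' : ℂ} (hf : HasDerivAt f f' 0) (n : ℕ) :
    HasDerivAt (fun s => f s ^ n * (starRingEnd ℂ) (f s) ^ (n + 1))
      ((n * f 0 ^ (n - 1) * f') * (starRingEnd ℂ) (f 0) ^ (n + 1) +
        f 0 ^ n * (((n + 1 : ℕ) : ℂ) * (starRingEnd ℂ) (f 0) ^ n * (starRingEnd ℂ) f')) 0 := by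
  have h1 : HasDerivAt (fun s => (starRingEnd ℂ) (f s)) ((starRingEnd ℂ) f') 0 := hf.star
  exact (hf.fun_pow n).mul (h1.fun_pow (n + 1))

lemma norm_deriv_pow_mul_conj_pow_le (w w' : ℂ) (n : ℕ) :
    ‖(n * w ^ (n - 1) * w') * (starRingEnd ℂ) w ^ (n + 1) +
        w ^ n * (((n + 1 : ℕ) : ℂ) * (starRingEnd ℂ) w ^ n * (starRingEnd ℂ) w')‖ ≤
      (2 * n + 1) * ‖w‖ ^ (2 * n) * ‖w'‖ := by
  refine (norm_add_le _ _).trans ?_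
  simp only [norm_mul, norm_pow, RCLike.norm_conj, Complex.norm_natCast]
  rcases n with _ | n
  · simp
  · simp only [Nat.add_sub_cancel]
    push_cast
    apply le_of_eq
    ring

end

lemma mul_pow_conj_pow (w : ℂ) (n : ℕ) :
    w * (w ^ n * (starRingEnd ℂ) w ^ (n + 1)) = ((‖w‖ ^ (2 * n + 2) : ℝ) : ℂ) := by
  have h : w * (starRingEnd ℂ) w = ((‖w‖ ^ 2 : ℝ) : ℂ) := by
    rw [Complex.mul_conj, Complex.normSq_eq_norm_sq]
  calc w * (w ^ n * (starRingEnd ℂ) w ^ (n + 1)) = (w * (starRingEnd ℂ) w) ^ (n + 1) := by ring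
    _ = _ := by rw [h]; push_cast; ring

lemma BddMeas.normReal_pow {N : ℕ} {P : Matrix (Fin N) (Fin N) ℝ → ℂ} (hb : BddMeas N P) (n : ℕ) :
    BddMeas N fun A => ((‖P A‖ ^ n : ℝ) : ℂ) := by
  push_cast; exact hb.norm.pow n

/-- Moment bound obtained by integration by parts against `P ^ n * conj P ^ (n + 1)`. -/
lemma errDiag_moment_bound {N : ℕ} {z : ℂ} (hz : 0 < z.im) (k : Fin N) (n : ℕ)
    {P : Matrix (Fin N) (Fin N) ℝ → ℂ} {P' : Fin N → Matrix (Fin N) (Fin N) ℝ → ℂ}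
    (hP : ∀ j A, A.IsHermitian → HasDerivAt (fun s : ℝ => P (A + s • symDir N k j)) (P' j A) 0)
    (hb : BddMeas N P) (hb' : ∀ j, BddMeas N (P' j))
    {f : Matrix (Fin N) (Fin N) ℝ → ℝ} (hf : BddMeas N fun A => (f A : ℂ))
    (hbound : ∀ A, A.IsHermitian →
      1 / (N * z.im) * (resolventM N A z k k).im * ‖P A‖ ^ (2 * n + 1) +
        (2 * n + 1) * ‖P A‖ ^ (2 * n) *
          (1 / N * ∑ j, ‖resolventM N A z k j‖ * ‖P' j A‖) ≤ f A) :
    ‖∫ g, errDiag N z k (Mmat N g) * (P (Mmat N g) ^ n *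
      (starRingEnd ℂ) (P (Mmat N g)) ^ (n + 1)) ∂(gMeasure N)‖ ≤
      ∫ g, f (Mmat N g) ∂(gMeasure N) := by
  have hPb : BddMeas N fun A => P A ^ n * (starRingEnd ℂ) (P A) ^ (n + 1) :=
    (hb.pow n).mul (hb.conj.pow (n + 1))
  have hPb' : ∀ j, BddMeas N fun A => (n * P A ^ (n - 1) * P' j A) *
      (starRingEnd ℂ) (P A) ^ (n + 1) + P A ^ n * (((n + 1 : ℕ) : ℂ) *
      (starRingEnd ℂ) (P A) ^ n * (starRingEnd ℂ) (P' j A)) := fun j =>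
    ((((BddMeas.const _).mul (hb.pow _)).mul (hb' j)).mul (hb.conj.pow _)).add
      ((hb.pow n).mul (((BddMeas.const _).mul (hb.conj.pow n)).mul (hb' j).conj))
  refine (errDiag_integral_bound hz k (F := fun A => P A ^ n * (starRingEnd ℂ) (P A) ^ (n + 1))
    (F' := fun j A => (n * P A ^ (n - 1) * P' j A) *
      (starRingEnd ℂ) (P A) ^ (n + 1) + P A ^ n * (((n + 1 : ℕ) : ℂ) *
      (starRingEnd ℂ) (P A) ^ n * (starRingEnd ℂ) (P' j A))) ?_ hPb hPb').trans ?_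
  · intro j A hA
    have := hasDerivAt_pow_mul_conj_pow (hP j A hA) n
    simpa only [zero_smul, add_zero] using this
  · refine integral_mono ?_ hf.integrable_of_real fun g => ?_
    · refine BddMeas.integrable_of_real (f := fun A =>
        1 / (N * z.im) * (resolventM N A z k k).im *
        ‖P A ^ n * (starRingEnd ℂ) (P A) ^ (n + 1)‖ + 1 / N * ∑ j, ‖resolventM N A z k j‖ *
        ‖(n * P A ^ (n - 1) * P' j A) * (starRingEnd ℂ) (P A) ^ (n + 1) + P A ^ n *
        (((n + 1 : ℕ) : ℂ) * (starRingEnd ℂ) (P A) ^ n * (starRingEnd ℂ) (P' j A))‖) ?_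
      simp only [Complex.ofReal_add, Complex.ofReal_mul, Complex.ofReal_sum]
      exact (((BddMeas.const _).mul (BddMeas.resolvent hz k k).im).mul hPb.norm).add
        ((BddMeas.const _).mul (BddMeas.sum _ fun j _ =>
          (BddMeas.resolvent hz k j).norm.mul (hPb' j).norm))
    · have hA := Mmat_isHermitian N g
      refine le_trans ?_ (hbound _ hA)
      generalize Mmat N g = A at hA
      refine add_le_add ?_ ?_
      · apply le_of_eq
        rw [norm_mul, norm_pow, norm_pow, RCLike.norm_conj]; ring
      · calc _ ≤ 1 / (N : ℝ) * ∑ j, ‖resolventM N A z k j‖ *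
              ((2 * n + 1) * ‖P A‖ ^ (2 * n) * ‖P' j A‖) := by
              gcongr with j _
              exact norm_deriv_pow_mul_conj_pow_le _ _ n
          _ = _ := by
              rw [Finset.mul_sum, Finset.mul_sum, Finset.mul_sum]
              exact Finset.sum_congr rfl fun j _ => by ring

lemma errTrace_eq {N : ℕ} (hN : 0 < N) (z : ℂ) (A : Matrix (Fin N) (Fin N) ℝ) :
    errTrace N z A = (1 / (N : ℂ)) * ∑ k, errDiag N z k A := by
  have hNc : (N : ℂ) ≠ 0 := by exact_mod_cast hN.ne'
  simp only [errDiag, errTrace]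
  rw [Finset.sum_add_distrib, ← Finset.mul_sum]
  have : ∑ k, resolventM N A z k k = N * stTrans N A z := by
    rw [stTrans, Matrix.trace]; field_simp; rfl
  rw [this]; simp; field_simp; ring

lemma bddMeas_errTrace {N : ℕ} {z : ℂ} (hz : 0 < z.im) : BddMeas N (errTrace N z) :=
  ((BddMeas.const 1).add ((BddMeas.const z).mul (BddMeas.stieltjes hz))).add
    ((BddMeas.stieltjes hz).pow 2)

lemma bddMeas_errDiag {N : ℕ} {z : ℂ} (hz : 0 < z.im) (k : Fin N) : BddMeas N (errDiag N z k) :=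
  (BddMeas.const 1).add (((BddMeas.const z).add (BddMeas.stieltjes hz)).mul
    (BddMeas.resolvent hz k k))

lemma stTrans_im_eq {N : ℕ} (z : ℂ) (A : Matrix (Fin N) (Fin N) ℝ) :
    (stTrans N A z).im = 1 / N * ∑ k, (resolventM N A z k k).im := by
  rw [stTrans, show (1 / (N : ℂ)) = ((1 / N : ℝ) : ℂ) by push_cast; rfl, Complex.im_ofReal_mul,
    Matrix.trace, Complex.im_sum]
  rfl

lemma errTrace_moment {N : ℕ} (hN : 0 < N) {z : ℂ} (hz : 0 < z.im) (n : ℕ) :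
    ∫ g, ‖errTrace N z (Mmat N g)‖ ^ (2 * n + 2) ∂(gMeasure N) ≤
    ∫ g, (1 / (N * z.im) * (stTrans N (Mmat N g) z).im *
        ‖errTrace N z (Mmat N g)‖ ^ (2 * n + 1) +
      (2 * n + 1) * ‖errTrace N z (Mmat N g)‖ ^ (2 * n) * (2 * (1 / (N * z.im)) ^ 2 *
        (‖z + 2 * stTrans N (Mmat N g) z‖ * (stTrans N (Mmat N g) z).im))) ∂(gMeasure N) := by
  have hNr : (0 : ℝ) < N := by exact_mod_cast hN
  set P := errTrace N z with hP
  have hb : BddMeas N P := bddMeas_errTrace hz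
  set P' : Fin N → Fin N → Matrix (Fin N) (Fin N) ℝ → ℂ := fun k j A =>
    (z + 2 * stTrans N A z) * (-(2 / (N : ℂ)) * (resolventM N A z * resolventM N A z) k j) with hP'
  have hd : ∀ k j A, A.IsHermitian →
      HasDerivAt (fun s : ℝ => P (A + s • symDir N k j)) (P' k j A) 0 := by
    intro k j A hA
    have h1 := stTrans_hasDerivAt hA hz k j
    have h2 := ((h1.const_mul z).const_add 1).add (h1.fun_pow 2)
    refine h2.congr_deriv ?_
    simp only [zero_smul, add_zero, hP']
    push_cast; ring
  have hb' : ∀ k j, BddMeas N (P' k j) := by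
    intro k j
    refine ((BddMeas.const z).add ((BddMeas.const 2).mul (BddMeas.stieltjes hz))).mul
      ((BddMeas.const _).mul ?_)
    simp only [Matrix.mul_apply]
    exact BddMeas.sum _ fun c _ => (BddMeas.resolvent hz k c).mul (BddMeas.resolvent hz c j)
  set f : Fin N → Matrix (Fin N) (Fin N) ℝ → ℝ := fun k A =>
    1 / (N * z.im) * (resolventM N A z k k).im * ‖P A‖ ^ (2 * n + 1) +
    (2 * n + 1) * ‖P A‖ ^ (2 * n) * (2 * (1 / (N * z.im)) ^ 2 *
        (‖z + 2 * stTrans N A z‖ * (resolventM N A z k k).im)) with hf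
  have hfb : ∀ k, BddMeas N fun A => (f k A : ℂ) := by
    intro k
    simp only [hf, Complex.ofReal_add, Complex.ofReal_mul]
    refine (((BddMeas.const _).mul (BddMeas.resolvent hz k k).im).mul (hb.normReal_pow _)).add
      (((BddMeas.const _).mul (hb.normReal_pow _)).mul ((BddMeas.const _).mul
      (BddMeas.mul (BddMeas.norm ?_) (BddMeas.resolvent hz k k).im)))
    exact (BddMeas.const z).add ((BddMeas.const 2).mul (BddMeas.stieltjes hz))
  have key : ∀ k, _ := fun k => errDiag_moment_bound hz k n (hd k) hb (hb' k) (hfb k) (by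
    intro A hA
    simp only [hf]
    gcongr _ + ?_
    refine mul_le_mul_of_nonneg_left ?_ (by positivity)
    have h1 := resolventM_mul_sq_bound hA hz k
    calc 1 / (N : ℝ) * ∑ j, ‖resolventM N A z k j‖ * ‖P' k j A‖ =
        1 / N * (‖z + 2 * stTrans N A z‖ * (2 / N) * ∑ j, ‖resolventM N A z k j‖ *
          ‖(resolventM N A z * resolventM N A z) k j‖) := by
          congr 1
          rw [Finset.mul_sum]
          refine Finset.sum_congr rfl fun j _ => ?_
          simp only [hP', norm_mul, norm_neg, norm_div, Complex.norm_natCast, Complex.norm_ofNat]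
          ring
      _ ≤ 1 / N * (‖z + 2 * stTrans N A z‖ * (2 / N) *
            ((resolventM N A z k k).im / z.im ^ 2)) := by gcongr
      _ = _ := by field_simp)
  have hbF : BddMeas N fun A => P A ^ n * (starRingEnd ℂ) (P A) ^ (n + 1) :=
    (hb.pow n).mul (hb.conj.pow (n + 1))
  have e1 : ((∫ g, ‖P (Mmat N g)‖ ^ (2 * n + 2) ∂(gMeasure N) : ℝ) : ℂ) =
      (1 / (N : ℂ)) * ∑ k, ∫ g, errDiag N z k (Mmat N g) * (P (Mmat N g) ^ n *
      (starRingEnd ℂ) (P (Mmat N g)) ^ (n + 1)) ∂(gMeasure N) := by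
    rw [← integral_complex_ofReal, ← integral_finsetSum, ← integral_const_mul]
    · congr 1
      ext g
      rw [← Finset.sum_mul, ← mul_assoc, ← errTrace_eq hN, mul_pow_conj_pow]
    · intro k _
      exact ((bddMeas_errDiag hz k).mul hbF).integrable
  have e2 : ∫ g, ‖P (Mmat N g)‖ ^ (2 * n + 2) ∂(gMeasure N) ≤
      1 / N * ∑ k, ∫ g, f k (Mmat N g) ∂(gMeasure N) := by
    have h0 : 0 ≤ ∫ g, ‖P (Mmat N g)‖ ^ (2 * n + 2) ∂(gMeasure N) :=
      integral_nonneg fun g => by positivity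
    rw [← Complex.norm_of_nonneg h0, e1, norm_mul]
    have : ‖(1 / (N : ℂ))‖ = 1 / N := by simp
    rw [this]
    gcongr
    exact (norm_sum_le _ _).trans (Finset.sum_le_sum fun k _ => key k)
  refine e2.trans (le_of_eq ?_)
  rw [← integral_finsetSum _ fun k _ => (hfb k).integrable_of_real, ← integral_const_mul]
  congr 1
  ext g
  simp only [hf, stTrans_im_eq]
  rw [Finset.sum_add_distrib, ← Finset.sum_mul, ← Finset.mul_sum, ← Finset.mul_sum,
    ← Finset.mul_sum, ← Finset.mul_sum]
  ring

lemma errDiag_moment {N : ℕ} {z : ℂ} (hz : 0 < z.im) (k : Fin N) (n : ℕ) :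
    ∫ g, ‖errDiag N z k (Mmat N g)‖ ^ (2 * n + 2) ∂(gMeasure N) ≤
    ∫ g, (1 / (N * z.im) * (resolventM N (Mmat N g) z k k).im *
        ‖errDiag N z k (Mmat N g)‖ ^ (2 * n + 1) +
      (2 * n + 1) * ‖errDiag N z k (Mmat N g)‖ ^ (2 * n) *
        (2 * ‖resolventM N (Mmat N g) z k k‖ * (resolventM N (Mmat N g) z k k).im *
        ((1 / (N * z.im)) ^ 2 + ‖z + stTrans N (Mmat N g) z‖ * (1 / (N * z.im)))))
        ∂(gMeasure N) := by
  have hNr : (0 : ℝ) < N := by exact_mod_cast k.pos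
  set P := errDiag N z k with hP
  have hb : BddMeas N P := bddMeas_errDiag hz k
  set P' : Fin N → Matrix (Fin N) (Fin N) ℝ → ℂ := fun j A =>
    (-(2 / (N : ℂ)) * (resolventM N A z * resolventM N A z) k j) * resolventM N A z k k +
    (z + stTrans N A z) * (-(resolventM N A z k k * resolventM N A z j k +
        resolventM N A z k j * resolventM N A z k k)) with hP'
  have hd : ∀ j A, A.IsHermitian →
      HasDerivAt (fun s : ℝ => P (A + s • symDir N k j)) (P' j A) 0 := by
    intro j A hA
    have h1 := (stTrans_hasDerivAt hA hz k j).const_add z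
    have h2 := (h1.mul (resolventM_hasDerivAt hA hz k j k k)).const_add 1
    simp only [zero_smul, add_zero] at h2
    exact h2
  have hb' : ∀ j, BddMeas N (P' j) := by
    intro j
    have bG := fun a b : Fin N => BddMeas.resolvent hz a b
    refine BddMeas.add (((BddMeas.const _).mul ?_).mul (bG k k))
      (((BddMeas.const z).add (BddMeas.stieltjes hz)).mul
        (((bG k k).mul (bG j k)).add ((bG k j).mul (bG k k))).neg)
    simp only [Matrix.mul_apply]
    exact BddMeas.sum _ fun c _ => (bG k c).mul (bG c j)
  set f : Matrix (Fin N) (Fin N) ℝ → ℝ := fun A =>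
    1 / (N * z.im) * (resolventM N A z k k).im * ‖P A‖ ^ (2 * n + 1) +
    (2 * n + 1) * ‖P A‖ ^ (2 * n) *
      (2 * ‖resolventM N A z k k‖ * (resolventM N A z k k).im *
        ((1 / (N * z.im)) ^ 2 + ‖z + stTrans N A z‖ * (1 / (N * z.im)))) with hf
  have hfb : BddMeas N fun A => (f A : ℂ) := by
    have bG := BddMeas.resolvent (N := N) hz k k
    simp only [hf, Complex.ofReal_add, Complex.ofReal_mul]
    exact (((BddMeas.const _).mul bG.im).mul (hb.normReal_pow _)).add
      (((BddMeas.const _).mul (hb.normReal_pow _)).mul ((((BddMeas.const _).mul bG.norm).mul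
      bG.im).mul ((BddMeas.const _).add
        (((BddMeas.const z).add (BddMeas.stieltjes hz)).norm.mul (BddMeas.const _)))))
  have key := errDiag_moment_bound hz k n hd hb hb' hfb (by
    intro A hA
    simp only [hf]
    gcongr _ + ?_
    refine mul_le_mul_of_nonneg_left ?_ (by positivity)
    have h1 := resolventM_mul_sq_bound hA hz k
    have h2 := resolventM_ward hA hz k
    set G := resolventM N A z
    have h3 : ∀ j, ‖G k j‖ * ‖P' j A‖ ≤ ‖G k k‖ * (2 / N) * (‖G k j‖ * ‖(G * G) k j‖) +
        2 * ‖z + stTrans N A z‖ * ‖G k k‖ * ‖G k j‖ ^ 2 := by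
      intro j
      have : P' j A = (-(2 / (N : ℂ)) * (G * G) k j) * G k k +
          (z + stTrans N A z) * (-(2 * (G k k * G k j))) := by
        simp only [hP']
        rw [resolventM_symm hA hz j k]; ring
      rw [this]
      calc _ ≤ ‖G k j‖ * (‖(-(2 / (N : ℂ)) * (G * G) k j) * G k k‖ +
            ‖(z + stTrans N A z) * (-(2 * (G k k * G k j)))‖) := by
            gcongr; exact norm_add_le _ _
        _ = _ := by
            simp only [norm_mul, norm_neg, norm_div, Complex.norm_natCast, Complex.norm_ofNat]
            ring
    calc 1 / (N : ℝ) * ∑ j, ‖G k j‖ * ‖P' j A‖ ≤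
        1 / N * ∑ j, (‖G k k‖ * (2 / N) * (‖G k j‖ * ‖(G * G) k j‖) +
        2 * ‖z + stTrans N A z‖ * ‖G k k‖ * ‖G k j‖ ^ 2) := by
          gcongr with j _; exact h3 j
      _ = 1 / N * (‖G k k‖ * (2 / N) * (∑ j, ‖G k j‖ * ‖(G * G) k j‖) +
        2 * ‖z + stTrans N A z‖ * ‖G k k‖ * ((G k k).im / z.im)) := by
          rw [Finset.sum_add_distrib, ← Finset.mul_sum, ← Finset.mul_sum, h2]
      _ ≤ 1 / N * (‖G k k‖ * (2 / N) * ((G k k).im / z.im ^ 2) +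
        2 * ‖z + stTrans N A z‖ * ‖G k k‖ * ((G k k).im / z.im)) := by gcongr
      _ = _ := by field_simp)
  refine le_trans (le_of_eq ?_) key
  have h0 : 0 ≤ ∫ g, ‖P (Mmat N g)‖ ^ (2 * n + 2) ∂(gMeasure N) :=
    integral_nonneg fun g => by positivity
  rw [← Complex.norm_of_nonneg h0, ← integral_complex_ofReal]
  congr 2
  ext g
  rw [← mul_pow_conj_pow]

section

/-- Relations between the dimension `N`, the small scale `X = N^{-1/10}` and the
slowly growing factor `T`. -/
structure ScaleParams (N : ℕ) (X T : ℝ) : Prop where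
  X_pos : 0 < X
  N_eq : (N : ℝ) * X ^ 10 = 1
  T_large : 10 ^ 6 ≤ T
  X_small : X * T ^ 100 ≤ 1
  log_le : 1 + 4 * Real.log N ≤ T

namespace ScaleParams

variable {N : ℕ} {X T : ℝ}

lemma T_pos (hp : ScaleParams N X T) : 0 < T := by linarith [hp.T_large]

lemma one_le_T (hp : ScaleParams N X T) : 1 ≤ T := by linarith [hp.T_large]

lemma X_mul_pow_le (hp : ScaleParams N X T) {k : ℕ} (hk : k ≤ 100) : X * T ^ k ≤ 1 :=
  (mul_le_mul_of_nonneg_left (pow_le_pow_right₀ hp.one_le_T hk) hp.X_pos.le).trans hp.X_small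

lemma X_le (hp : ScaleParams N X T) : X ≤ 1 / 10 ^ 6 := by
  have h := hp.X_mul_pow_le (k := 1) (by norm_num)
  have := mul_le_mul_of_nonneg_left hp.T_large hp.X_pos.le
  rw [le_div_iff₀ (by norm_num)]; linarith

lemma N_pos (hp : ScaleParams N X T) : 0 < N := by
  rcases Nat.eq_zero_or_pos N with h | h
  · have := hp.N_eq; simp [h] at this
  · exact h

lemma Nr_pos (hp : ScaleParams N X T) : (0 : ℝ) < N := by exact_mod_cast hp.N_pos

lemma one_div_N_mul (hp : ScaleParams N X T) : 1 / ((N : ℝ) * X ^ 9) = X := by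
  have := hp.X_pos
  have := hp.Nr_pos
  rw [div_eq_iff (by positivity)]
  linarith [hp.N_eq]

end ScaleParams

lemma quad_bounds {r E η a y A B : ℝ} (hE : 0 ≤ E) (hη : 0 ≤ η) (hr : 0 ≤ r)
    (hA : 0 ≤ A) (hB : B = 2 * r + E * η)
    (h1 : y ^ 2 - a ^ 2 ≤ A) (h2 : |a * y| ≤ B) :
    y ^ 2 ≤ A + B ∧ y * √(a ^ 2 + y ^ 2) ≤ A + 2 * B := by
  have hB0 : 0 ≤ B := by rw [hB]; positivity
  have h3 : (a * y) ^ 2 ≤ B ^ 2 := by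
    rw [← sq_abs]; gcongr
  have h4 : y ^ 2 ≤ A + B := by
    by_contra! h
    have : B < y ^ 2 - A := by linarith
    have h5 : (A + B) * B < y ^ 2 * (y ^ 2 - A) := by
      apply mul_lt_mul'' h this <;> positivity
    nlinarith [mul_le_mul_of_nonneg_left h1 (sq_nonneg y), mul_nonneg hA hB0]
  refine ⟨h4, ?_⟩
  apply le_of_sq_le_sq _ (by positivity)
  rw [mul_pow, Real.sq_sqrt (by positivity)]
  have h6 : (y ^ 2) ^ 2 ≤ (A + B) ^ 2 := by gcongr
  nlinarith [mul_nonneg hA hB0, sq_nonneg B]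

lemma errTrace_quad_bounds {N : ℕ} {X E : ℝ} (hX : 0 < X) (hX1 : X ≤ 1 / 100)
    (hE1 : 2 - 2 * X ^ 3 ≤ E) (hE2 : E * X ^ 6 ≤ 2) (A : Matrix (Fin N) (Fin N) ℝ)
    {z : ℂ} (hz : z = ⟨E, X ^ 9⟩) (him : 0 ≤ (stTrans N A z).im) :
    (2 * (stTrans N A z).im + X ^ 9) ^ 2 ≤ 6 * ‖errTrace N z A‖ + X ^ 2 ∧
    (2 * (stTrans N A z).im + X ^ 9) * ‖z + 2 * stTrans N A z‖ ≤
      8 * ‖errTrace N z A‖ + X ^ 2 := by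
  set m := stTrans N A z with hm
  set P := errTrace N z A with hP
  set r := ‖P‖
  have hX3 : X ^ 3 ≤ 1 / 100 * X ^ 2 := by
    rw [show X ^ 3 = X * X ^ 2 by ring]; gcongr
  have hX30 : X ^ 3 ≤ 1 := pow_le_one₀ hX.le (by linarith)
  have hE0 : 0 ≤ E := by linarith
  have hu : (z + 2 * m) * (z + 2 * m) = 4 * P + (z * z - 4) := by
    rw [hP, errTrace, ← hm]; ring
  have hre : (z + 2 * m).re = E + 2 * m.re := by simp [hz]
  have him' : (z + 2 * m).im = 2 * m.im + X ^ 9 := by simp [hz]; ring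
  set a := (z + 2 * m).re with ha
  set y := 2 * m.im + X ^ 9 with hy
  have hy0 : 0 ≤ y := by positivity
  have hX18 : (X ^ 9) ^ 2 ≤ X ^ 3 := by
    rw [← pow_mul]; exact pow_le_pow_of_le_one hX.le (by linarith) (by norm_num)
  have hEη : E * X ^ 9 ≤ 2 * X ^ 3 := by
    rw [show E * X ^ 9 = E * X ^ 6 * X ^ 3 by ring]; gcongr
  have hPre := Complex.abs_re_le_norm P
  have hPim := Complex.abs_im_le_norm P
  have hr1 : a ^ 2 - y ^ 2 = 4 * P.re + (E ^ 2 - (X ^ 9) ^ 2 - 4) := by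
    have := congrArg Complex.re hu
    rw [Complex.mul_re, ← ha, him'] at this
    simp [hz] at this
    linarith
  have hi1 : a * y = 2 * P.im + E * X ^ 9 := by
    have := congrArg Complex.im hu
    rw [Complex.mul_im, ← ha, him'] at this
    simp [hz] at this
    linarith
  have hE4 : -(8 * X ^ 3) ≤ E ^ 2 - 4 := by nlinarith [pow_pos hX 3]
  have hnorm : ‖z + 2 * m‖ = √(a ^ 2 + y ^ 2) := by
    rw [← Real.sqrt_sq (norm_nonneg (z + 2 * m)), ← Complex.normSq_eq_norm_sq,
      Complex.normSq_apply, ← ha, him']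
    congr 1; ring
  rw [abs_le] at hPre hPim
  obtain ⟨k1, k2⟩ := quad_bounds (r := r) (E := E) (η := X ^ 9) (a := a) (y := y)
    (A := 4 * r + 8 * X ^ 3 + (X ^ 9) ^ 2) (B := 2 * r + E * X ^ 9) hE0 (by positivity)
    (norm_nonneg _) (by positivity) rfl (by linarith)
    (by
      rw [hi1, abs_le]
      have : 0 ≤ E * X ^ 9 := by positivity
      constructor <;> linarith)
  rw [hnorm]
  have := sq_nonneg X
  constructor <;> linarith

lemma moment_absorb {r s X y v u K : ℝ} (n : ℕ) (hX : 0 ≤ X) (hr : 0 ≤ r)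
    (hv0 : 0 ≤ v) (hK : K = 36 * (2 * n + 1)) (hrs : r ≤ s)
    (hXs : K * X ^ 2 ≤ s) (h1 : y ^ 2 ≤ 6 * r + X ^ 2) (h2 : y * u ≤ 8 * r + X ^ 2)
    (hv : v ≤ y / 2) (hu : 0 ≤ u) :
    X * v * r ^ (2 * n + 1) + (2 * n + 1) * r ^ (2 * n) * (2 * X ^ 2 * (u * v)) ≤
      1 / 2 * s ^ (2 * n + 2) := by
  have hy : 0 ≤ y := by linarith
  have hs : 0 ≤ s := hr.trans hrs
  have hn : (0 : ℝ) ≤ n := n.cast_nonneg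
  have hXs1 : 36 * X ^ 2 ≤ s := by
    refine le_trans ?_ hXs
    rw [hK]; nlinarith [sq_nonneg X, mul_nonneg hn (sq_nonneg X)]
  have hXy : X * y ≤ s / 2 := by
    apply le_of_sq_le_sq _ (by positivity)
    have : X ^ 2 * y ^ 2 ≤ (s / 36) * (7 * s) := by
      apply mul_le_mul <;> first | positivity | nlinarith [sq_nonneg X]
    nlinarith [sq_nonneg s]
  have hXv : X * v ≤ s / 4 := by
    have := mul_le_mul_of_nonneg_left hv hX
    linarith
  have huv : u * v ≤ 9 / 2 * s := by
    have := mul_le_mul_of_nonneg_left hv hu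
    nlinarith [sq_nonneg X]
  have e1 : X * v * r ^ (2 * n + 1) ≤ s / 4 * s ^ (2 * n + 1) := by
    gcongr
  have e2 : (2 * n + 1) * r ^ (2 * n) * (2 * X ^ 2 * (u * v)) ≤
      (2 * n + 1) * s ^ (2 * n) * (2 * X ^ 2 * (9 / 2 * s)) := by
    gcongr
  have e3 : (2 * n + 1) * s ^ (2 * n) * (2 * X ^ 2 * (9 / 2 * s)) =
      (K * X ^ 2) * (1 / 4 * s ^ (2 * n + 1)) := by rw [hK]; ring
  have e4 : (K * X ^ 2) * (1 / 4 * s ^ (2 * n + 1)) ≤ s * (1 / 4 * s ^ (2 * n + 1)) := by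
    gcongr
  calc _ ≤ s / 4 * s ^ (2 * n + 1) + s * (1 / 4 * s ^ (2 * n + 1)) := by linarith
    _ = _ := by ring

lemma BddMeas.integrable_norm_pow {N : ℕ} {F : Matrix (Fin N) (Fin N) ℝ → ℂ} (hF : BddMeas N F)
    (p : ℕ) : Integrable (fun g => ‖F (Mmat N g)‖ ^ p) (gMeasure N) :=
  BddMeas.integrable_of_real (f := fun A => ‖F A‖ ^ p) (by
    simpa only [Complex.ofReal_pow] using hF.norm.pow p)

lemma max_pow_le_add {r c : ℝ} (hr : 0 ≤ r) (hc : 0 ≤ c) (p : ℕ) :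
    max r c ^ p ≤ r ^ p + c ^ p := by
  rcases max_choice r c with h | h <;> rw [h]
  · linarith [pow_nonneg hc p]
  · linarith [pow_nonneg hr p]

lemma BddMeas.tail_of_moment {N : ℕ} {F : Matrix (Fin N) (Fin N) ℝ → ℂ} (hF : BddMeas N F)
    {p : ℕ} {L T C : ℝ} (hL : 0 < L) (hT : 0 < T)
    (h : ∫ g, ‖F (Mmat N g)‖ ^ p ∂(gMeasure N) ≤ C * L ^ p) :
    (gMeasure N).real {g | T * L < ‖F (Mmat N g)‖} ≤ C * T⁻¹ ^ p := by
  have h1 := mul_meas_ge_le_integral_of_nonneg (μ := gMeasure N)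
    (ae_of_all _ fun g => pow_nonneg (norm_nonneg (F (Mmat N g))) p) (hF.integrable_norm_pow p)
    ((T * L) ^ p)
  have h2 : (gMeasure N).real {g | T * L < ‖F (Mmat N g)‖} ≤
      (gMeasure N).real {g | (T * L) ^ p ≤ ‖F (Mmat N g)‖ ^ p} := by
    apply measureReal_mono _ (measure_ne_top _ _)
    intro g hg
    simp only [Set.mem_ofPred_eq] at hg ⊢
    gcongr
  have h3 : (T * L) ^ p * (gMeasure N).real {g | T * L < ‖F (Mmat N g)‖} ≤ C * L ^ p :=
    (mul_le_mul_of_nonneg_left h2 (by positivity)).trans (h1.trans h)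
  have : 0 < (T * L) ^ p := by positivity
  rw [inv_pow, ← div_eq_mul_inv, le_div_iff₀ (by positivity)]
  have hLp : 0 < L ^ p := by positivity
  rw [mul_pow] at h3
  nlinarith

lemma errTrace_tail {N : ℕ} {X T : ℝ} (hp : ScaleParams N X T) {E : ℝ}
    (hE1 : 2 - 2 * X ^ 3 ≤ E) (hE2 : E * X ^ 6 ≤ 2) {n : ℕ} (hn : 36 * (2 * n + 1) ≤ T) :
    (gMeasure N).real {g | T ^ 2 * X ^ 2 < ‖errTrace N ⟨E, X ^ 9⟩ (Mmat N g)‖} ≤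
      T⁻¹ ^ (2 * n + 2) := by
  have hX := hp.X_pos
  set z : ℂ := ⟨E, X ^ 9⟩ with hz
  have hzi : 0 < z.im := by simp only [hz]; positivity
  have hb := bddMeas_errTrace (N := N) hzi
  have h1 := errTrace_moment hp.N_pos hzi n
  rw [show z.im = X ^ 9 from rfl, hp.one_div_N_mul] at h1
  set K : ℝ := 36 * (2 * n + 1) with hK
  have hK0 : 0 < K := by positivity
  have h2 : ∫ g, (X * (stTrans N (Mmat N g) z).im *
        ‖errTrace N z (Mmat N g)‖ ^ (2 * n + 1) +
      (2 * n + 1) * ‖errTrace N z (Mmat N g)‖ ^ (2 * n) * (2 * X ^ 2 *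
        (‖z + 2 * stTrans N (Mmat N g) z‖ * (stTrans N (Mmat N g) z).im))) ∂(gMeasure N) ≤
      ∫ g, 1 / 2 * (‖errTrace N z (Mmat N g)‖ ^ (2 * n + 2) + (K * X ^ 2) ^ (2 * n + 2))
        ∂(gMeasure N) := by
    apply integral_mono_of_nonneg
    · refine ae_of_all _ fun g => ?_
      have := stTrans_im_nonneg (Mmat_isHermitian N g) hzi
      positivity
    · exact ((hb.integrable_norm_pow _).add (integrable_const _)).const_mul _
    · refine ae_of_all _ fun g => ?_
      have him := stTrans_im_nonneg (Mmat_isHermitian N g) hzi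
      obtain ⟨k1, k2⟩ := errTrace_quad_bounds hX (hp.X_le.trans (by norm_num)) hE1 hE2
        (Mmat N g) hz him
      refine (moment_absorb n hX.le (norm_nonneg _) him hK (le_max_left _ _)
        (le_max_right _ (K * X ^ 2)) k1 k2 ?_ (norm_nonneg _)).trans ?_
      · have : 0 < X ^ 9 := by positivity
        linarith
      · refine mul_le_mul_of_nonneg_left ?_ (by norm_num)
        exact max_pow_le_add (norm_nonneg _) (by positivity) _
  have h3 := h1.trans h2
  rw [integral_const_mul, integral_add (hb.integrable_norm_pow _) (integrable_const _)] at h3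
  simp only [integral_const, probReal_univ, one_smul] at h3
  have h4 : ∫ g, ‖errTrace N z (Mmat N g)‖ ^ (2 * n + 2) ∂(gMeasure N) ≤
      1 * (T * X ^ 2) ^ (2 * n + 2) := by
    have : (K * X ^ 2) ^ (2 * n + 2) ≤ (T * X ^ 2) ^ (2 * n + 2) := by gcongr
    linarith
  have := hb.tail_of_moment (by have := hp.T_pos; positivity) hp.T_pos h4
  rw [one_mul, ← mul_assoc, ← sq] at this
  exact this

end

section

/-- Equally spaced energies above `2 - 2X³` with spacing a quarter of the spectral scale. -/
def gridPt (X : ℝ) (l : ℕ) : ℝ := 2 - 2 * X ^ 3 + l * (X ^ 9 / 4)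

/-- `E` is a grid energy of polynomially bounded index and size. -/
def IsGridPt (N : ℕ) (X E : ℝ) : Prop := (∃ l, l < N ^ 2 ∧ E = gridPt X l) ∧ E * X ^ 6 ≤ 2

/-- `A` has polynomially bounded spectrum and its Stieltjes transform nearly solves the
semicircle equation at all grid energies. -/
structure TraceRegular (N : ℕ) (X T : ℝ) (A : Matrix (Fin N) (Fin N) ℝ) (lam : Fin N → ℝ)
    (u : Fin N → Fin N → ℝ) : Prop where
  params : ScaleParams N X T
  herm : A.IsHermitian
  spec : SpecData A lam u
  eig : ∀ j, |lam j| * X ^ 6 ≤ 1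
  err : ∀ E, IsGridPt N X E → ‖errTrace N ⟨E, X ^ 9⟩ A‖ ≤ T ^ 2 * X ^ 2

lemma ScaleParams.exists_gridPt {N : ℕ} {X T x : ℝ} (hp : ScaleParams N X T)
    (h1 : 2 - 2 * X ^ 3 ≤ x) (h2 : x * X ^ 6 ≤ 2) :
    ∃ E, IsGridPt N X E ∧ E ≤ x ∧ x < E + X ^ 9 / 4 := by
  have hX := hp.X_pos
  have hX1 := hp.X_le
  have hη : 0 < X ^ 9 / 4 := by positivity
  have h0 : 0 ≤ (x - (2 - 2 * X ^ 3)) / (X ^ 9 / 4) := by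
    apply div_nonneg _ hη.le; linarith
  set l := ⌊(x - (2 - 2 * X ^ 3)) / (X ^ 9 / 4)⌋₊ with hl
  have hl1 : (l : ℝ) * (X ^ 9 / 4) ≤ x - (2 - 2 * X ^ 3) := by
    rw [← le_div_iff₀ hη]; exact Nat.floor_le h0
  have hl2 : x - (2 - 2 * X ^ 3) < (l + 1) * (X ^ 9 / 4) := by
    rw [← div_lt_iff₀ hη]; exact Nat.lt_floor_add_one _
  have hle : gridPt X l ≤ x := by unfold gridPt; linarith
  refine ⟨gridPt X l, ⟨⟨l, ?_, rfl⟩, ?_⟩, hle, ?_⟩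
  · have hX3 : X ^ 3 ≤ 1 := pow_le_one₀ hX.le (by linarith)
    have hlx : (l : ℝ) * X ^ 15 ≤ 8 := by
      have : (l : ℝ) * (X ^ 9 / 4) * X ^ 6 ≤ x * X ^ 6 := by gcongr; linarith
      nlinarith
    have hN20 : ((N : ℝ) ^ 2) * X ^ 20 = 1 := by
      have := hp.N_eq
      calc (N : ℝ) ^ 2 * X ^ 20 = (N * X ^ 10) ^ 2 := by ring
        _ = 1 := by rw [this]; norm_num
    have : (l : ℝ) < (N : ℝ) ^ 2 := by
      by_contra! h
      have h5 : X ^ 5 ≤ 1 / 10 ^ 6 := by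
        calc X ^ 5 ≤ X ^ 1 := pow_le_pow_of_le_one hX.le (by linarith) (by norm_num)
          _ ≤ _ := by simpa using hX1
      have : (1 : ℝ) ≤ l * X ^ 15 * X ^ 5 := by
        calc (1 : ℝ) = (N : ℝ) ^ 2 * X ^ 20 := hN20.symm
          _ ≤ l * X ^ 20 := by gcongr
          _ = _ := by ring
      have : l * X ^ 15 * X ^ 5 ≤ 8 * (1 / 10 ^ 6) := by gcongr
      norm_num at this; linarith
    exact_mod_cast this
  · exact (mul_le_mul_of_nonneg_right hle (by positivity)).trans h2
  · unfold gridPt; linarith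

lemma IsGridPt.ge {N : ℕ} {X E : ℝ} (h : IsGridPt N X E) (hX : 0 < X) : 2 - 2 * X ^ 3 ≤ E := by
  obtain ⟨⟨l, _, rfl⟩, _⟩ := h
  unfold gridPt
  have : 0 ≤ (l : ℝ) * (X ^ 9 / 4) := by positivity
  linarith

lemma SpecData.stTrans_im {N : ℕ} {A : Matrix (Fin N) (Fin N) ℝ} {lam : Fin N → ℝ}
    {u : Fin N → Fin N → ℝ} (h : SpecData A lam u) {z : ℂ} (hz : z.im ≠ 0) :
    (stTrans N A z).im = 1 / N * ∑ j, z.im / ((lam j - z.re) ^ 2 + z.im ^ 2) := by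
  rw [h.stTrans_eq hz, show (1 / (N : ℂ)) = ((1 / N : ℝ) : ℂ) by push_cast; rfl,
    Complex.im_ofReal_mul, Complex.im_sum]
  simp_rw [inv_sub_im]

/-- Harmonic bound from a uniform count of points per bin. -/
lemma sum_one_div_le_of_bins {ι : Type*} (s : Finset ι) (y : ι → ℝ) {η ν C : ℝ} (K : ℕ)
    (hη : 0 < η) (hν : 0 < ν) (hC : 0 ≤ C) (hy : ∀ j ∈ s, 0 ≤ y j) (hyK : ∀ j ∈ s, y j < K * η)
    (hbin : ∀ k : ℕ, ((s.filter fun j => k * η ≤ y j ∧ y j ≤ k * η + η).card : ℝ) ≤ C) :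
    ∑ j ∈ s, 1 / (y j + ν) ≤ C / ν + C / η * (1 + Real.log K) := by
  classical
  have hmap : ∀ j ∈ s, ⌊y j / η⌋₊ ∈ Finset.range (K + 1) := by
    intro j hj
    rw [Finset.mem_range, Nat.floor_lt (by have := hy j hj; positivity), div_lt_iff₀ hη]
    push_cast
    linarith [hyK j hj]
  rw [← Finset.sum_fiberwise_of_maps_to hmap]
  have hb : ∀ k ∈ Finset.range (K + 1), ∑ j ∈ s with ⌊y j / η⌋₊ = k, 1 / (y j + ν) ≤
      C * (1 / (k * η + ν)) := by
    intro k _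
    calc _ ≤ ∑ j ∈ s with ⌊y j / η⌋₊ = k, 1 / (k * η + ν) := by
          refine Finset.sum_le_sum fun j hj => ?_
          rw [Finset.mem_filter] at hj
          have h1 := Nat.floor_le (div_nonneg (hy j hj.1) hη.le)
          rw [hj.2, le_div_iff₀ hη] at h1
          gcongr
      _ ≤ _ := by
          rw [Finset.sum_const, nsmul_eq_mul]
          gcongr
          refine le_trans ?_ (hbin k)
          norm_cast
          refine Finset.card_le_card fun j hj => ?_
          rw [Finset.mem_filter] at hj ⊢
          have h1 := Nat.floor_le (div_nonneg (hy j hj.1) hη.le)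
          have h2 := Nat.lt_floor_add_one (y j / η)
          rw [hj.2, le_div_iff₀ hη] at h1
          rw [hj.2, div_lt_iff₀ hη] at h2
          exact ⟨hj.1, h1, by linarith⟩
  refine (Finset.sum_le_sum hb).trans ?_
  rw [Finset.sum_range_succ', add_comm]
  have h1 : ∑ k ∈ Finset.range K, C * (1 / (((k + 1 : ℕ) : ℝ) * η + ν)) ≤
      ∑ k ∈ Finset.range K, C / η * (((k + 1 : ℕ) : ℝ))⁻¹ := by
    refine Finset.sum_le_sum fun k _ => ?_
    calc _ ≤ C * (1 / (((k + 1 : ℕ) : ℝ) * η)) := by gcongr; linarith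
      _ = _ := by push_cast; field_simp
  have h2 := harmonic_le_one_add_log K
  rw [harmonic] at h2
  push_cast at h2
  push_cast at h1
  rw [← Finset.mul_sum (f := fun k : ℕ => ((k : ℝ) + 1)⁻¹)] at h1
  have h3 := mul_le_mul_of_nonneg_left h2 (div_nonneg hC hη.le)
  simp only [Nat.cast_zero, zero_mul, zero_add, mul_one_div] at h1 ⊢
  push_cast
  linarith

namespace TraceRegular

variable {N : ℕ} {X T E : ℝ} {A : Matrix (Fin N) (Fin N) ℝ} {lam : Fin N → ℝ}
  {u : Fin N → Fin N → ℝ}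

lemma im_le (h : TraceRegular N X T A lam u) (hE : IsGridPt N X E) :
    (stTrans N A ⟨E, X ^ 9⟩).im ≤ 2 * (T * X) := by
  have hX := h.params.X_pos
  have hT := h.params.one_le_T
  have him := stTrans_im_nonneg h.herm (z := ⟨E, X ^ 9⟩) (by simp; positivity)
  obtain ⟨h1, -⟩ := errTrace_quad_bounds hX (h.params.X_le.trans (by norm_num)) (hE.ge hX) hE.2 A
    rfl him
  have h2 := h.err E hE
  have h9 : 0 < X ^ 9 := by positivity
  have h3 : (2 * (stTrans N A ⟨E, X ^ 9⟩).im) ^ 2 ≤ (4 * (T * X)) ^ 2 := by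
    have hTX : X ^ 2 ≤ T ^ 2 * X ^ 2 := le_mul_of_one_le_left (sq_nonneg X) (one_le_pow₀ hT)
    calc _ ≤ (2 * (stTrans N A ⟨E, X ^ 9⟩).im + X ^ 9) ^ 2 := by gcongr; linarith
      _ ≤ _ := by nlinarith
  have h4 := le_of_sq_le_sq h3 (by positivity)
  linarith

lemma card_near_le (h : TraceRegular N X T A lam u) (hE : IsGridPt N X E) :
    ((Finset.univ.filter fun j => |lam j - E| ≤ X ^ 9).card : ℝ) ≤ 4 * T := by
  have hX := h.params.X_pos
  have hη : 0 < X ^ 9 := by positivity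
  have hN := h.params.Nr_pos
  have h1 := h.im_le hE
  rw [h.spec.stTrans_im (by simpa using hη.ne')] at h1
  simp only at h1
  have h2 : ((Finset.univ.filter fun j => |lam j - E| ≤ X ^ 9).card : ℝ) * (1 / (2 * X ^ 9)) ≤
      ∑ j, X ^ 9 / ((lam j - E) ^ 2 + (X ^ 9) ^ 2) := by
    rw [← nsmul_eq_mul, ← Finset.sum_const]
    refine (Finset.sum_le_sum fun j hj => ?_).trans
      (Finset.sum_le_univ_sum_of_nonneg fun j => by positivity)
    rw [Finset.mem_filter] at hj
    have : (lam j - E) ^ 2 ≤ (X ^ 9) ^ 2 := by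
      rw [← sq_abs]; gcongr; exact hj.2
    rw [div_le_div_iff₀ (by positivity) (by positivity)]
    nlinarith
  have h3 : 1 / (N : ℝ) = X ^ 10 := by
    rw [div_eq_iff hN.ne']; linarith [h.params.N_eq]
  rw [h3] at h1
  have h4 := mul_le_mul_of_nonneg_left h2 (by positivity : 0 ≤ X ^ 10)
  have h5 : X ^ 10 * (((Finset.univ.filter fun j => |lam j - E| ≤ X ^ 9).card : ℝ) *
      (1 / (2 * X ^ 9))) =
      X / 2 * ((Finset.univ.filter fun j => |lam j - E| ≤ X ^ 9).card : ℝ) := by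
    field_simp
  rw [h5] at h4
  have h6 := h4.trans h1
  nlinarith

lemma card_window_le (h : TraceRegular N X T A lam u) (x : ℝ) :
    ((Finset.univ.filter fun j => 2 - X ^ 3 ≤ lam j ∧ x ≤ lam j ∧ lam j ≤ x + X ^ 9).card : ℝ)
      ≤ 4 * T := by
  have hX := h.params.X_pos
  have hX1 := h.params.X_le
  have hT := h.params.T_pos
  have hη : 0 < X ^ 9 := by positivity
  have hη3 : X ^ 9 ≤ X ^ 3 := pow_le_pow_of_le_one hX.le (by linarith) (by norm_num)
  rcases (Finset.univ.filter fun j =>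
    2 - X ^ 3 ≤ lam j ∧ x ≤ lam j ∧ lam j ≤ x + X ^ 9).eq_empty_or_nonempty with he | ⟨i, hi⟩
  · rw [he]; simp; positivity
  rw [Finset.mem_filter] at hi
  obtain ⟨-, hi1, hi2, hi3⟩ := hi
  have hR : x * X ^ 6 ≤ 1 :=
    (mul_le_mul_of_nonneg_right (hi2.trans (le_abs_self _)) (by positivity)).trans (h.eig i)
  have hX15 : X ^ 9 / 2 * X ^ 6 ≤ 1 := by
    have : X ^ 15 ≤ 1 := pow_le_one₀ hX.le (by linarith)
    calc _ = X ^ 15 / 2 := by ring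
      _ ≤ _ := by linarith
  obtain ⟨E, hE, hE1, hE2⟩ := h.params.exists_gridPt (x := x + X ^ 9 / 2) (by linarith)
    (by linarith)
  refine le_trans ?_ (h.card_near_le hE)
  norm_cast
  refine Finset.card_le_card fun j hj => ?_
  rw [Finset.mem_filter] at hj ⊢
  refine ⟨hj.1, ?_⟩
  rw [abs_le]
  constructor <;> linarith [hj.2.2.1, hj.2.2.2]

lemma sum_edge_le (h : TraceRegular N X T A lam u) {x ν : ℝ} (hx : |x| * X ^ 6 ≤ 2)
    (hν : 0 < ν) :
    ∑ j with 2 - X ^ 3 ≤ lam j, 1 / (|lam j - x| + ν) ≤ 8 * T / ν + 8 * T ^ 2 / X ^ 9 := by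
  classical
  have hX := h.params.X_pos
  have hX1 := h.params.X_le
  have hT := h.params.T_pos
  have hη : 0 < X ^ 9 := by positivity
  have hN := h.params.Nr_pos
  have h1 := sum_one_div_le_of_bins (Finset.univ.filter fun j => 2 - X ^ 3 ≤ lam j)
    (fun j => |lam j - x|) (η := X ^ 9) (C := 8 * T) (N ^ 2) hη hν (by positivity)
    (fun j _ => abs_nonneg _) (fun j _ => ?_) (fun k => ?_)
  · refine h1.trans ?_
    have h2 : 1 + Real.log ((N ^ 2 : ℕ) : ℝ) ≤ T := by
      push_cast
      rw [Real.log_pow]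
      have := h.params.log_le
      have h0 : 0 ≤ Real.log N := Real.log_natCast_nonneg N
      push_cast
      linarith
    have h3 : 8 * T / X ^ 9 * (1 + Real.log ((N ^ 2 : ℕ) : ℝ)) ≤ 8 * T / X ^ 9 * T := by
      gcongr
    calc _ ≤ 8 * T / ν + 8 * T / X ^ 9 * T := by linarith
      _ = _ := by ring
  · have h2 : |lam j - x| * X ^ 6 ≤ 3 := by
      have := mul_le_mul_of_nonneg_right (abs_sub (lam j) x) (by positivity : 0 ≤ X ^ 6)
      linarith [h.eig j]
    have h20 : ((N ^ 2 : ℕ) : ℝ) * X ^ 20 = 1 := by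
      push_cast
      calc (N : ℝ) ^ 2 * X ^ 20 = (N * X ^ 10) ^ 2 := by ring
        _ = 1 := by rw [h.params.N_eq]; norm_num
    have h5 : X ^ 5 ≤ 1 / 10 ^ 6 := by
      calc X ^ 5 ≤ X ^ 1 := pow_le_pow_of_le_one hX.le (by linarith) (by norm_num)
        _ ≤ _ := by simpa using hX1
    have h11 : |lam j - x| * X ^ 11 < 1 := by
      calc |lam j - x| * X ^ 11 = |lam j - x| * X ^ 6 * X ^ 5 := by ring
        _ ≤ 3 * (1 / 10 ^ 6) := by gcongr
        _ < 1 := by norm_num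
    have : |lam j - x| * X ^ 11 < ((N ^ 2 : ℕ) : ℝ) * X ^ 9 * X ^ 11 := by
      calc _ < 1 := h11
        _ = _ := by rw [← h20]; ring
    exact lt_of_mul_lt_mul_right this (by positivity)
  · have e1 := h.card_window_le (x + k * X ^ 9)
    have e2 := h.card_window_le (x - k * X ^ 9 - X ^ 9)
    have e3 : ((Finset.univ.filter fun j => 2 - X ^ 3 ≤ lam j).filter fun j =>
        k * X ^ 9 ≤ |lam j - x| ∧ |lam j - x| ≤ k * X ^ 9 + X ^ 9) ⊆
        (Finset.univ.filter fun j => 2 - X ^ 3 ≤ lam j ∧ x + k * X ^ 9 ≤ lam j ∧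
          lam j ≤ x + k * X ^ 9 + X ^ 9) ∪
        (Finset.univ.filter fun j => 2 - X ^ 3 ≤ lam j ∧ x - k * X ^ 9 - X ^ 9 ≤ lam j ∧
          lam j ≤ x - k * X ^ 9 - X ^ 9 + X ^ 9) := by
      intro j hj
      simp only [Finset.mem_filter, Finset.mem_univ, true_and, Finset.mem_union] at hj ⊢
      obtain ⟨hj0, hj1, hj2⟩ := hj
      rcases abs_cases (lam j - x) with ⟨ha, _⟩ | ⟨ha, _⟩ <;> rw [ha] at hj1 hj2
      · left; refine ⟨hj0, ?_, ?_⟩ <;> linarith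
      · right; refine ⟨hj0, ?_, ?_⟩ <;> linarith
    have e4 := (Finset.card_le_card e3).trans (Finset.card_union_le _ _)
    have e5 : (_ : ℝ) ≤ _ := Nat.cast_le.2 e4
    push_cast at e5
    linarith

end TraceRegular

end

section

lemma norm_inv_sub_le_two_div (x : ℝ) {z : ℂ} (hz : 0 < z.im) :
    ‖((x : ℂ) - z)⁻¹‖ ≤ 2 / (|x - z.re| + z.im) := by
  apply le_of_sq_le_sq _ (by positivity)
  rw [norm_inv_sub_sq, div_pow, inv_eq_one_div, div_le_div_iff₀ (by positivity) (by positivity)]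
  nlinarith [sq_abs (x - z.re), sq_nonneg (|x - z.re| - z.im)]

lemma ScaleParams.T_sq_mul_X_le {N : ℕ} {X T : ℝ} (hp : ScaleParams N X T) :
    T ^ 2 * X ≤ 1 / 10 ^ 6 := by
  have h := hp.X_mul_pow_le (k := 3) (by norm_num)
  have := hp.T_large
  have hT := hp.T_pos
  have hX := hp.X_pos
  rw [le_div_iff₀ (by norm_num)]
  calc T ^ 2 * X * 10 ^ 6 ≤ T ^ 2 * X * T := by gcongr
    _ = X * T ^ 3 := by ring
    _ ≤ 1 := h

lemma ScaleParams.inv_eta {N : ℕ} {X T : ℝ} (hp : ScaleParams N X T) :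
    1 / X ^ 9 = N * X := by
  have := hp.X_pos
  rw [div_eq_iff (by positivity)]
  linarith [hp.N_eq]

namespace TraceRegular

variable {N : ℕ} {X T E : ℝ} {A : Matrix (Fin N) (Fin N) ℝ} {lam : Fin N → ℝ}
  {u : Fin N → Fin N → ℝ}

lemma sum_edge_grid_le (h : TraceRegular N X T A lam u) (hE : IsGridPt N X E) :
    ∑ j with 2 - X ^ 3 ≤ lam j, 1 / (|lam j - E| + X ^ 9) ≤ (N : ℝ) / 1000 := by
  have hX := h.params.X_pos
  have hX1 := h.params.X_le
  have hX3 : X ^ 3 ≤ 1 := pow_le_one₀ hX.le (by linarith)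
  have hE0 : 0 ≤ E := by linarith [hE.ge hX]
  have hN := h.params.Nr_pos
  have hT := h.params.one_le_T
  refine (h.sum_edge_le (x := E) (ν := X ^ 9) (by rw [abs_of_nonneg hE0]; exact hE.2)
    (by positivity)).trans ?_
  have h1 : 8 * T / X ^ 9 + 8 * T ^ 2 / X ^ 9 = (8 * T + 8 * T ^ 2) * X * N := by
    have := h.params.inv_eta
    calc _ = (8 * T + 8 * T ^ 2) * (1 / X ^ 9) := by ring
      _ = _ := by rw [this]; ring
  rw [h1]
  have h2 := h.params.T_sq_mul_X_le
  have h3 : T * X ≤ T ^ 2 * X := by gcongr; exact le_self_pow₀ hT (by norm_num)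
  have : (8 * T + 8 * T ^ 2) * X ≤ 1 / 1000 := by
    norm_num at h2; linarith
  calc _ ≤ 1 / 1000 * (N : ℝ) := by gcongr
    _ = _ := by ring

lemma one_le_N_norm (h : TraceRegular N X T A lam u) (hE : IsGridPt N X E) :
    99 / 100 ≤ ‖stTrans N A ⟨E, X ^ 9⟩‖ * ‖⟨E, X ^ 9⟩ + stTrans N A ⟨E, X ^ 9⟩‖ ∧
    ‖stTrans N A ⟨E, X ^ 9⟩‖ * ‖⟨E, X ^ 9⟩ + stTrans N A ⟨E, X ^ 9⟩‖ ≤ 101 / 100 := by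
  have hX := h.params.X_pos
  have hX1 := h.params.X_le
  set z : ℂ := ⟨E, X ^ 9⟩
  set m := stTrans N A z with hm
  have h1 : ‖errTrace N z A‖ ≤ 1 / 100 := by
    refine (h.err E hE).trans ?_
    have h2 := h.params.T_sq_mul_X_le
    calc T ^ 2 * X ^ 2 = T ^ 2 * X * X := by ring
      _ ≤ 1 / 10 ^ 6 * (1 / 10 ^ 6) := by gcongr
      _ ≤ _ := by norm_num
  have h2 : m * (z + m) = errTrace N z A - 1 := by rw [errTrace, ← hm]; ring
  rw [← norm_mul, h2]
  have h3 := norm_sub_norm_le (1 : ℂ) (errTrace N z A)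
  have h4 := norm_sub_le (errTrace N z A) 1
  rw [norm_sub_rev] at h3
  rw [norm_one] at h3 h4
  constructor <;> linarith

lemma norm_gridPt_le (h : TraceRegular N X T A lam u) (hE : IsGridPt N X E) (h3 : E ≤ 3) :
    ‖(⟨E, X ^ 9⟩ : ℂ)‖ ≤ 301 / 100 := by
  have hX := h.params.X_pos
  have hX1 := h.params.X_le
  have hX3 : X ^ 3 ≤ 1 := pow_le_one₀ hX.le (by linarith)
  have hE0 : 0 ≤ E := by linarith [hE.ge hX]
  refine (Complex.norm_le_abs_re_add_abs_im _).trans ?_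
  simp only [abs_of_nonneg hE0]
  rw [abs_of_nonneg (by positivity)]
  have : X ^ 9 ≤ X ^ 1 := pow_le_pow_of_le_one hX.le (by linarith) (by norm_num)
  norm_num at *
  linarith

lemma norm_stTrans_le_two (h : TraceRegular N X T A lam u) (hE : IsGridPt N X E) (h3 : 3 ≤ E) :
    ‖stTrans N A ⟨E, X ^ 9⟩‖ ≤ 2 := by
  classical
  have hX := h.params.X_pos
  have hη : 0 < X ^ 9 := by positivity
  have hκ : 0 < X ^ 3 := by positivity
  have hN := h.params.Nr_pos
  rw [h.spec.stTrans_eq (by simpa using hη.ne'), norm_mul, norm_div, norm_one,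
    Complex.norm_natCast, ← Finset.sum_filter_add_sum_filter_not _ fun j => 2 - X ^ 3 ≤ lam j]
  have h1 : ‖∑ j with 2 - X ^ 3 ≤ lam j, ((lam j : ℂ) - ⟨E, X ^ 9⟩)⁻¹‖ ≤ (N : ℝ) / 500 := by
    refine (norm_sum_le _ _).trans ?_
    calc _ ≤ ∑ j with 2 - X ^ 3 ≤ lam j, 2 * (1 / (|lam j - E| + X ^ 9)) := by
          refine Finset.sum_le_sum fun j _ => ?_
          refine (norm_inv_sub_le_two_div (lam j) (z := ⟨E, X ^ 9⟩) hη).trans (le_of_eq ?_)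
          simp only; ring
      _ ≤ 2 * ((N : ℝ) / 1000) := by
          rw [← Finset.mul_sum]
          have := h.sum_edge_grid_le hE
          gcongr
      _ = _ := by ring
  have h2 : ‖∑ j with ¬ 2 - X ^ 3 ≤ lam j, ((lam j : ℂ) - ⟨E, X ^ 9⟩)⁻¹‖ ≤ N := by
    refine (norm_sum_le _ _).trans ?_
    calc _ ≤ ∑ j with ¬ 2 - X ^ 3 ≤ lam j, (1 : ℝ) := by
          refine Finset.sum_le_sum fun j hj => ?_
          rw [Finset.mem_filter] at hj
          rw [norm_inv]
          refine inv_le_one_of_one_le₀ ?_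
          refine le_trans ?_ (Complex.abs_re_le_norm _)
          simp only [Complex.sub_re, Complex.ofReal_re]
          rw [abs_sub_comm]
          exact le_trans (by linarith [hj.2]) (le_abs_self _)
      _ ≤ ∑ j : Fin N, (1 : ℝ) := Finset.sum_le_univ_sum_of_nonneg fun _ => zero_le_one
      _ = N := by simp
  have h4 := (norm_add_le _ _).trans (add_le_add h1 h2)
  calc _ ≤ 1 / (N : ℝ) * (N / 500 + N) := by gcongr
    _ ≤ 2 := by field_simp; norm_num

lemma norm_stTrans_le (h : TraceRegular N X T A lam u) (hE : IsGridPt N X E) :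
    ‖stTrans N A ⟨E, X ^ 9⟩‖ ≤ 5 := by
  rcases le_total E 3 with h3 | h3
  · by_contra! hm
    have h1 := h.norm_gridPt_le hE h3
    have h2 := (h.one_le_N_norm hE).2
    have h4 := norm_sub_le (⟨E, X ^ 9⟩ + stTrans N A ⟨E, X ^ 9⟩) ⟨E, X ^ 9⟩
    rw [add_sub_cancel_left] at h4
    nlinarith [norm_nonneg (stTrans N A ⟨E, X ^ 9⟩)]
  · linarith [h.norm_stTrans_le_two hE h3]

lemma norm_add_stTrans_ge (h : TraceRegular N X T A lam u) (hE : IsGridPt N X E) :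
    1 / 8 ≤ ‖⟨E, X ^ 9⟩ + stTrans N A ⟨E, X ^ 9⟩‖ := by
  by_contra! hm
  have h4 := norm_sub_le (⟨E, X ^ 9⟩ + stTrans N A ⟨E, X ^ 9⟩) ⟨E, X ^ 9⟩
  rw [add_sub_cancel_left] at h4
  rcases le_total E 3 with h3 | h3
  · have h1 := h.norm_gridPt_le hE h3
    have h2 := (h.one_le_N_norm hE).1
    nlinarith [norm_nonneg (⟨E, X ^ 9⟩ + stTrans N A ⟨E, X ^ 9⟩)]
  · have h1 := h.norm_stTrans_le_two hE h3
    have h5 := norm_sub_le (⟨E, X ^ 9⟩ + stTrans N A ⟨E, X ^ 9⟩) (stTrans N A ⟨E, X ^ 9⟩)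
    rw [add_sub_cancel_right] at h5
    have h6 := (le_abs_self _).trans (Complex.abs_re_le_norm (⟨E, X ^ 9⟩ : ℂ))
    simp only at h6
    linarith

lemma sum_grid_le (h : TraceRegular N X T A lam u) (hE : IsGridPt N X E)
    (hE2 : 2 - X ^ 3 / 2 ≤ E) : ∑ j, 1 / (|lam j - E| + X ^ 9) ≤ 6 * (N : ℝ) := by
  classical
  have hX := h.params.X_pos
  have hX1 := h.params.X_le
  have hη : 0 < X ^ 9 := by positivity
  have hκ : X ^ 9 ≤ X ^ 3 / 2 := by
    have h6 : X ^ 6 ≤ X ^ 1 := pow_le_pow_of_le_one hX.le (by linarith) (by norm_num)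
    have : X ^ 6 ≤ 1 / 2 := by norm_num at *; linarith
    calc X ^ 9 = X ^ 6 * X ^ 3 := by ring
      _ ≤ 1 / 2 * X ^ 3 := by gcongr
      _ = _ := by ring
  have hN := h.params.Nr_pos
  have hzi : (⟨E, X ^ 9⟩ : ℂ).im ≠ 0 := hη.ne'
  set z : ℂ := ⟨E, X ^ 9⟩ with hz
  have hm := h.norm_stTrans_le hE
  have hre : -(stTrans N A z).re ≤ 5 := by
    have := Complex.abs_re_le_norm (stTrans N A z)
    linarith [neg_le_abs (stTrans N A z).re]
  have hmre : (stTrans N A z).re = 1 / N * ∑ j, (lam j - E) / ((lam j - E) ^ 2 + (X ^ 9) ^ 2) := by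
    rw [h.spec.stTrans_eq hzi, show (1 / (N : ℂ)) = ((1 / N : ℝ) : ℂ) by
      push_cast; rfl, Complex.re_ofReal_mul, Complex.re_sum]
    simp_rw [inv_sub_re]
    simp [hz]
  rw [hmre, ← Finset.sum_filter_add_sum_filter_not _ fun j => 2 - X ^ 3 ≤ lam j] at hre
  rw [← Finset.sum_filter_add_sum_filter_not _ fun j => 2 - X ^ 3 ≤ lam j]
  have he := h.sum_edge_grid_le hE
  have h1 : ∑ j with 2 - X ^ 3 ≤ lam j, (lam j - E) / ((lam j - E) ^ 2 + (X ^ 9) ^ 2) ≤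
      2 * ((N : ℝ) / 1000) := by
    refine le_trans ?_ (mul_le_mul_of_nonneg_left he zero_le_two)
    rw [Finset.mul_sum]
    refine Finset.sum_le_sum fun j _ => ?_
    refine (le_abs_self _).trans ?_
    rw [abs_div, abs_of_nonneg (by positivity : 0 ≤ (lam j - E) ^ 2 + (X ^ 9) ^ 2), mul_one_div,
      div_le_div_iff₀ (by positivity) (by positivity)]
    nlinarith [sq_abs (lam j - E), abs_nonneg (lam j - E), sq_nonneg (|lam j - E| - X ^ 9)]
  have h2 : ∑ j with ¬ 2 - X ^ 3 ≤ lam j, 1 / (|lam j - E| + X ^ 9) ≤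
      ∑ j with ¬ 2 - X ^ 3 ≤ lam j, -((lam j - E) / ((lam j - E) ^ 2 + (X ^ 9) ^ 2)) := by
    refine Finset.sum_le_sum fun j hj => ?_
    rw [Finset.mem_filter] at hj
    have hd : X ^ 9 ≤ E - lam j := by linarith [hj.2]
    rw [abs_of_nonpos (by linarith), ← neg_div, div_le_div_iff₀ (by linarith) (by positivity)]
    nlinarith
  rw [Finset.sum_neg_distrib] at h2
  have h3 : -(∑ j with 2 - X ^ 3 ≤ lam j, (lam j - E) / ((lam j - E) ^ 2 + (X ^ 9) ^ 2) +
      ∑ j with ¬ 2 - X ^ 3 ≤ lam j, (lam j - E) / ((lam j - E) ^ 2 + (X ^ 9) ^ 2)) ≤ 5 * N := by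
    rw [← mul_neg, one_div, inv_mul_le_iff₀ hN] at hre
    linarith
  linarith

lemma im_le_above (h : TraceRegular N X T A lam u) (hE : IsGridPt N X E)
    (hE2 : 2 - X ^ 3 / 2 ≤ E) {s : ℝ} (hs : X ^ 9 ≤ s) : (stTrans N A ⟨E, s⟩).im ≤ 12 := by
  have hX := h.params.X_pos
  have hη : 0 < X ^ 9 := by positivity
  have hs0 : 0 < s := hη.trans_le hs
  have hN := h.params.Nr_pos
  rw [h.spec.stTrans_im (by simpa using hs0.ne')]
  have h1 : ∑ j, s / ((lam j - E) ^ 2 + s ^ 2) ≤ 2 * ∑ j, 1 / (|lam j - E| + X ^ 9) := by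
    rw [Finset.mul_sum]
    refine Finset.sum_le_sum fun j _ => ?_
    calc s / ((lam j - E) ^ 2 + s ^ 2) ≤ 2 * (1 / (|lam j - E| + s)) := by
          rw [mul_one_div, div_le_div_iff₀ (by positivity) (by positivity)]
          nlinarith [sq_abs (lam j - E), abs_nonneg (lam j - E), sq_nonneg (|lam j - E| - s)]
      _ ≤ _ := by gcongr
  calc _ ≤ 1 / (N : ℝ) * (2 * (6 * N)) := by
        have := h.sum_grid_le hE hE2
        gcongr
        exact h1.trans (by linarith)
    _ = 12 := by field_simp; norm_num

end TraceRegular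

end

lemma diag_im_le {w G P : ℂ} {Y : ℝ} (hP : P = 1 + w * G) (hw : 1 / 8 ≤ ‖w‖)
    (him0 : 0 ≤ w.im) (him : w.im ≤ 3 * Y) : G.im ≤ 8 * ‖P‖ + 200 * Y := by
  have hw0 : w ≠ 0 := by
    rintro rfl; norm_num at hw
  have hG : G = P / w - w⁻¹ := by
    rw [hP]; field_simp; ring
  have h1 : (P / w).im ≤ 8 * ‖P‖ := by
    refine (le_abs_self _).trans ((Complex.abs_im_le_norm _).trans ?_)
    rw [norm_div, div_le_iff₀ (by linarith)]
    nlinarith [norm_nonneg P]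
  have h2 : -(w⁻¹).im ≤ 64 * w.im := by
    rw [Complex.inv_im, Complex.normSq_eq_norm_sq, neg_div, neg_neg,
      div_le_iff₀ (by nlinarith)]
    nlinarith [mul_le_mul_of_nonneg_left (show (1 / 64 : ℝ) ≤ ‖w‖ ^ 2 by nlinarith) him0]
  rw [hG, Complex.sub_im]
  linarith

lemma diag_moment_absorb {r s X Y v g w K : ℝ} (n : ℕ) (hX : 0 ≤ X) (hXY : X ≤ Y) (hr : 0 ≤ r)
    (hv0 : 0 ≤ v) (hg0 : 0 ≤ g) (hw0 : 0 ≤ w) (hK : K = 1000 * (2 * n + 1)) (hKX : K * X ≤ 1)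
    (hrs : r ≤ s) (hYs : K * Y ≤ s)
    (hv : v ≤ 8 * r + 200 * Y) (hg : g ≤ 8 * (1 + r)) (hgw : w * g ≤ 1 + r) :
    X * v * r ^ (2 * n + 1) + (2 * n + 1) * r ^ (2 * n) * (2 * g * v * (X ^ 2 + w * X)) ≤
      1 / 2 * s ^ (2 * n + 2) := by
  have hs : 0 ≤ s := hr.trans hrs
  have hn : (0 : ℝ) ≤ n := n.cast_nonneg
  have hY : 0 ≤ Y := hX.trans hXY
  have hK1 : 1000 ≤ K := by rw [hK]; linarith
  have hX1 : X ≤ 1 / 1000 := by nlinarith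
  have hv9 : v ≤ 9 * s := by nlinarith
  have e0 : g * (X ^ 2 + w * X) ≤ 2 * X * (1 + r) := by
    have : g * X ^ 2 ≤ (8 * X) * (X * (1 + r)) := by
      nlinarith [mul_le_mul_of_nonneg_right hg (sq_nonneg X)]
    have h2 : (8 * X) * (X * (1 + r)) ≤ 1 * (X * (1 + r)) := by gcongr; linarith
    nlinarith [mul_le_mul_of_nonneg_right hgw hX]
  have e1 : X * v * r ^ (2 * n + 1) ≤ X * (9 * s) * s ^ (2 * n + 1) := by gcongr
  have hKr : K * (X * (1 + r)) ≤ 2 * s := by nlinarith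
  have e2 : (2 * n + 1) * r ^ (2 * n) * (2 * g * v * (X ^ 2 + w * X)) ≤
      (2 * n + 1) * s ^ (2 * n) * (2 * (9 * s) * (2 * X * (1 + r))) := by
    rw [show 2 * g * v * (X ^ 2 + w * X) = 2 * v * (g * (X ^ 2 + w * X)) by ring]
    gcongr
  have e3 : (2 * n + 1) * s ^ (2 * n) * (2 * (9 * s) * (2 * X * (1 + r))) =
      (K * (X * (1 + r))) * (36 / 1000 * s ^ (2 * n + 1)) := by rw [hK]; ring
  have e4 : (K * (X * (1 + r))) * (36 / 1000 * s ^ (2 * n + 1)) ≤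
      (2 * s) * (36 / 1000 * s ^ (2 * n + 1)) := by gcongr
  have e5 : X * (9 * s) * s ^ (2 * n + 1) ≤ 1 / 1000 * (9 * s) * s ^ (2 * n + 1) := by gcongr
  have e6 : 0 ≤ s * s ^ (2 * n + 1) := by positivity
  calc _ ≤ 1 / 1000 * (9 * s) * s ^ (2 * n + 1) + (2 * s) * (36 / 1000 * s ^ (2 * n + 1)) := by
        linarith
    _ ≤ 1 / 2 * (s * s ^ (2 * n + 1)) := by nlinarith
    _ = _ := by ring

lemma diag_moment_crude {r X v g w L : ℝ} (n : ℕ) (hX : 0 ≤ X) (hX1 : X ≤ 1) (hr : 0 ≤ r)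
    (hv0 : 0 ≤ v) (hg0 : 0 ≤ g) (hw0 : 0 ≤ w) (hL : 5 * (2 * n + 1) ≤ L)
    (hrL : r ≤ L) (hv : v ≤ L) (hg : g ≤ L) (hw : w ≤ L) :
    X * v * r ^ (2 * n + 1) + (2 * n + 1) * r ^ (2 * n) * (2 * g * v * (X ^ 2 + w * X)) ≤
      L ^ (2 * n + 4) := by
  have hn : (0 : ℝ) ≤ n := n.cast_nonneg
  have hL1 : 1 ≤ L := by linarith
  have e1 : X * v * r ^ (2 * n + 1) ≤ 1 * L * L ^ (2 * n + 1) := by gcongr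
  have e2 : (2 * n + 1) * r ^ (2 * n) * (2 * g * v * (X ^ 2 + w * X)) ≤
      (2 * n + 1) * L ^ (2 * n) * (2 * L * L * (1 ^ 2 + L * 1)) := by gcongr
  have e3 : (2 * n + 1) * L ^ (2 * n) * (2 * L * L * (1 ^ 2 + L * 1)) ≤
      (2 * n + 1) * L ^ (2 * n) * (2 * L * L * (L + L * 1)) := by gcongr; simpa using hL1
  have e4 : L * L ^ (2 * n + 1) ≤ L * L ^ (2 * n + 1) * L := le_mul_of_one_le_right (by positivity) hL1
  have e5 : 0 ≤ L ^ (2 * n + 3) := by positivity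
  calc _ ≤ 1 * L * L ^ (2 * n + 1) +
        (2 * n + 1) * L ^ (2 * n) * (2 * L * L * (L + L * 1)) := by linarith
    _ = L ^ (2 * n + 2) + 4 * (2 * n + 1) * L ^ (2 * n + 3) := by ring
    _ ≤ L ^ (2 * n + 3) + 4 * (2 * n + 1) * L ^ (2 * n + 3) := by
        gcongr
        norm_num
    _ ≤ 5 * (2 * n + 1) * L ^ (2 * n + 3) := by nlinarith
    _ ≤ L * L ^ (2 * n + 3) := by gcongr
    _ = _ := by ring

lemma errDiag_tail {N : ℕ} {X T : ℝ} (hp : ScaleParams N X T) {E : ℝ} (hE : 0 ≤ E)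
    (hE2 : E * X ^ 6 ≤ 2) {n : ℕ} (hn : 1000 * (2 * n + 1) ≤ T)
    (hbad : (gMeasure N).real {g | ¬ (1 / 8 ≤ ‖⟨E, X ^ 9⟩ + stTrans N (Mmat N g) ⟨E, X ^ 9⟩‖ ∧
      (stTrans N (Mmat N g) ⟨E, X ^ 9⟩).im ≤ 2 * (T * X))} ≤ X ^ (60 * (n + 2)))
    (k : Fin N) :
    (gMeasure N).real {g | T * (T * (T * X)) < ‖errDiag N ⟨E, X ^ 9⟩ k (Mmat N g)‖} ≤
      2 * T⁻¹ ^ (2 * n + 2) := by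
  have hX := hp.X_pos
  have hX1 := hp.X_le
  have hX1' : X ≤ 1 := by norm_num at hX1; linarith
  have hT := hp.T_pos
  have hT1 := hp.one_le_T
  have hη : 0 < X ^ 9 := by positivity
  have hη1 : X ^ 9 ≤ X := by
    calc X ^ 9 ≤ X ^ 1 := pow_le_pow_of_le_one hX.le hX1' (by norm_num)
      _ = X := pow_one X
  set z : ℂ := ⟨E, X ^ 9⟩ with hz
  have hzi : 0 < z.im := hη
  have hb := bddMeas_errDiag (N := N) hzi k
  have h1 := errDiag_moment hzi k n
  rw [show z.im = X ^ 9 from rfl, hp.one_div_N_mul] at h1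
  set K : ℝ := 1000 * (2 * n + 1) with hK
  have hn0 : (0 : ℝ) ≤ n := n.cast_nonneg
  have hK0 : 0 < K := by positivity
  have hK1 : 1 ≤ K := by rw [hK]; linarith
  have hKX : K * X ≤ 1 := by
    have := hp.X_mul_pow_le (k := 1) (by norm_num)
    nlinarith
  set Y := T * X with hY
  have hXY : X ≤ Y := le_mul_of_one_le_left hX.le hT1
  set L : ℝ := X⁻¹ ^ 19 with hL
  have hXi : 10 ^ 6 ≤ X⁻¹ := by
    rw [le_inv_comm₀ (by norm_num) hX]; simpa using hX1
  have hL5 : 5 * (2 * n + 1) ≤ L := by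
    have h2 : K ≤ X⁻¹ := by rw [← one_div, le_div_iff₀ hX]; exact hKX
    have h3 : X⁻¹ ≤ L := le_self_pow₀ (by linarith) (by norm_num)
    linarith
  set bad : Set (Fin N → Fin N → ℝ) := {g | ¬ (1 / 8 ≤ ‖z + stTrans N (Mmat N g) z‖ ∧
      (stTrans N (Mmat N g) z).im ≤ 2 * Y)} with hbaddef
  have hmeas : MeasurableSet bad := by
    have hm := measurable_stTrans N z
    refine MeasurableSet.compl ?_
    exact (measurableSet_le measurable_const (hm.const_add z).norm).inter
      (measurableSet_le (Complex.measurable_im.comp hm) measurable_const)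
  set r : (Fin N → Fin N → ℝ) → ℝ := fun g => ‖errDiag N z k (Mmat N g)‖ with hr
  have hint : Integrable (fun g => r g ^ (2 * n + 2)) (gMeasure N) := hb.integrable_norm_pow _
  have hcrude : ∀ g, ‖stTrans N (Mmat N g) z‖ ≤ 1 / X ^ 9 ∧ ‖resolventM N (Mmat N g) z k k‖ ≤ L ∧
      ‖z + stTrans N (Mmat N g) z‖ ≤ L ∧ r g ≤ L := by
    intro g
    have c1 : ‖stTrans N (Mmat N g) z‖ ≤ X⁻¹ ^ 9 := by
      simpa using stTrans_norm_le (Mmat_isHermitian N g) hzi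
    have c2 : ‖resolventM N (Mmat N g) z k k‖ ≤ X⁻¹ ^ 9 := by
      simpa using resolventM_norm_le (Mmat_isHermitian N g) hzi k k
    have c3 : ‖z‖ ≤ X⁻¹ ^ 9 := by
      have d1 : ‖z‖ ≤ E + X ^ 9 := by
        refine (Complex.norm_le_abs_re_add_abs_im _).trans (le_of_eq ?_)
        simp only [hz, abs_of_nonneg hE, abs_of_pos hη]
      have d2 : E ≤ 2 * X⁻¹ ^ 6 := by
        rw [inv_pow, ← div_eq_mul_inv, le_div_iff₀ (by positivity)]; exact hE2
      have d3 : X ^ 9 ≤ X⁻¹ ^ 6 := by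
        have : 1 ≤ X⁻¹ ^ 6 := one_le_pow₀ (by linarith)
        linarith
      have d4 : 3 * X⁻¹ ^ 6 ≤ X⁻¹ ^ 9 := by
        calc 3 * X⁻¹ ^ 6 ≤ X⁻¹ ^ 3 * X⁻¹ ^ 6 := by
              gcongr
              have : X⁻¹ ≤ X⁻¹ ^ 3 := le_self_pow₀ (by linarith) (by norm_num)
              linarith
          _ = _ := by ring
      linarith
    have c4 : ‖z + stTrans N (Mmat N g) z‖ ≤ 2 * X⁻¹ ^ 9 := (norm_add_le _ _).trans (by linarith)
    have c5 : r g ≤ 1 + 2 * X⁻¹ ^ 9 * X⁻¹ ^ 9 := by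
      simp only [hr, errDiag]
      refine (norm_add_le _ _).trans ?_
      rw [norm_one, norm_mul]
      gcongr
    have c6 : 2 * X⁻¹ ^ 9 ≤ L := by
      calc 2 * X⁻¹ ^ 9 ≤ X⁻¹ ^ 10 * X⁻¹ ^ 9 := by
            gcongr
            have : X⁻¹ ≤ X⁻¹ ^ 10 := le_self_pow₀ (by linarith) (by norm_num)
            linarith
        _ = _ := by rw [hL]; ring
    have c7 : 1 + 2 * X⁻¹ ^ 9 * X⁻¹ ^ 9 ≤ L := by
      have : 1 ≤ X⁻¹ ^ 18 := one_le_pow₀ (by linarith)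
      calc 1 + 2 * X⁻¹ ^ 9 * X⁻¹ ^ 9 ≤ 3 * X⁻¹ ^ 18 := by linarith [show 2 * X⁻¹ ^ 9 * X⁻¹ ^ 9 = 2 * X⁻¹ ^ 18 by ring]
        _ ≤ X⁻¹ * X⁻¹ ^ 18 := by gcongr; linarith
        _ = _ := by rw [hL]; ring
    refine ⟨by simpa using c1, c2.trans ?_, c4.trans c6, c5.trans c7⟩
    have : 0 ≤ X⁻¹ ^ 9 := by positivity
    linarith
  have h2 : ∫ g, (X * (resolventM N (Mmat N g) z k k).im *
        ‖errDiag N z k (Mmat N g)‖ ^ (2 * n + 1) +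
      (2 * n + 1) * ‖errDiag N z k (Mmat N g)‖ ^ (2 * n) *
        (2 * ‖resolventM N (Mmat N g) z k k‖ * (resolventM N (Mmat N g) z k k).im *
        (X ^ 2 + ‖z + stTrans N (Mmat N g) z‖ * X))) ∂(gMeasure N) ≤
      ∫ g, (1 / 2 * (r g ^ (2 * n + 2) + (K * Y) ^ (2 * n + 2)) +
        bad.indicator (fun _ => L ^ (2 * n + 4)) g) ∂(gMeasure N) := by
    apply integral_mono_of_nonneg
    · refine ae_of_all _ fun g => ?_
      have := resolventM_im_nonneg (Mmat_isHermitian N g) hzi k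
      positivity
    · exact ((hint.add (integrable_const _)).const_mul _).add
        ((integrable_const _).indicator hmeas)
    · refine ae_of_all _ fun g => ?_
      have hA := Mmat_isHermitian N g
      have him := resolventM_im_nonneg hA hzi k
      have him2 := (le_abs_self _).trans (Complex.abs_im_le_norm (resolventM N (Mmat N g) z k k))
      have hs0 := stTrans_im_nonneg hA hzi
      obtain ⟨-, c2, c3, c4⟩ := hcrude g
      by_cases hg : g ∈ bad
      · refine (diag_moment_crude n hX.le hX1' (norm_nonneg _) him (norm_nonneg _)
          (norm_nonneg _) hL5 c4 (him2.trans c2) c2 c3).trans ?_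
        beta_reduce
        rw [Set.indicator_of_mem hg]
        have : 0 ≤ 1 / 2 * (r g ^ (2 * n + 2) + (K * Y) ^ (2 * n + 2)) := by positivity
        linarith
      · beta_reduce
        rw [Set.indicator_of_notMem hg, add_zero]
        rw [hbaddef, Set.mem_ofPred_eq, not_not] at hg
        obtain ⟨g1, g2⟩ := hg
        have hwG : ‖z + stTrans N (Mmat N g) z‖ * ‖resolventM N (Mmat N g) z k k‖ ≤ 1 + r g := by
          have e : (z + stTrans N (Mmat N g) z) * resolventM N (Mmat N g) z k k =
            errDiag N z k (Mmat N g) - 1 := by rw [errDiag]; ring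
          rw [← norm_mul, e]
          refine (norm_sub_le _ _).trans ?_
          rw [norm_one, add_comm]
        have hG8 : ‖resolventM N (Mmat N g) z k k‖ ≤ 8 * (1 + r g) := by
          have := mul_le_mul_of_nonneg_right g1 (norm_nonneg (resolventM N (Mmat N g) z k k))
          linarith
        refine (diag_moment_absorb n hX.le hXY (norm_nonneg _) him (norm_nonneg _) (norm_nonneg _)
          hK hKX (le_max_left _ _) (le_max_right _ (K * Y))
          (diag_im_le rfl g1 ?_ ?_) hG8 hwG).trans ?_
        · rw [Complex.add_im]; linarith
        · rw [Complex.add_im, show z.im = X ^ 9 from rfl]; linarith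
        · refine mul_le_mul_of_nonneg_left ?_ (by norm_num)
          exact max_pow_le_add (norm_nonneg _) (by positivity) _
  have h3 := h1.trans h2
  have hI : ∫ g, (1 / 2 * (r g ^ (2 * n + 2) + (K * Y) ^ (2 * n + 2)) +
        bad.indicator (fun _ => L ^ (2 * n + 4)) g) ∂(gMeasure N) =
      1 / 2 * (∫ g, r g ^ (2 * n + 2) ∂(gMeasure N) + (K * Y) ^ (2 * n + 2)) +
        (gMeasure N).real bad * L ^ (2 * n + 4) := by
    have hi1 : Integrable (fun g => r g ^ (2 * n + 2) + (K * Y) ^ (2 * n + 2)) (gMeasure N) :=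
      hint.add (integrable_const _)
    rw [integral_add (hi1.const_mul (1 / 2)) ((integrable_const _).indicator hmeas),
      integral_const_mul, integral_add hint (integrable_const _), integral_indicator_const _ hmeas]
    simp
  rw [hI] at h3
  have h5 : (gMeasure N).real bad * L ^ (2 * n + 4) ≤ 1 / 2 * (K * Y) ^ (2 * n + 2) := by
    have e1 : X ^ (2 * n + 2) ≤ (K * Y) ^ (2 * n + 2) := by
      gcongr
      nlinarith
    have e2 : X ^ (60 * (n + 2)) * L ^ (2 * n + 4) = X ^ (22 * n + 44) := by
      rw [hL, ← pow_mul, inv_pow, ← div_eq_mul_inv, div_eq_iff (by positivity), ← pow_add]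
      congr 1; ring
    have e3 : X ^ (22 * n + 44) ≤ X ^ (2 * n + 3) :=
      pow_le_pow_of_le_one hX.le hX1' (by omega)
    have e4 : X ^ (2 * n + 3) ≤ 1 / 2 * X ^ (2 * n + 2) := by
      rw [pow_succ X (2 * n + 2), mul_comm]
      gcongr
      norm_num at hX1; linarith
    calc _ ≤ X ^ (60 * (n + 2)) * L ^ (2 * n + 4) := by gcongr
      _ ≤ _ := by rw [e2]; linarith
  have h4 : ∫ g, ‖errDiag N z k (Mmat N g)‖ ^ (2 * n + 2) ∂(gMeasure N) ≤
      2 * (T * Y) ^ (2 * n + 2) := by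
    have : (K * Y) ^ (2 * n + 2) ≤ (T * Y) ^ (2 * n + 2) := by gcongr
    have : ∫ g, ‖errDiag N z k (Mmat N g)‖ ^ (2 * n + 2) ∂(gMeasure N) =
      ∫ g, r g ^ (2 * n + 2) ∂(gMeasure N) := rfl
    linarith
  exact hb.tail_of_moment (by positivity) hT h4

section

namespace SpecData

variable {N : ℕ} {A : Matrix (Fin N) (Fin N) ℝ} {lam : Fin N → ℝ} {u : Fin N → Fin N → ℝ}

lemma parseval (h : SpecData A lam u) (x : Fin N → ℝ) :
    ∑ a, (∑ j, x j * u j a) ^ 2 = ∑ j, x j ^ 2 := by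
  have h1 : ∀ a, (∑ j, x j * u j a) ^ 2 = ∑ j, ∑ k, x j * x k * (u j a * u k a) := by
    intro a
    rw [sq, Finset.sum_mul_sum]
    refine Finset.sum_congr rfl fun j _ => Finset.sum_congr rfl fun k _ => by ring
  simp_rw [h1]
  rw [Finset.sum_comm]
  refine Finset.sum_congr rfl fun j _ => ?_
  rw [Finset.sum_comm]
  simp_rw [← Finset.mul_sum, h.orth]
  simp [sq]

/-- Matrix element of a diagonal perturbation between two eigenvectors. -/
def cross (u : Fin N → Fin N → ℝ) (d : Fin N → ℝ) (j k : Fin N) : ℝ := ∑ c, u j c * d c * u k c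

lemma sum_sandwich_sq (h : SpecData A lam u) (f g d : Fin N → ℝ) :
    ∑ a, ∑ b, (∑ c, fcr u f a c * fcr u g c b * d c) ^ 2 =
      ∑ j, ∑ k, (f j * g k * cross u d j k) ^ 2 := by
  have h1 : ∀ a b, ∑ c, fcr u f a c * fcr u g c b * d c =
      ∑ k, (∑ j, (f j * g k * cross u d j k) * u j a) * u k b := by
    intro a b
    have e1 : ∀ c, fcr u f a c * fcr u g c b * d c =
        ∑ k, ∑ j, f j * g k * u j a * u k b * (u j c * d c * u k c) := by
      intro c
      rw [fcr, fcr, Finset.sum_mul_sum, Finset.sum_mul, Finset.sum_comm]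
      refine Finset.sum_congr rfl fun k _ => ?_
      rw [Finset.sum_mul]
      refine Finset.sum_congr rfl fun j _ => by ring
    simp_rw [e1]
    rw [Finset.sum_comm]
    refine Finset.sum_congr rfl fun k _ => ?_
    rw [Finset.sum_comm, Finset.sum_mul]
    refine Finset.sum_congr rfl fun j _ => ?_
    rw [← Finset.mul_sum, cross]; ring
  simp_rw [h1]
  have h2 : ∀ a, ∑ b, (∑ k, (∑ j, (f j * g k * cross u d j k) * u j a) * u k b) ^ 2 =
      ∑ k, (∑ j, (f j * g k * cross u d j k) * u j a) ^ 2 := fun a => h.parseval _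
  simp_rw [h2]
  rw [Finset.sum_comm]
  simp_rw [h.parseval]
  rw [Finset.sum_comm]

lemma sum_cross_sq_le (h : SpecData A lam u) {f g d : Fin N → ℝ} {p q Y τ : ℝ}
    (hf : ∀ j, 0 ≤ f j) (hfp : ∀ j, f j ≤ p) (hg : ∀ j, 0 ≤ g j) (hgq : ∀ j, g j ≤ q)
    (hτ : 0 ≤ τ) (hp : 0 ≤ p) (hY0 : 0 ≤ Y) (hY : ∀ c, fcr u f c c ≤ Y)
    (hquad : ∀ a b, (∑ c, fcr u f a c * fcr u g c b * d c) ^ 2 ≤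
      τ * ∑ c, (fcr u f a c * fcr u g c b) ^ 2) :
    ∑ j, ∑ k, (f j * g k * cross u d j k) ^ 2 ≤ τ * (p * Y) * (q * ∑ k, g k) := by
  have hsymm : ∀ a c, fcr u f a c = fcr u f c a :=
    fun a c => Finset.sum_congr rfl fun j _ => by rw [mul_comm (u j a)]
  rw [← h.sum_sandwich_sq]
  have h1 : ∀ c, ∑ j, u j c ^ 2 * f j ^ 2 ≤ p * Y := by
    intro c
    calc _ ≤ ∑ j, p * (u j c * u j c * f j) := by
          refine Finset.sum_le_sum fun j _ => ?_
          have := mul_le_mul_of_nonneg_right (hfp j) (mul_nonneg (sq_nonneg (u j c)) (hf j))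
          linarith
      _ = p * fcr u f c c := by rw [← Finset.mul_sum, fcr]
      _ ≤ _ := mul_le_mul_of_nonneg_left (hY c) hp
  have h2 : ∑ c, ∑ k, u k c ^ 2 * g k ^ 2 ≤ q * ∑ k, g k := by
    rw [Finset.sum_comm, Finset.mul_sum]
    refine Finset.sum_le_sum fun k _ => ?_
    rw [← Finset.sum_mul, h.sum_sq_one', one_mul, sq]
    exact mul_le_mul_of_nonneg_right (hgq k) (hg k)
  calc _ ≤ ∑ a, ∑ b, τ * ∑ c, (fcr u f a c * fcr u g c b) ^ 2 :=
        Finset.sum_le_sum fun a _ => Finset.sum_le_sum fun b _ => hquad a b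
    _ = τ * ∑ c, (∑ a, fcr u f c a ^ 2) * ∑ b, fcr u g c b ^ 2 := by
        simp_rw [← Finset.mul_sum]
        congr 1
        simp_rw [Finset.sum_mul_sum]
        rw [Finset.sum_comm' (t' := Finset.univ) (s' := fun _ => Finset.univ) (by simp)]
        have e : ∀ y x, ∑ b, (fcr u f x b * fcr u g b y) ^ 2 =
          ∑ b, fcr u f b x ^ 2 * fcr u g b y ^ 2 := fun y x =>
            Finset.sum_congr rfl fun b _ => by rw [mul_pow, hsymm x b]
        simp_rw [e]
        rw [Finset.sum_comm]
        conv_rhs => rw [Finset.sum_comm]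
        refine Finset.sum_congr rfl fun x _ => ?_
        rw [Finset.sum_comm]
    _ = τ * ∑ c, (∑ j, u j c ^ 2 * f j ^ 2) * ∑ k, u k c ^ 2 * g k ^ 2 := by
        simp_rw [h.sum_fcr_sq]
    _ ≤ τ * ∑ c, (p * Y) * ∑ k, u k c ^ 2 * g k ^ 2 := by
        gcongr with c _
        exact h1 c
    _ ≤ _ := by
        rw [← Finset.mul_sum, ← mul_assoc]
        refine mul_le_mul_of_nonneg_left h2 (mul_nonneg hτ (mul_nonneg hp hY0))

end SpecData

end

section

/-- A trace-regular matrix with regular diagonal Green function, together with a small diagonal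
perturbation `d` that is quadratically concentrated when tested against resolvents. -/
structure PerturbRegular (N : ℕ) (X T : ℝ) (A : Matrix (Fin N) (Fin N) ℝ) (lam : Fin N → ℝ)
    (u : Fin N → Fin N → ℝ) (d : Fin N → ℝ) : Prop extends TraceRegular N X T A lam u where
  diag : ∀ E, IsGridPt N X E → ∀ k, ‖errDiag N ⟨E, X ^ 9⟩ k A‖ ≤ T * (T * (T * X))
  pert : ∀ c, |d c| ≤ X ^ 4
  quad : ∀ E E', IsGridPt N X E → IsGridPt N X E' → ∀ s ≤ Nat.clog 2 (N ^ 2), ∀ a b,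
    (∑ c, (resolventM N A ⟨E, X ^ 9⟩ a c).im * (resolventM N A ⟨E', 2 ^ s * X ^ 9⟩ c b).im * d c)
      ^ 2 ≤ T * (2 / N) * ∑ c, ((resolventM N A ⟨E, X ^ 9⟩ a c).im *
        (resolventM N A ⟨E', 2 ^ s * X ^ 9⟩ c b).im) ^ 2

lemma SpecData.resolventM_im {N : ℕ} {A : Matrix (Fin N) (Fin N) ℝ} {lam : Fin N → ℝ}
    {u : Fin N → Fin N → ℝ} (h : SpecData A lam u) (E : ℝ) {t : ℝ} (ht : t ≠ 0) (a b : Fin N) :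
    (resolventM N A ⟨E, t⟩ a b).im = SpecData.fcr u (fun j => t / ((lam j - E) ^ 2 + t ^ 2)) a b := by
  rw [h.resolventM_apply (by simpa using ht), SpecData.fc_im]
  simp_rw [inv_sub_im]

namespace PerturbRegular

open SpecData

variable {N : ℕ} {X T E E' : ℝ} {A : Matrix (Fin N) (Fin N) ℝ} {lam : Fin N → ℝ}
  {u : Fin N → Fin N → ℝ} {d : Fin N → ℝ}

lemma diag_im_le (h : PerturbRegular N X T A lam u d) (hE : IsGridPt N X E) (k : Fin N) :
    (resolventM N A ⟨E, X ^ 9⟩ k k).im ≤ T ^ 4 * X := by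
  have hX := h.params.X_pos
  have hX1 : X ≤ 1 := h.params.X_le.trans (by norm_num)
  have hT := h.params.one_le_T
  have hT6 := h.params.T_large
  have hη : 0 < X ^ 9 := by positivity
  have hηX : X ^ 9 ≤ X := pow_le_of_le_one hX.le hX1 (by norm_num)
  have hXT : X ≤ T * X := le_mul_of_one_le_left hX.le hT
  have h1 := h.toTraceRegular.norm_add_stTrans_ge hE
  have h2 := h.im_le hE
  have h3 := stTrans_im_nonneg h.herm (z := ⟨E, X ^ 9⟩) hη
  have h4 := _root_.diag_im_le (w := ⟨E, X ^ 9⟩ + stTrans N A ⟨E, X ^ 9⟩) (Y := T * X)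
    (G := resolventM N A ⟨E, X ^ 9⟩ k k) (P := errDiag N ⟨E, X ^ 9⟩ k A) rfl h1
    (by rw [Complex.add_im]; exact add_nonneg hη.le h3)
    (by rw [Complex.add_im]; change X ^ 9 + _ ≤ _; linarith)
  have h5 := h.diag E hE k
  calc _ ≤ 8 * (T * (T * (T * X))) + 200 * (T * X) := by linarith
    _ ≤ 208 * (T ^ 3 * X) := by
        have : T * X ≤ T ^ 3 * X := by gcongr; exact le_self_pow₀ hT (by norm_num)
        nlinarith
    _ ≤ T * (T ^ 3 * X) := by gcongr; linarith
    _ = _ := by ring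

lemma sum_cross_near_le (h : PerturbRegular N X T A lam u d) (hE : IsGridPt N X E)
    (hE' : IsGridPt N X E') {s : ℕ} (hs : s ≤ Nat.clog 2 (N ^ 2)) {j : Fin N}
    (hj : |lam j - E| ≤ X ^ 9) :
    ∑ k with |lam k - E'| ≤ 2 ^ s * X ^ 9, cross u d j k ^ 2 ≤
      32 * T ^ 5 / N * (2 ^ s * X ^ 9) * (stTrans N A ⟨E', 2 ^ s * X ^ 9⟩).im := by
  classical
  have hX := h.params.X_pos
  have hT := h.params.T_pos
  have hN := h.params.Nr_pos
  have hη : 0 < X ^ 9 := by positivity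
  set η := X ^ 9 with hηd
  have ht : 0 < 2 ^ s * η := by positivity
  set t := 2 ^ s * η with htd
  set f : Fin N → ℝ := fun j => η / ((lam j - E) ^ 2 + η ^ 2) with hf
  set g : Fin N → ℝ := fun j => t / ((lam j - E') ^ 2 + t ^ 2) with hg
  have hfle : ∀ (x : ℝ) {y : ℝ}, 0 < y → y / (x ^ 2 + y ^ 2) ≤ 1 / y := by
    intro x y hy
    rw [div_le_div_iff₀ (by positivity) hy]
    nlinarith [sq_nonneg x]
  have hfge : ∀ {x y : ℝ}, 0 < y → |x| ≤ y → 1 / (2 * y) ≤ y / (x ^ 2 + y ^ 2) := by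
    intro x y hy hxy
    rw [div_le_div_iff₀ (by positivity) (by positivity)]
    have := sq_le_sq' (by linarith [neg_abs_le x]) ((le_abs_self x).trans hxy)
    nlinarith
  have hY : ∀ c, fcr u f c c ≤ T ^ 4 * X := fun c => by
    rw [hf, ← h.spec.resolventM_im E hη.ne']; exact h.diag_im_le hE c
  have hquad := h.quad E E' hE hE' s hs
  simp_rw [← hηd, ← htd, h.spec.resolventM_im E hη.ne', h.spec.resolventM_im E' ht.ne'] at hquad
  have h1 := h.spec.sum_cross_sq_le (f := f) (g := g) (d := d) (p := 1 / η) (q := 1 / t)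
    (Y := T ^ 4 * X) (τ := T * (2 / N)) (fun j => by positivity) (fun j => hfle _ hη)
    (fun j => by positivity) (fun j => hfle _ ht) (by positivity) (by positivity) (by positivity)
    hY hquad
  have h2 : ∑ k, g k = N * (stTrans N A ⟨E', t⟩).im := by
    rw [h.spec.stTrans_im (by simpa using ht.ne'), ← mul_assoc, mul_one_div_cancel hN.ne', one_mul]
  rw [h2] at h1
  have h3 : ∑ k with |lam k - E'| ≤ t, (1 / (2 * η) * (1 / (2 * t)) * cross u d j k) ^ 2 ≤
      ∑ j, ∑ k, (f j * g k * cross u d j k) ^ 2 := by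
    calc _ ≤ ∑ k with |lam k - E'| ≤ t, (f j * g k * cross u d j k) ^ 2 := by
          refine Finset.sum_le_sum fun k hk => ?_
          rw [Finset.mem_filter] at hk
          rw [mul_pow, mul_pow _ (cross u d j k)]
          gcongr
          · exact hfge hη hj
          · exact hfge ht hk.2
      _ ≤ ∑ k, (f j * g k * cross u d j k) ^ 2 :=
          Finset.sum_le_sum_of_subset_of_nonneg (Finset.filter_subset _ _)
            fun _ _ _ => sq_nonneg _
      _ ≤ _ := Finset.single_le_sum (f := fun j => ∑ k, (f j * g k * cross u d j k) ^ 2)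
            (fun _ _ => Finset.sum_nonneg fun _ _ => sq_nonneg _) (Finset.mem_univ j)
  have h4 := h3.trans h1
  simp_rw [mul_pow _ (cross u d j _), ← Finset.mul_sum] at h4
  have h5 : N * (η * X) = 1 := by rw [hηd, ← h.params.N_eq]; ring
  have h6 : X = 1 / (N * η) := by field_simp; linarith
  set S := ∑ k with |lam k - E'| ≤ t, cross u d j k ^ 2
  have h7 : S = (16 * η ^ 2 * t ^ 2) * ((1 / (2 * η) * (1 / (2 * t))) ^ 2 * S) := by
    field_simp; norm_num
  rw [h7]
  refine (mul_le_mul_of_nonneg_left h4 (by positivity)).trans (le_of_eq ?_)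
  set m := (stTrans N A ⟨E', t⟩).im
  rw [h6]
  field_simp
  ring

lemma sum_cross_weighted_le (h : PerturbRegular N X T A lam u d) {x : ℝ}
    (hx1 : 2 - X ^ 3 / 4 ≤ x) (hx2 : x * X ^ 6 ≤ 1) {j : Fin N} (hj : 2 - X ^ 3 ≤ lam j) :
    ∑ k, cross u d j k ^ 2 / (|lam k - x| + T ^ 9 / N) ≤ 1600 * T ^ 6 / N := by
  classical
  have hX := h.params.X_pos
  have hX1 := h.params.X_le
  have hT := h.params.T_pos
  have hT1 := h.params.one_le_T
  have hN := h.params.Nr_pos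
  have hη : 0 < X ^ 9 := by positivity
  have hXη : N * (X ^ 9 * X) = 1 := by rw [← h.params.N_eq]; ring
  have hX3 : 0 < X ^ 3 := by positivity
  have hη3 : X ^ 9 ≤ X ^ 3 / 4 := by
    have h6 : X ^ 6 ≤ X ^ 1 := pow_le_pow_of_le_one hX.le (by linarith) (by norm_num)
    have : X ^ 6 ≤ 1 / 4 := by norm_num at *; linarith
    calc X ^ 9 = X ^ 6 * X ^ 3 := by ring
      _ ≤ 1 / 4 * X ^ 3 := by gcongr
      _ = _ := by ring
  obtain ⟨E, hE, hE1, hE2⟩ := h.params.exists_gridPt (x := lam j) (by linarith)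
    (by have := h.eig j; have := mul_le_mul_of_nonneg_right (le_abs_self (lam j))
          (by positivity : 0 ≤ X ^ 6); linarith)
  obtain ⟨E', hE', hE1', hE2'⟩ := h.params.exists_gridPt (x := x) (by linarith) (by linarith)
  have hjE : |lam j - E| ≤ X ^ 9 := by rw [abs_of_nonneg (by linarith)]; linarith
  set L := Nat.clog 2 (N ^ 2) with hL
  set S : ℕ → ℝ := fun s => ∑ k with |lam k - E'| ≤ 2 ^ s * X ^ 9, cross u d j k ^ 2 with hS
  have hLT : (L : ℝ) ≤ T := by
    rcases Nat.eq_zero_or_pos L with h0 | h0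
    · rw [h0]; simpa using hT.le
    have hN2 : 1 < N ^ 2 := by
      by_contra! hc
      rw [hL, Nat.clog_of_right_le_one hc] at h0; omega
    have h1 := Nat.pow_pred_clog_lt_self (b := 2) (by norm_num) hN2
    rw [← hL] at h1
    have h2 : ((2 : ℝ)) ^ (L - 1) ≤ (N : ℝ) ^ 2 := by exact_mod_cast h1.le
    have h3 := Real.log_le_log (by positivity) h2
    rw [Real.log_pow, Real.log_pow, Nat.cast_sub h0] at h3
    have h4 := Real.log_two_gt_d9
    have h5 := h.params.log_le
    push_cast at h3
    have h6 : (0 : ℝ) ≤ (L : ℝ) - 1 := by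
      have : (1 : ℝ) ≤ L := by exact_mod_cast h0
      linarith
    nlinarith
  have hS0 : S 0 ≤ 64 * T ^ 6 / N ^ 2 := by
    have h1 := h.sum_cross_near_le hE hE' (s := 0) (Nat.zero_le _) hjE
    have h2 := h.im_le hE'
    simp only [pow_zero, one_mul] at h1
    calc S 0 ≤ 32 * T ^ 5 / N * X ^ 9 * (stTrans N A ⟨E', X ^ 9⟩).im := by simpa [hS] using h1
      _ ≤ 32 * T ^ 5 / N * X ^ 9 * (2 * (T * X)) := by gcongr
      _ = 64 * T ^ 6 / N * (X ^ 9 * X) := by ring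
      _ = _ := by
        rw [show X ^ 9 * X = 1 / N by field_simp; linarith]; field_simp
  have hSs : ∀ s ∈ Finset.Icc 1 L, 4 / (2 ^ s * X ^ 9) * S s ≤ 1536 * T ^ 5 / N := by
    intro s hs
    rw [Finset.mem_Icc] at hs
    have h1 := h.sum_cross_near_le hE hE' hs.2 hjE
    have h2 := h.im_le_above hE' (by linarith) (s := 2 ^ s * X ^ 9)
      (le_mul_of_one_le_left hη.le (one_le_pow₀ (by norm_num)))
    calc _ ≤ 4 / (2 ^ s * X ^ 9) * (32 * T ^ 5 / N * (2 ^ s * X ^ 9) * 12) := by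
          gcongr
          exact h1.trans (by gcongr)
      _ = _ := by field_simp; norm_num
  have hexL : ∀ k, |lam k - E'| ≤ 2 ^ L * X ^ 9 := by
    intro k
    have h1 : ((N : ℝ)) ^ 2 ≤ 2 ^ L := by
      exact_mod_cast Nat.le_pow_clog (b := 2) (by norm_num) (N ^ 2)
    have h2 : |lam k| * X ^ 6 ≤ 1 := h.eig k
    have h3 : |E'| * X ^ 6 ≤ 2 := by
      have : X ^ 3 ≤ 1 := pow_le_one₀ hX.le (hX1.trans (by norm_num))
      rw [abs_of_nonneg (by linarith)]; exact hE'.2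
    have h4 : |lam k - E'| * X ^ 6 ≤ 3 := by
      have := mul_le_mul_of_nonneg_right (abs_sub (lam k) E') (by positivity : 0 ≤ X ^ 6)
      linarith
    have h5 : 3 ≤ 2 ^ L * X ^ 9 * X ^ 6 := by
      have h7 : X ^ 5 ≤ X ^ 1 := pow_le_pow_of_le_one hX.le (by linarith) (by norm_num)
      have h8 : 3 * X ^ 5 ≤ 1 := by norm_num at *; linarith
      have h9 : 1 ≤ (2 : ℝ) ^ L * X ^ 20 := by
        calc (1 : ℝ) = (N * (X ^ 9 * X)) ^ 2 := by rw [hXη]; norm_num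
          _ = (N : ℝ) ^ 2 * X ^ 20 := by ring
          _ ≤ _ := by gcongr
      have h10 : 0 < X ^ 5 := by positivity
      have : 3 * X ^ 5 ≤ 2 ^ L * X ^ 9 * X ^ 6 * X ^ 5 := by
        calc _ ≤ 1 := h8
          _ ≤ _ := h9
          _ = _ := by ring
      exact le_of_mul_le_mul_right this h10
    exact le_of_mul_le_mul_right (h4.trans h5) (by positivity)
  have hpt : ∀ k, cross u d j k ^ 2 / (|lam k - x| + T ^ 9 / N) ≤
      (if |lam k - E'| ≤ 2 ^ 0 * X ^ 9 then N / T ^ 9 * cross u d j k ^ 2 else 0) +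
      ∑ s ∈ Finset.Icc 1 L, if |lam k - E'| ≤ 2 ^ s * X ^ 9 then
        4 / (2 ^ s * X ^ 9) * cross u d j k ^ 2 else 0 := by
    intro k
    have hnn : ∀ s ∈ Finset.Icc 1 L, 0 ≤ (if |lam k - E'| ≤ 2 ^ s * X ^ 9 then
        4 / (2 ^ s * X ^ 9) * cross u d j k ^ 2 else 0) := fun s _ => by
      split_ifs
      · positivity
      · exact le_rfl
    have hEx : |x - E'| ≤ X ^ 9 / 4 := by rw [abs_of_nonneg (by linarith)]; linarith
    have htri : |lam k - E'| ≤ |lam k - x| + X ^ 9 / 4 := by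
      have := abs_sub_le (lam k) x E'
      linarith
    by_cases hk : |lam k - E'| ≤ 2 ^ 0 * X ^ 9
    · rw [if_pos hk]
      refine le_add_of_le_of_nonneg ?_ (Finset.sum_nonneg hnn)
      rw [div_le_iff₀ (by positivity)]
      calc cross u d j k ^ 2 = N / T ^ 9 * cross u d j k ^ 2 * (T ^ 9 / N) := by field_simp
        _ ≤ _ := by gcongr; linarith [abs_nonneg (lam k - x)]
    · rw [if_neg hk, zero_add]
      have hex : ∃ s, |lam k - E'| ≤ 2 ^ s * X ^ 9 := ⟨L, hexL k⟩
      obtain ⟨s, hs, hs1, hsL, hsm⟩ : ∃ s, |lam k - E'| ≤ 2 ^ s * X ^ 9 ∧ 1 ≤ s ∧ s ≤ L ∧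
          2 ^ (s - 1) * X ^ 9 < |lam k - E'| := by
        have h0 : 1 ≤ Nat.find hex := by
          rw [Nat.one_le_iff_ne_zero]
          intro h0
          have := Nat.find_spec hex
          rw [h0] at this
          exact hk this
        refine ⟨Nat.find hex, Nat.find_spec hex, h0, Nat.find_min' hex (hexL k), ?_⟩
        exact not_le.mp (Nat.find_min hex (m := Nat.find hex - 1) (by omega))
      refine le_trans ?_ (Finset.single_le_sum hnn (Finset.mem_Icc.mpr ⟨hs1, hsL⟩))
      rw [if_pos hs, div_le_iff₀ (by positivity)]
      have hy : 2 ^ s * X ^ 9 / 4 ≤ |lam k - x| := by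
        obtain ⟨r, rfl⟩ : ∃ r, s = r + 1 := ⟨s - 1, by omega⟩
        rw [Nat.add_sub_cancel] at hsm
        have h1 : X ^ 9 ≤ 2 ^ r * X ^ 9 := le_mul_of_one_le_left hη.le (one_le_pow₀ (by norm_num))
        rw [pow_succ]
        linarith
      calc cross u d j k ^ 2 =
            4 / (2 ^ s * X ^ 9) * cross u d j k ^ 2 * (2 ^ s * X ^ 9 / 4) := by field_simp
        _ ≤ _ := by
            gcongr
            have : 0 < T ^ 9 / N := by positivity
            linarith
  calc _ ≤ ∑ k, ((if |lam k - E'| ≤ 2 ^ 0 * X ^ 9 then N / T ^ 9 * cross u d j k ^ 2 else 0) +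
      ∑ s ∈ Finset.Icc 1 L, if |lam k - E'| ≤ 2 ^ s * X ^ 9 then
        4 / (2 ^ s * X ^ 9) * cross u d j k ^ 2 else 0) := Finset.sum_le_sum fun k _ => hpt k
    _ = N / T ^ 9 * S 0 + ∑ s ∈ Finset.Icc 1 L, 4 / (2 ^ s * X ^ 9) * S s := by
        rw [Finset.sum_add_distrib, Finset.sum_comm]
        simp only [hS, Finset.mul_sum, Finset.sum_filter]
        congr 1
        · refine Finset.sum_congr rfl fun k _ => ?_
          split_ifs <;> simp
        · refine Finset.sum_congr rfl fun s _ => Finset.sum_congr rfl fun k _ => ?_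
          split_ifs <;> simp
    _ ≤ N / T ^ 9 * (64 * T ^ 6 / N ^ 2) + ∑ s ∈ Finset.Icc 1 L, 1536 * T ^ 5 / N := by
        gcongr with s hs
        exact hSs s hs
    _ = 64 / T ^ 3 / N + L * (1536 * T ^ 5 / N) := by
        rw [Finset.sum_const, Nat.card_Icc, nsmul_eq_mul]
        simp only [add_tsub_cancel_right]
        field_simp
    _ ≤ 64 * T ^ 6 / N + T * (1536 * T ^ 5 / N) := by
        gcongr
        rw [div_le_iff₀ (by positivity)]
        have : 1 ≤ T ^ 6 * T ^ 3 := by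
          rw [← pow_add]; exact one_le_pow₀ hT1
        linarith
    _ = _ := by ring

end PerturbRegular

end

section

lemma sum_sum_mul_sq_le {ι : Type*} [Fintype ι] [DecidableEq ι] (s : Finset ι) (D : ι → ι → ℝ)
    {w c e : ι → ℝ} {K : ℝ} (hw : ∀ j, 0 < w j) (hc : ∀ j, j ∉ s → c j = 0)
    (hK : ∑ j ∈ s, ∑ k, D j k ^ 2 / (w j * w k) ≤ K) :
    (∑ j, ∑ k, c j * e k * D j k) ^ 2 ≤ K * ((∑ j, w j * c j ^ 2) * ∑ k, w k * e k ^ 2) := by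
  have h1 : ∑ j, ∑ k, c j * e k * D j k = ∑ j ∈ s, ∑ k, c j * e k * D j k := by
    symm
    refine Finset.sum_subset (Finset.subset_univ s) fun j _ hj => ?_
    simp [hc j hj]
  rw [h1, ← Finset.sum_product' s Finset.univ (fun j k => c j * e k * D j k)]
  rw [← Finset.sum_product' s Finset.univ (fun j k => D j k ^ 2 / (w j * w k))] at hK
  have h2 : ∀ p ∈ s ×ˢ (Finset.univ : Finset ι), (c p.1 * e p.2 * D p.1 p.2) ^ 2 ≤
      (D p.1 p.2 ^ 2 / (w p.1 * w p.2)) * (w p.1 * c p.1 ^ 2 * (w p.2 * e p.2 ^ 2)) := by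
    intro p _
    have := hw p.1
    have := hw p.2
    apply le_of_eq
    field_simp
  have h3 := Finset.sum_sq_le_sum_mul_sum_of_sq_le_mul (s ×ˢ (Finset.univ : Finset ι))
    (f := fun p => D p.1 p.2 ^ 2 / (w p.1 * w p.2))
    (g := fun p => w p.1 * c p.1 ^ 2 * (w p.2 * e p.2 ^ 2))
    (fun p _ => by have := hw p.1; have := hw p.2; positivity)
    (fun p _ => by have := hw p.1; have := hw p.2; positivity) h2
  refine h3.trans ?_
  have h4 : ∑ p ∈ s ×ˢ (Finset.univ : Finset ι), w p.1 * c p.1 ^ 2 * (w p.2 * e p.2 ^ 2) ≤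
      (∑ j, w j * c j ^ 2) * ∑ k, w k * e k ^ 2 := by
    rw [Finset.sum_product' s Finset.univ (fun j k => w j * c j ^ 2 * (w k * e k ^ 2)),
      Finset.sum_mul_sum]
    refine Finset.sum_le_sum_of_subset_of_nonneg (Finset.subset_univ s) fun j _ _ => ?_
    refine Finset.sum_nonneg fun k _ => ?_
    have := hw j
    have := hw k
    positivity
  refine mul_le_mul hK h4 ?_ ((Finset.sum_nonneg fun p _ => ?_).trans hK)
  · refine Finset.sum_nonneg fun p _ => ?_
    have := hw p.1
    have := hw p.2
    positivity
  · have := hw p.1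
    have := hw p.2
    positivity

lemma SpecData.sum_mul_expand {N : ℕ} (u : Fin N → Fin N → ℝ) (d x y : Fin N → ℝ) :
    ∑ a, d a * ((∑ j, x j * u j a) * ∑ k, y k * u k a) =
      ∑ j, ∑ k, x j * y k * SpecData.cross u d j k := by
  simp_rw [SpecData.cross, Finset.sum_mul_sum, Finset.mul_sum]
  rw [Finset.sum_comm]
  refine Finset.sum_congr rfl fun j _ => ?_
  rw [Finset.sum_comm]
  refine Finset.sum_congr rfl fun k _ => Finset.sum_congr rfl fun a _ => by ring

namespace PerturbRegular

open SpecData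

variable {N : ℕ} {X T E E' : ℝ} {A : Matrix (Fin N) (Fin N) ℝ} {lam : Fin N → ℝ}
  {u : Fin N → Fin N → ℝ} {d : Fin N → ℝ}

lemma abs_quadForm_le (h : PerturbRegular N X T A lam u d) {x : ℝ} (hx1 : 2 - X ^ 3 / 4 ≤ x)
    (hx2 : x * X ^ 6 ≤ 1) (c : Fin N → ℝ) :
    |∑ a, d a * (∑ j, c j * u j a) ^ 2| ≤ ∑ k, (|lam k - x| + T ^ 9 / N) * c k ^ 2 := by
  classical
  have hX := h.params.X_pos
  have hX1 := h.params.X_le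
  have hT := h.params.T_pos
  have hT1 := h.params.one_le_T
  have hT6 := h.params.T_large
  have hN := h.params.Nr_pos
  have hX3 : 0 < X ^ 3 := by positivity
  have hX31 : X ^ 3 ≤ 1 := pow_le_one₀ hX.le (hX1.trans (by norm_num))
  have hXη : N * (X ^ 9 * X) = 1 := by rw [← h.params.N_eq]; ring
  set w : Fin N → ℝ := fun k => |lam k - x| + T ^ 9 / N with hw
  have hw0 : ∀ k, 0 < w k := fun k => by positivity
  set s := Finset.univ.filter fun j => 2 - X ^ 3 ≤ lam j with hs
  have hF : ∑ j ∈ s, ∑ k, cross u d j k ^ 2 / (w j * w k) ≤ 1 / 100 := by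
    have h1 : ∑ j ∈ s, 1 / w j ≤ 9 * N / T ^ 8 := by
      refine (h.sum_edge_le (x := x) (ν := T ^ 9 / N) ?_ (by positivity)).trans ?_
      · rw [abs_of_nonneg (by linarith)]; linarith
      · have e : 8 * T ^ 2 / X ^ 9 = 8 * T ^ 2 * (N * X) := by
          rw [mul_div_assoc, ← h.params.inv_eta]; ring
        have e2 := h.params.X_mul_pow_le (k := 11) (by norm_num)
        have e3 : 8 * T ^ 2 * (N * X) ≤ N / T ^ 8 := by
          rw [le_div_iff₀ (by positivity)]
          calc 8 * T ^ 2 * (N * X) * T ^ 8 = 8 * (N * (X * T ^ 10)) := by ring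
            _ ≤ T * (N * (X * T ^ 10)) := by gcongr; linarith
            _ = N * (X * T ^ 11) := by ring
            _ ≤ N * 1 := by gcongr
            _ = N := mul_one _
        calc _ = 8 * N / T ^ 8 + 8 * T ^ 2 * (N * X) := by rw [e]; field_simp
          _ ≤ 8 * N / T ^ 8 + N / T ^ 8 := by gcongr
          _ = _ := by ring
    calc _ = ∑ j ∈ s, 1 / w j * ∑ k, cross u d j k ^ 2 / w k := by
          refine Finset.sum_congr rfl fun j _ => ?_
          rw [Finset.mul_sum]
          refine Finset.sum_congr rfl fun k _ => ?_
          have := hw0 j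
          have := hw0 k
          field_simp
      _ ≤ ∑ j ∈ s, 1 / w j * (1600 * T ^ 6 / N) := by
          refine Finset.sum_le_sum fun j hj => ?_
          have := hw0 j
          gcongr
          exact h.sum_cross_weighted_le hx1 hx2 (Finset.mem_filter.mp hj).2
      _ ≤ 9 * N / T ^ 8 * (1600 * T ^ 6 / N) := by
          rw [← Finset.sum_mul]; gcongr
      _ = 14400 / T ^ 2 := by field_simp; norm_num
      _ ≤ _ := by
          rw [div_le_div_iff₀ (by positivity) (by norm_num)]
          nlinarith
  set Q : (Fin N → ℝ) → (Fin N → ℝ) → ℝ := fun x y =>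
    ∑ a, d a * ((∑ j, x j * u j a) * ∑ k, y k * u k a) with hQ
  set W : (Fin N → ℝ) → ℝ := fun x => ∑ k, w k * x k ^ 2 with hW
  have hWnn : ∀ x, 0 ≤ W x := fun x => Finset.sum_nonneg fun k _ => by
    have := hw0 k; positivity
  set p : Fin N → ℝ := fun k => if k ∈ s then c k else 0 with hp
  set q : Fin N → ℝ := fun k => if k ∈ s then 0 else c k with hq
  have hpW : W p ≤ W c := Finset.sum_le_sum fun k _ => by
    have := hw0 k
    simp only [hp]
    split_ifs
    · exact le_rfl
    · have : 0 ≤ w k * c k ^ 2 := by positivity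
      simpa using this
  have hqW : W q ≤ W c := Finset.sum_le_sum fun k _ => by
    have := hw0 k
    simp only [hq]
    split_ifs
    · have : 0 ≤ w k * c k ^ 2 := by positivity
      simpa using this
    · exact le_rfl
  have hpQ : ∀ y, W y ≤ W c → |Q p y| ≤ 1 / 10 * W c := by
    intro y hy
    apply abs_le_of_sq_le_sq _ (by have := hWnn c; positivity)
    simp only [hQ]
    rw [sum_mul_expand]
    refine (sum_sum_mul_sq_le s (cross u d) (e := y) hw0 (fun j hj => if_neg hj) hF).trans ?_
    have : W p * W y ≤ W c * W c := mul_le_mul hpW hy (hWnn _) (hWnn _)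
    simp only [hW] at this ⊢
    nlinarith
  have hqQ : |Q q q| ≤ 1 / 2 * W c := by
    have h1 : |Q q q| ≤ ∑ a, X ^ 4 * (∑ j, q j * u j a) ^ 2 := by
      refine (Finset.abs_sum_le_sum_abs _ _).trans (Finset.sum_le_sum fun a _ => ?_)
      rw [abs_mul, ← sq, abs_sq]
      exact mul_le_mul_of_nonneg_right (h.pert a) (sq_nonneg _)
    rw [← Finset.mul_sum, h.spec.parseval] at h1
    refine h1.trans (le_trans ?_ (mul_le_mul_of_nonneg_left hqW (by norm_num)))
    simp only [hW, Finset.mul_sum]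
    refine Finset.sum_le_sum fun k _ => ?_
    by_cases hk : k ∈ s
    · simp [hq, hk]
    · have hlk : lam k < 2 - X ^ 3 := by
        simpa only [hs, Finset.mem_filter, Finset.mem_univ, true_and, not_le] using hk
      rw [← mul_assoc]
      gcongr
      have h2 : X ^ 3 * (3 / 4) ≤ |lam k - x| := by
        rw [abs_sub_comm]
        exact le_trans (by linarith) (le_abs_self _)
      have h3 : 0 ≤ T ^ 9 / N := by positivity
      have h4 : X ^ 4 ≤ X ^ 3 * (1 / 10 ^ 6) := by
        rw [pow_succ]; gcongr
      simp only [hw]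
      norm_num at h4
      linarith
  have hsplit : ∀ a, (∑ j, c j * u j a) = (∑ j, p j * u j a) + ∑ j, q j * u j a := by
    intro a
    rw [← Finset.sum_add_distrib]
    refine Finset.sum_congr rfl fun j _ => ?_
    simp only [hp, hq]
    split_ifs <;> ring
  have hQc : ∑ a, d a * (∑ j, c j * u j a) ^ 2 = Q p c + Q p q + Q q q := by
    simp only [hQ]
    rw [← Finset.sum_add_distrib, ← Finset.sum_add_distrib]
    refine Finset.sum_congr rfl fun a _ => ?_
    rw [hsplit]; ring
  rw [hQc]
  have h1 := hpQ c le_rfl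
  have h2 := hpQ q hqW
  have h3 := abs_add_le (Q p c + Q p q) (Q q q)
  have h4 := abs_add_le (Q p c) (Q p q)
  have h5 := hWnn c
  change _ ≤ W c
  linarith

end PerturbRegular

end

section

namespace SpecData

variable {N : ℕ} {A B : Matrix (Fin N) (Fin N) ℝ} {lam mu : Fin N → ℝ} {u v : Fin N → Fin N → ℝ}

lemma reconstruct (h : SpecData A lam u) (y : Fin N → ℝ) (b : Fin N) :
    ∑ k, (∑ a, y a * u k a) * u k b = y b := by
  simp_rw [Finset.sum_mul]
  rw [Finset.sum_comm]
  have : ∀ a, ∑ k, y a * u k a * u k b = y a * (if a = b then 1 else 0) := by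
    intro a
    rw [← h.compl, Finset.mul_sum]
    exact Finset.sum_congr rfl fun k _ => by ring
  simp [this]

lemma sum_coef_sq (h : SpecData A lam u) (y : Fin N → ℝ) :
    ∑ k, (∑ a, y a * u k a) ^ 2 = ∑ a, y a ^ 2 := by
  rw [← h.parseval]
  simp_rw [h.reconstruct]

lemma quadForm_eq (h : SpecData A lam u) (y : Fin N → ℝ) :
    ∑ a, ∑ b, y a * A a b * y b = ∑ k, lam k * (∑ a, y a * u k a) ^ 2 := by
  have h1 : ∀ a b, y a * A a b * y b = ∑ k, lam k * (y a * u k a) * (y b * u k b) := by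
    intro a b
    rw [h.spec, Finset.mul_sum, Finset.sum_mul]
    exact Finset.sum_congr rfl fun k _ => by ring
  have h2 : ∀ k, lam k * (∑ a, y a * u k a) ^ 2 =
      ∑ a, ∑ b, lam k * (y a * u k a) * (y b * u k b) := by
    intro k
    rw [sq, Finset.sum_mul_sum, Finset.mul_sum]
    refine Finset.sum_congr rfl fun a _ => ?_
    rw [Finset.mul_sum]
    exact Finset.sum_congr rfl fun b _ => by ring
  simp_rw [h1, h2]
  rw [Finset.sum_comm' (s := Finset.univ (α := Fin N)) (t := fun _ => Finset.univ)
    (t' := Finset.univ (α := Fin N)) (s' := fun _ => Finset.univ) (by simp)]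
  rw [Finset.sum_congr rfl fun b _ => Finset.sum_comm, Finset.sum_comm]
  refine Finset.sum_congr rfl fun k _ => Finset.sum_comm

lemma neg (h : SpecData A lam u) : SpecData (-A) (fun k => -lam k) u where
  orth := h.orth
  compl := h.compl
  spec a b := by rw [Matrix.neg_apply, h.spec, ← Finset.sum_neg_distrib]; simp

lemma card_gt_le (hB : SpecData B mu v) {x θ : ℝ}
    (hq : ∀ y : Fin N → ℝ, (∀ k, x < lam k → ∑ a, y a * u k a = 0) →
      ∑ a, ∑ b, y a * B a b * y b ≤ θ * ∑ a, y a ^ 2) :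
    (Finset.univ.filter fun j => θ < mu j).card ≤ (Finset.univ.filter fun j => x < lam j).card := by
  classical
  by_contra! hlt
  set Φ : (Fin N → ℝ) →ₗ[ℝ] (({k // x < lam k} ⊕ {j // ¬ θ < mu j}) → ℝ) :=
    { toFun := fun y => Sum.elim (fun k => ∑ a, y a * u k a) (fun j => ∑ a, y a * v j a)
      map_add' := fun y y' => by
        funext i
        rcases i with i | i <;> simp [add_mul, Finset.sum_add_distrib]
      map_smul' := fun r y => by
        funext i
        rcases i with i | i <;> simp [Finset.mul_sum, mul_assoc] } with hΦ
  have hcard : Module.finrank ℝ (({k // x < lam k} ⊕ {j // ¬ θ < mu j}) → ℝ) <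
      Module.finrank ℝ (Fin N → ℝ) := by
    rw [Module.finrank_fintype_fun_eq_card, Module.finrank_fintype_fun_eq_card, Fintype.card_sum,
      Fintype.card_subtype, Fintype.card_subtype]
    have := Finset.card_filter_add_card_filter_not (s := Finset.univ) (fun j => θ < mu j)
    rw [Finset.card_univ] at this
    omega
  obtain ⟨y, hy, hy0⟩ :=
    Submodule.exists_mem_ne_zero_of_ne_bot (LinearMap.ker_ne_bot_of_finrank_lt (f := Φ) hcard)
  rw [LinearMap.mem_ker] at hy
  have h1 : ∀ k, x < lam k → ∑ a, y a * u k a = 0 := fun k hk => congrFun hy (Sum.inl ⟨k, hk⟩)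
  have h2 : ∀ j, ¬ θ < mu j → ∑ a, y a * v j a = 0 := fun j hj => congrFun hy (Sum.inr ⟨j, hj⟩)
  have h3 := hq y h1
  rw [hB.quadForm_eq, ← hB.sum_coef_sq y, Finset.mul_sum] at h3
  have h4 : ∀ j ∈ Finset.univ, θ * (∑ a, y a * v j a) ^ 2 ≤ mu j * (∑ a, y a * v j a) ^ 2 := by
    intro j _
    by_cases hj : θ < mu j
    · gcongr
    · simp [h2 j hj]
  have h5 := (Finset.sum_eq_sum_iff_of_le h4).mp (le_antisymm (Finset.sum_le_sum h4) h3)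
  apply hy0
  funext b
  rw [← hB.reconstruct y b]
  refine Finset.sum_eq_zero fun j _ => ?_
  by_cases hj : θ < mu j
  · have h6 := h5 j (Finset.mem_univ j)
    have h7 : (mu j - θ) * (∑ a, y a * v j a) ^ 2 = 0 := by linarith
    rcases mul_eq_zero.mp h7 with h8 | h8
    · linarith
    · rw [pow_eq_zero_iff two_ne_zero] at h8
      rw [h8, zero_mul]
  · rw [h2 j hj, zero_mul]

end SpecData

lemma evalsDesc_antitone {N : ℕ} {A : Matrix (Fin N) (Fin N) ℝ} (hA : A.IsHermitian) :
    Antitone (evalsDesc hA) := by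
  intro i j hij
  have := Tuple.monotone_sort (fun j => -hA.eigenvalues j) hij
  exact neg_le_neg this

lemma evalsDesc_eq {N : ℕ} {A : Matrix (Fin N) (Fin N) ℝ} (hA : A.IsHermitian) (i : Fin N) :
    evalsDesc hA i = hA.eigenvalues (Tuple.sort (fun j => -hA.eigenvalues j) i) := by
  simp [evalsDesc]

lemma card_evalsDesc {N : ℕ} {A : Matrix (Fin N) (Fin N) ℝ} (hA : A.IsHermitian) (p : ℝ → Prop)
    [DecidablePred p] : (Finset.univ.filter fun i => p (evalsDesc hA i)).card =
      (Finset.univ.filter fun j => p (hA.eigenvalues j)).card := by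
  refine Finset.card_equiv (Tuple.sort fun j => -hA.eigenvalues j) fun i => ?_
  simp [evalsDesc_eq]

lemma Antitone.le_of_card_gt_le {N : ℕ} {α β : Fin N → ℝ} (hα : Antitone α) (hβ : Antitone β)
    {x θ : ℝ} (h : (Finset.univ.filter fun j => θ < β j).card ≤
      (Finset.univ.filter fun j => x < α j).card) {i : Fin N} (hi : α i ≤ x) : β i ≤ θ := by
  by_contra! hlt
  have h1 : Finset.Iic i ⊆ Finset.univ.filter fun j => θ < β j := fun j hj => by
    rw [Finset.mem_filter]
    exact ⟨Finset.mem_univ _, hlt.trans_le (hβ (Finset.mem_Iic.mp hj))⟩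
  have h2 : (Finset.univ.filter fun j => x < α j) ⊆ Finset.Iio i := fun j hj => by
    rw [Finset.mem_filter] at hj
    rw [Finset.mem_Iio]
    by_contra! hc
    linarith [hα hc, hj.2]
  have h3 := Finset.card_le_card h1
  have h4 := Finset.card_le_card h2
  rw [Fin.card_Iic] at h3
  rw [Fin.card_Iio] at h4
  omega

lemma Antitone.ge_of_card_lt_le {N : ℕ} {α β : Fin N → ℝ} (hα : Antitone α) (hβ : Antitone β)
    {x θ : ℝ} (h : (Finset.univ.filter fun j => β j < θ).card ≤
      (Finset.univ.filter fun j => α j < x).card) {i : Fin N} (hi : x ≤ α i) : θ ≤ β i := by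
  by_contra! hlt
  have h1 : Finset.Ici i ⊆ Finset.univ.filter fun j => β j < θ := fun j hj => by
    rw [Finset.mem_filter]
    exact ⟨Finset.mem_univ _, (hβ (Finset.mem_Ici.mp hj)).trans_lt hlt⟩
  have h2 : (Finset.univ.filter fun j => α j < x) ⊆ Finset.Ioi i := fun j hj => by
    rw [Finset.mem_filter] at hj
    rw [Finset.mem_Ioi]
    by_contra! hc
    linarith [hα hc, hj.2]
  have h3 := Finset.card_le_card h1
  have h4 := Finset.card_le_card h2
  rw [Fin.card_Ici] at h3
  rw [Fin.card_Ioi] at h4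
  have := i.isLt
  omega

end

section

namespace PerturbRegular

open SpecData

variable {N : ℕ} {X T : ℝ} {A B : Matrix (Fin N) (Fin N) ℝ} {lam mu : Fin N → ℝ}
  {u v : Fin N → Fin N → ℝ} {d : Fin N → ℝ}

lemma abs_quadForm_sub_le (h : PerturbRegular N X T A lam u d)
    (hB : ∀ a b, B a b = A a b + if a = b then d a else 0) {x : ℝ} (hx1 : 2 - X ^ 3 / 4 ≤ x)
    (hx2 : x * X ^ 6 ≤ 1) (y : Fin N → ℝ) :
    |∑ a, ∑ b, y a * B a b * y b - ∑ k, lam k * (∑ a, y a * u k a) ^ 2| ≤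
      ∑ k, (|lam k - x| + T ^ 9 / N) * (∑ a, y a * u k a) ^ 2 := by
  have h1 := h.abs_quadForm_le hx1 hx2 fun k => ∑ a, y a * u k a
  simp_rw [h.spec.reconstruct] at h1
  refine le_trans (le_of_eq ?_) h1
  congr 1
  rw [← h.spec.quadForm_eq, ← Finset.sum_sub_distrib]
  refine Finset.sum_congr rfl fun a _ => ?_
  rw [← Finset.sum_sub_distrib]
  have : ∀ b, y a * B a b * y b - y a * A a b * y b = if a = b then d a * y a * y b else 0 := by
    intro b
    rw [hB]
    split_ifs <;> ring
  simp_rw [this]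
  simp
  ring

lemma card_gt_le (h : PerturbRegular N X T A lam u d)
    (hB : ∀ a b, B a b = A a b + if a = b then d a else 0) (hv : SpecData B mu v) {x : ℝ}
    (hx1 : 2 - X ^ 3 / 4 ≤ x) (hx2 : x * X ^ 6 ≤ 1) :
    (Finset.univ.filter fun j => x + T ^ 9 / N < mu j).card ≤
      (Finset.univ.filter fun j => x < lam j).card := by
  refine hv.card_gt_le (u := u) fun y hy => ?_
  have h1 := (abs_le.mp (h.abs_quadForm_sub_le hB hx1 hx2 y)).2
  rw [← h.spec.sum_coef_sq, Finset.mul_sum]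
  rw [sub_le_iff_le_add, ← Finset.sum_add_distrib] at h1
  refine h1.trans (Finset.sum_le_sum fun k _ => ?_)
  by_cases hk : x < lam k
  · simp [hy k hk]
  · rw [abs_of_nonpos (by linarith)]
    apply le_of_eq; ring

lemma card_lt_le (h : PerturbRegular N X T A lam u d)
    (hB : ∀ a b, B a b = A a b + if a = b then d a else 0) (hv : SpecData B mu v) {x : ℝ}
    (hx1 : 2 - X ^ 3 / 4 ≤ x) (hx2 : x * X ^ 6 ≤ 1) :
    (Finset.univ.filter fun j => mu j < x - T ^ 9 / N).card ≤
      (Finset.univ.filter fun j => lam j < x).card := by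
  have h0 := hv.neg.card_gt_le (lam := fun k => -lam k) (x := -x) (θ := -(x - T ^ 9 / N)) (u := u)
    fun y hy => ?_
  · simpa only [neg_lt_neg_iff] using h0
  have h1 := (abs_le.mp (h.abs_quadForm_sub_le hB hx1 hx2 y)).1
  simp only [Matrix.neg_apply, mul_neg, neg_mul, Finset.sum_neg_distrib]
  rw [neg_le_neg_iff, ← h.spec.sum_coef_sq, Finset.mul_sum]
  rw [neg_le_sub_iff_le_add, ← sub_le_iff_le_add, ← Finset.sum_sub_distrib] at h1
  refine le_trans (Finset.sum_le_sum fun k _ => ?_) h1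
  by_cases hk : lam k < x
  · simp [hy k (by linarith)]
  · rw [abs_of_nonneg (by linarith)]
    apply le_of_eq; ring

lemma trace_diff_le {hA : A.IsHermitian} (h : PerturbRegular N X T A hA.eigenvalues u d)
    (hBH : B.IsHermitian) (hB : ∀ a b, B a b = A a b + if a = b then d a else 0)
    {f : ℝ → ℝ} (hf : Differentiable ℝ f) {K p q : ℝ} (hp : 2 - X ^ 3 / 8 ≤ p)
    (hpq : q ≤ p + 3 * X ^ 9) (hsupp : ∀ x, x ∉ Set.Icc p q → f x = 0)
    (hK : ∀ x, |deriv f x| ≤ K) :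
    |∑ i, f (evalsDesc hA i) - ∑ i, f (evalsDesc hBH i)| ≤ 16 * T * (K * (T ^ 9 / N)) := by
  classical
  have hX := h.params.X_pos
  have hX1 := h.params.X_le
  have hT := h.params.T_pos
  have hN := h.params.Nr_pos
  have hK0 : 0 ≤ K := (abs_nonneg _).trans (hK 0)
  have hX3 : 0 < X ^ 3 := by positivity
  have hη : 0 < X ^ 9 := by positivity
  have hX6 : X ^ 6 ≤ 1 / 10 ^ 6 := by
    calc X ^ 6 ≤ X ^ 1 := pow_le_pow_of_le_one hX.le (hX1.trans (by norm_num)) (by norm_num)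
      _ ≤ _ := by simpa using hX1
  have hη3 : X ^ 9 ≤ X ^ 3 / 16 := by
    have : X ^ 6 ≤ 1 / 16 := hX6.trans (by norm_num)
    calc X ^ 9 = X ^ 6 * X ^ 3 := by ring
      _ ≤ 1 / 16 * X ^ 3 := by gcongr
      _ = _ := by ring
  have hν0 : 0 < T ^ 9 / N := by positivity
  have hν : T ^ 9 / N ≤ X ^ 9 / 2 := by
    have h1 := h.params.X_mul_pow_le (k := 10) (by norm_num)
    have h2 : X * T ^ 9 ≤ 1 / 2 := by
      have h3 : 2 * (X * T ^ 9) ≤ T * (X * T ^ 9) := by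
        gcongr; linarith [h.params.T_large]
      have : T * (X * T ^ 9) = X * T ^ 10 := by ring
      linarith
    rw [div_le_iff₀ hN]
    calc T ^ 9 = N * X ^ 10 * T ^ 9 := by rw [h.params.N_eq, one_mul]
      _ = N * X ^ 9 * (X * T ^ 9) := by ring
      _ ≤ N * X ^ 9 * (1 / 2) := by gcongr
      _ = _ := by ring
  set ν := T ^ 9 / N with hνd
  obtain ⟨v, hv⟩ := exists_specData hBH
  have hx0 : (2 - X ^ 3 / 4) * X ^ 6 ≤ 1 := by
    have : (2 - X ^ 3 / 4) * X ^ 6 ≤ 2 * X ^ 6 := by gcongr; linarith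
    norm_num at hX6; linarith
  set α := evalsDesc hA with hα
  set β := evalsDesc hBH with hβ
  have hαa : Antitone α := evalsDesc_antitone hA
  have hβa : Antitone β := evalsDesc_antitone hBH
  have hcg : ∀ x, 2 - X ^ 3 / 4 ≤ x → x * X ^ 6 ≤ 1 →
      (Finset.univ.filter fun j => x + ν < β j).card ≤
        (Finset.univ.filter fun j => x < α j).card := by
    intro x h1 h2
    rw [card_evalsDesc hBH fun y => x + ν < y, card_evalsDesc hA fun y => x < y]
    exact h.card_gt_le hB hv h1 h2
  have hcl : ∀ x, 2 - X ^ 3 / 4 ≤ x → x * X ^ 6 ≤ 1 →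
      (Finset.univ.filter fun j => β j < x - ν).card ≤
        (Finset.univ.filter fun j => α j < x).card := by
    intro x h1 h2
    rw [card_evalsDesc hBH fun y => y < x - ν, card_evalsDesc hA fun y => y < x]
    exact h.card_lt_le hB hv h1 h2
  have hαR : ∀ i, α i * X ^ 6 ≤ 1 := by
    intro i
    rw [hα, evalsDesc_eq]
    exact (mul_le_mul_of_nonneg_right (le_abs_self _) (by positivity)).trans (h.eig _)
  have hlow : ∀ i, α i < 2 - X ^ 3 / 4 → β i ≤ 2 - X ^ 3 / 4 + ν := fun i hi =>
    hαa.le_of_card_gt_le hβa (hcg _ le_rfl hx0) hi.le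
  have hhigh : ∀ i, 2 - X ^ 3 / 4 ≤ α i → |α i - β i| ≤ ν := by
    intro i hi
    have h1 := hαa.le_of_card_gt_le hβa (hcg _ hi (hαR i)) le_rfl
    have h2 := hαa.ge_of_card_lt_le hβa (hcl _ hi (hαR i)) le_rfl
    rw [abs_le]; constructor <;> linarith
  have hLip : ∀ x y, |f x - f y| ≤ K * |x - y| := by
    intro x y
    have := Convex.norm_image_sub_le_of_norm_deriv_le (s := Set.univ) (f := f) (C := K)
      (fun z _ => hf z) (fun z _ => by simpa using hK z) convex_univ (Set.mem_univ y)
      (Set.mem_univ x)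
    simpa using this
  set S := Finset.univ.filter fun i => 2 - X ^ 3 ≤ α i ∧ p - X ^ 9 / 2 ≤ α i ∧
    α i ≤ p - X ^ 9 / 2 + 4 * X ^ 9 with hS
  have hzero : ∀ i, i ∉ S → f (α i) - f (β i) = 0 := by
    intro i hi
    by_cases hlo : α i < 2 - X ^ 3 / 4
    · have h1 := hlow i hlo
      rw [hsupp (α i) fun hc => by linarith [hc.1], hsupp (β i) fun hc => by linarith [hc.1],
        sub_zero]
    · push Not at hlo
      have h1 := abs_le.mp (hhigh i hlo)
      have h2 : ∀ z, |α i - z| ≤ ν → z ∉ Set.Icc p q := by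
        intro z hz hc
        have h3 := abs_le.mp hz
        apply hi
        rw [hS, Finset.mem_filter]
        exact ⟨Finset.mem_univ _, by linarith, by linarith [hc.1], by linarith [hc.2]⟩
      rw [hsupp (α i) (h2 _ (by simpa using hν0.le)), hsupp (β i) (h2 _ (hhigh i hlo)), sub_zero]
  have hterm : ∀ i ∈ S, |f (α i) - f (β i)| ≤ K * ν := by
    intro i hi
    rw [hS, Finset.mem_filter] at hi
    exact (hLip _ _).trans (mul_le_mul_of_nonneg_left (hhigh i (by linarith [hi.2.2.1])) hK0)
  have hcard : (S.card : ℝ) ≤ 16 * T := by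
    rw [hS, card_evalsDesc hA fun y => 2 - X ^ 3 ≤ y ∧ p - X ^ 9 / 2 ≤ y ∧
      y ≤ p - X ^ 9 / 2 + 4 * X ^ 9]
    set W : ℕ → Finset (Fin N) := fun m => Finset.univ.filter fun j => 2 - X ^ 3 ≤ hA.eigenvalues j ∧
      p - X ^ 9 / 2 + m * X ^ 9 ≤ hA.eigenvalues j ∧
      hA.eigenvalues j ≤ p - X ^ 9 / 2 + m * X ^ 9 + X ^ 9 with hW
    have hsub : (Finset.univ.filter fun j => 2 - X ^ 3 ≤ hA.eigenvalues j ∧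
        p - X ^ 9 / 2 ≤ hA.eigenvalues j ∧ hA.eigenvalues j ≤ p - X ^ 9 / 2 + 4 * X ^ 9) ⊆
        (Finset.range 4).biUnion W := by
      intro j hj
      rw [Finset.mem_filter] at hj
      obtain ⟨-, h1, h2, h3⟩ := hj
      simp only [Finset.mem_biUnion, hW, Finset.mem_filter, Finset.mem_univ, true_and,
        Finset.mem_range]
      by_cases c1 : hA.eigenvalues j ≤ p - X ^ 9 / 2 + X ^ 9
      · exact ⟨0, by norm_num, h1, by simpa using h2, by simpa using c1⟩
      by_cases c2 : hA.eigenvalues j ≤ p - X ^ 9 / 2 + 2 * X ^ 9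
      · exact ⟨1, by norm_num, h1, by push_cast; linarith, by push_cast; linarith⟩
      by_cases c3 : hA.eigenvalues j ≤ p - X ^ 9 / 2 + 3 * X ^ 9
      · exact ⟨2, by norm_num, h1, by push_cast; linarith, by push_cast; linarith⟩
      · exact ⟨3, by norm_num, h1, by push_cast; linarith, by push_cast; linarith⟩
    have h1 := (Finset.card_le_card hsub).trans Finset.card_biUnion_le
    have h2 : ((∑ m ∈ Finset.range 4, (W m).card : ℕ) : ℝ) ≤ ∑ m ∈ Finset.range 4, 4 * T := by
      push_cast
      exact Finset.sum_le_sum fun m _ => h.card_window_le _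
    rw [Finset.sum_const, Finset.card_range, nsmul_eq_mul] at h2
    have h3 : ((_ : ℕ) : ℝ) ≤ _ := Nat.cast_le.mpr h1
    refine h3.trans (h2.trans (le_of_eq ?_))
    push_cast; ring
  rw [← Finset.sum_sub_distrib, ← Finset.sum_subset (Finset.subset_univ S) fun i _ hi => hzero i hi]
  calc _ ≤ ∑ i ∈ S, K * ν := (Finset.abs_sum_le_sum_abs _ _).trans (Finset.sum_le_sum hterm)
    _ = S.card * (K * ν) := by rw [Finset.sum_const, nsmul_eq_mul]
    _ ≤ _ := by gcongr

end PerturbRegular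

end

section

/-- Rows of products of imaginary parts of two resolvents of the zero-diagonal matrix. -/
def imProd (N : ℕ) (z w : ℂ) (a b : Fin N) (g : Fin N → Fin N → ℝ) (c : Fin N) : ℝ :=
  (resolventM N (Mmat N g) z a c).im * (resolventM N (Mmat N g) w c b).im

/-- Entrywise bound and trace estimate. -/
structure TypicalTrace (N : ℕ) (X T : ℝ) (g : Fin N → Fin N → ℝ) : Prop where
  entry : ∀ i j, |g i j| ≤ T
  trace : ∀ E, IsGridPt N X E → ‖errTrace N ⟨E, X ^ 9⟩ (Mmat N g)‖ ≤ T ^ 2 * X ^ 2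

/-- Diagonal Green function estimate and concentration of the diagonal perturbation. -/
structure Typical (N : ℕ) (X T : ℝ) (g : Fin N → Fin N → ℝ) : Prop extends
    TypicalTrace N X T g where
  diag : ∀ E, IsGridPt N X E → ∀ k, ‖errDiag N ⟨E, X ^ 9⟩ k (Mmat N g)‖ ≤ T * (T * (T * X))
  quad : ∀ E, IsGridPt N X E → ∀ E', IsGridPt N X E' → ∀ s ≤ Nat.clog 2 (N ^ 2), ∀ a b,
    (∑ c, imProd N ⟨E, X ^ 9⟩ ⟨E', 2 ^ s * X ^ 9⟩ a b g c * g c c) ^ 2 ≤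
      T * ∑ c, imProd N ⟨E, X ^ 9⟩ ⟨E', 2 ^ s * X ^ 9⟩ a b g c ^ 2

variable {N : ℕ} {X T : ℝ}

lemma ScaleParams.two_mul_T_mul_X (hp : ScaleParams N X T) : 2 * (T * X) ≤ 1 := by
  have hX := hp.X_pos
  have hT := hp.T_pos
  have h1 := hp.X_mul_pow_le (k := 2) (by norm_num)
  have h2 : 2 * (T * X) ≤ T * (T * X) := by
    gcongr; linarith [hp.T_large]
  linarith [show T * (T * X) = X * T ^ 2 by ring]

lemma TypicalTrace.traceRegular {g : Fin N → Fin N → ℝ} (h : TypicalTrace N X T g)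
    (hp : ScaleParams N X T) {u : Fin N → Fin N → ℝ}
    (hu : SpecData (Mmat N g) (Mmat_isHermitian N g).eigenvalues u) :
    TraceRegular N X T (Mmat N g) (Mmat_isHermitian N g).eigenvalues u where
  params := hp
  herm := Mmat_isHermitian N g
  spec := hu
  err := h.trace
  eig j := by
    have hX := hp.X_pos
    have hT := hp.T_pos
    have hN := hp.Nr_pos
    have hsq : 1 / Real.sqrt (2 * N) ≤ X ^ 5 := by
      rw [div_le_iff₀ (by positivity)]
      apply le_of_sq_le_sq _ (by positivity)
      rw [mul_pow, Real.sq_sqrt (by positivity)]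
      have := hp.N_eq
      nlinarith
    have hM : ∀ a b, |Mmat N g a b| ≤ 2 * T * X ^ 5 := by
      intro a b
      rw [Mmat]
      split_ifs
      · rw [abs_zero]; positivity
      · rw [abs_div, abs_of_nonneg (Real.sqrt_nonneg _), div_eq_mul_one_div]
        have h1 := (abs_add_le (g a b) (g b a)).trans (add_le_add (h.entry a b) (h.entry b a))
        gcongr
        linarith
    have h1 := hu.quadForm_eq (u j)
    simp_rw [hu.orth] at h1
    simp only [ite_pow, one_pow, ne_eq, OfNat.ofNat_ne_zero, not_false_eq_true, zero_pow, mul_ite,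
      mul_one, mul_zero, Finset.sum_ite_eq, Finset.mem_univ, if_true] at h1
    rw [← h1]
    have h2 : |∑ a, ∑ b, u j a * Mmat N g a b * u j b| ≤ 2 * T * X ^ 5 * (∑ a, |u j a|) ^ 2 := by
      rw [sq, Finset.sum_mul_sum, Finset.mul_sum]
      refine (Finset.abs_sum_le_sum_abs _ _).trans (Finset.sum_le_sum fun a _ => ?_)
      rw [Finset.mul_sum]
      refine (Finset.abs_sum_le_sum_abs _ _).trans (Finset.sum_le_sum fun b _ => ?_)
      rw [abs_mul, abs_mul]
      have := mul_le_mul_of_nonneg_right (hM a b) (by positivity : 0 ≤ |u j a| * |u j b|)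
      linarith
    have h3 : (∑ a, |u j a|) ^ 2 ≤ N := by
      have := sq_sum_le_card_mul_sum_sq (s := Finset.univ) (f := fun a => |u j a|)
      simp_rw [sq_abs, hu.sum_sq_one'] at this
      simpa using this
    calc _ ≤ 2 * T * X ^ 5 * N * X ^ 6 := by
          gcongr
          exact h2.trans (by gcongr)
      _ = 2 * (T * X) * (N * X ^ 10) := by ring
      _ ≤ _ := by rw [hp.N_eq, mul_one]; exact hp.two_mul_T_mul_X

lemma Typical.perturbRegular {g : Fin N → Fin N → ℝ} (h : Typical N X T g)
    (hp : ScaleParams N X T) {u : Fin N → Fin N → ℝ}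
    (hu : SpecData (Mmat N g) (Mmat_isHermitian N g).eigenvalues u) :
    PerturbRegular N X T (Mmat N g) (Mmat_isHermitian N g).eigenvalues u
      (fun c => Real.sqrt (2 / N) * g c c) where
  toTraceRegular := h.traceRegular hp hu
  diag := h.diag
  pert c := by
    have hX := hp.X_pos
    have hT := hp.T_pos
    have hN := hp.Nr_pos
    have hsq : Real.sqrt (2 / N) ≤ 2 * X ^ 5 := by
      rw [Real.sqrt_le_left (by positivity), div_le_iff₀ hN]
      have := hp.N_eq
      nlinarith
    rw [abs_mul, abs_of_nonneg (Real.sqrt_nonneg _)]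
    calc _ ≤ 2 * X ^ 5 * T := by gcongr; exact h.entry c c
      _ = 2 * (T * X) * X ^ 4 := by ring
      _ ≤ 1 * X ^ 4 := by gcongr; exact hp.two_mul_T_mul_X
      _ = _ := one_mul _
  quad E E' hE hE' s hs a b := by
    have hN := hp.Nr_pos
    have h1 := mul_le_mul_of_nonneg_left (h.quad E hE E' hE' s hs a b)
      (by positivity : 0 ≤ 2 / (N : ℝ))
    simp only [imProd] at h1
    refine le_trans (le_of_eq ?_) (h1.trans (le_of_eq (by ring)))
    rw [← Real.sq_sqrt (by positivity : 0 ≤ 2 / (N : ℝ)), ← mul_pow, Finset.mul_sum,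
      Real.sq_sqrt (by positivity : 0 ≤ 2 / (N : ℝ))]
    congr 1
    exact Finset.sum_congr rfl fun c _ => by ring

lemma Hmat_eq_add (N : ℕ) (g : Fin N → Fin N → ℝ) (a b : Fin N) :
    Hmat N g a b = Mmat N g a b + if a = b then Real.sqrt (2 / N) * g a a else 0 := by
  unfold Hmat Mmat
  split_ifs <;> simp

lemma measureReal_exists_finset_le {Ω ι : Type*} [MeasurableSpace Ω] (μ : Measure Ω)
    [IsFiniteMeasure μ] (s : Finset ι) (P : ι → Ω → Prop) {c : ℝ}
    (h : ∀ i ∈ s, μ.real {ω | P i ω} ≤ c) : μ.real {ω | ∃ i ∈ s, P i ω} ≤ s.card * c := by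
  have e : {ω | ∃ i ∈ s, P i ω} = ⋃ i ∈ s, {ω | P i ω} := by
    ext ω; simp
  rw [e]
  refine (measureReal_biUnion_finset_le s _).trans ?_
  rw [← nsmul_eq_mul]
  exact Finset.sum_le_card_nsmul _ _ _ h

lemma measureReal_exists_gridPt_le {Ω : Type*} [MeasurableSpace Ω] (μ : Measure Ω)
    [IsFiniteMeasure μ] (P : ℝ → Ω → Prop) {c : ℝ} (hc : 0 ≤ c)
    (h : ∀ E, IsGridPt N X E → μ.real {ω | P E ω} ≤ c) :
    μ.real {ω | ∃ E, IsGridPt N X E ∧ P E ω} ≤ (N : ℝ) ^ 2 * c := by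
  have h1 := measureReal_exists_finset_le μ (Finset.range (N ^ 2))
    (fun l ω => IsGridPt N X (gridPt X l) ∧ P (gridPt X l) ω) (c := c) fun l _ => by
      by_cases hl : IsGridPt N X (gridPt X l)
      · simpa [hl] using h _ hl
      · simpa [hl] using hc
  rw [Finset.card_range] at h1
  push_cast at h1
  refine le_trans (measureReal_mono fun ω hω => ?_) h1
  obtain ⟨E, hE, hP⟩ := hω
  obtain ⟨⟨l, hl, rfl⟩, _⟩ := id hE
  exact ⟨l, Finset.mem_range.mpr hl, hE, hP⟩

lemma measureReal_not_typicalTrace_le (hp : ScaleParams N X T) {m : ℕ} (hm : 36 * (2 * m + 1) ≤ T) :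
    (gMeasure N).real {g | ¬ TypicalTrace N X T g} ≤
      (N : ℝ) ^ 2 * (2 * Real.exp (-T / 2)) + (N : ℝ) ^ 2 * T⁻¹ ^ (2 * m + 2) := by
  have hT := hp.T_pos
  have h1 := measureReal_exists_finset_le (gMeasure N) (Finset.univ : Finset (Fin N × Fin N))
    (fun p g => T < |g p.1 p.2|) (c := 2 * Real.exp (-T / 2)) fun p _ => by
      refine (gMeasure_entry_tail N p.1 p.2 T hT.le).trans ?_
      gcongr
      nlinarith [hp.one_le_T]
  have h2 := measureReal_exists_gridPt_le (N := N) (X := X) (gMeasure N)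
    (fun E g => T ^ 2 * X ^ 2 < ‖errTrace N ⟨E, X ^ 9⟩ (Mmat N g)‖) (c := T⁻¹ ^ (2 * m + 2))
    (by positivity) fun E hE => errTrace_tail hp (hE.ge hp.X_pos) hE.2 hm
  rw [Finset.card_univ, Fintype.card_prod, Fintype.card_fin] at h1
  push_cast at h1
  rw [← sq] at h1
  refine le_trans (measureReal_mono fun g hg => ?_) ((measureReal_union_le _ _).trans
    (add_le_add h1 h2))
  by_contra hc
  simp only [Set.mem_union, Set.mem_ofPred_eq, not_or, not_exists, not_and, not_lt] at hc
  exact hg ⟨fun i j => hc.1 (i, j) (Finset.mem_univ _), hc.2⟩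

lemma measureReal_not_typical_le (hp : ScaleParams N X T) {n m : ℕ} (hm : 36 * (2 * m + 1) ≤ T)
    (hn : 1000 * (2 * n + 1) ≤ T) (hnm : (N : ℝ) ^ 2 * (2 * Real.exp (-T / 2)) +
      (N : ℝ) ^ 2 * T⁻¹ ^ (2 * m + 2) ≤ X ^ (60 * (n + 2))) :
    (gMeasure N).real {g | ¬ Typical N X T g} ≤
      (N : ℝ) ^ 2 * (2 * Real.exp (-T / 2)) + (N : ℝ) ^ 2 * T⁻¹ ^ (2 * m + 2) +
      (N : ℝ) ^ 2 * (N * (2 * T⁻¹ ^ (2 * n + 2))) +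
      (N : ℝ) ^ 2 * ((N : ℝ) ^ 2 * (2 * (N : ℝ) ^ 2 * ((N : ℝ) ^ 2 * (2 * Real.exp (-T / 2))))) := by
  have hT := hp.T_pos
  have hX := hp.X_pos
  have hN := hp.N_pos
  have hη : 0 < X ^ 9 := by positivity
  have h1 := measureReal_not_typicalTrace_le hp hm
  have h2 := measureReal_exists_gridPt_le (N := N) (X := X) (gMeasure N)
    (fun E g => ∃ k ∈ (Finset.univ : Finset (Fin N)),
      T * (T * (T * X)) < ‖errDiag N ⟨E, X ^ 9⟩ k (Mmat N g)‖)
    (c := N * (2 * T⁻¹ ^ (2 * n + 2))) (by positivity) fun E hE => by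
      have h3 := measureReal_exists_finset_le (gMeasure N) (Finset.univ : Finset (Fin N))
        (fun k g => T * (T * (T * X)) < ‖errDiag N ⟨E, X ^ 9⟩ k (Mmat N g)‖)
        (c := 2 * T⁻¹ ^ (2 * n + 2)) fun k _ => by
          have hE0 : 0 ≤ E := by
            have := hE.ge hX
            have h3 : X ^ 3 ≤ 1 := pow_le_one₀ hX.le (hp.X_le.trans (by norm_num))
            linarith
          refine errDiag_tail hp hE0 hE.2 hn ?_ k
          refine le_trans (measureReal_mono fun g hg => ?_) (h1.trans hnm)
          intro hc
          obtain ⟨u, hu⟩ := exists_specData (Mmat_isHermitian N g)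
          exact hg ⟨(hc.traceRegular hp hu).norm_add_stTrans_ge hE,
            (hc.traceRegular hp hu).im_le hE⟩
      rwa [Finset.card_univ, Fintype.card_fin] at h3
  have h3 := measureReal_exists_gridPt_le (N := N) (X := X) (gMeasure N)
    (fun E g => ∃ E', IsGridPt N X E' ∧ ∃ s ∈ Finset.range (Nat.clog 2 (N ^ 2) + 1),
      ∃ p ∈ (Finset.univ : Finset (Fin N × Fin N)),
      T * ∑ c, imProd N ⟨E, X ^ 9⟩ ⟨E', 2 ^ s * X ^ 9⟩ p.1 p.2 g c ^ 2 <
      (∑ c, imProd N ⟨E, X ^ 9⟩ ⟨E', 2 ^ s * X ^ 9⟩ p.1 p.2 g c * g c c) ^ 2)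
    (c := (N : ℝ) ^ 2 * (2 * (N : ℝ) ^ 2 * ((N : ℝ) ^ 2 * (2 * Real.exp (-T / 2)))))
    (by positivity) fun E hE => by
      refine measureReal_exists_gridPt_le (gMeasure N) _ (by positivity) fun E' hE' => ?_
      have h4 := measureReal_exists_finset_le (gMeasure N)
        (Finset.range (Nat.clog 2 (N ^ 2) + 1)) (fun s g =>
          ∃ p ∈ (Finset.univ : Finset (Fin N × Fin N)),
          T * ∑ c, imProd N ⟨E, X ^ 9⟩ ⟨E', 2 ^ s * X ^ 9⟩ p.1 p.2 g c ^ 2 <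
          (∑ c, imProd N ⟨E, X ^ 9⟩ ⟨E', 2 ^ s * X ^ 9⟩ p.1 p.2 g c * g c c) ^ 2)
        (c := (N : ℝ) ^ 2 * (2 * Real.exp (-T / 2))) fun s _ => by
          have h5 := measureReal_exists_finset_le (gMeasure N)
            (Finset.univ : Finset (Fin N × Fin N)) (fun p g =>
            T * ∑ c, imProd N ⟨E, X ^ 9⟩ ⟨E', 2 ^ s * X ^ 9⟩ p.1 p.2 g c ^ 2 <
            (∑ c, imProd N ⟨E, X ^ 9⟩ ⟨E', 2 ^ s * X ^ 9⟩ p.1 p.2 g c * g c c) ^ 2)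
            (c := 2 * Real.exp (-T / 2)) fun p _ => by
              refine gMeasure_diag_tail_cond N _ ?_ ?_ T hT.le
              · refine measurable_pi_lambda _ fun c => ?_
                exact (Complex.measurable_im.comp (measurable_resolventM N _ _ _)).mul
                  (Complex.measurable_im.comp (measurable_resolventM N _ _ _))
              · intro g g' hgg
                have : Mmat N g = Mmat N g' := by
                  ext i j
                  unfold Mmat
                  split_ifs with hij
                  · rfl
                  · rw [hgg i j hij, hgg j i (Ne.symm hij)]
                funext c
                simp only [imProd, this]
          rw [Finset.card_univ, Fintype.card_prod, Fintype.card_fin] at h5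
          push_cast at h5
          rwa [← sq] at h5
      refine h4.trans ?_
      rw [Finset.card_range]
      gcongr
      have h6 : Nat.clog 2 (N ^ 2) ≤ N ^ 2 := Nat.clog_le_of_le_pow Nat.lt_two_pow_self.le
      have h7 : 1 ≤ N ^ 2 := Nat.one_le_pow _ _ hN
      have h8 : Nat.clog 2 (N ^ 2) + 1 ≤ 2 * N ^ 2 := by omega
      exact_mod_cast h8
  refine le_trans (measureReal_mono fun g hg => ?_) ((measureReal_union_le _ _).trans
    (add_le_add ((measureReal_union_le _ _).trans (add_le_add h1 h2)) h3))
  by_contra hc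
  simp only [Set.mem_union, Set.mem_ofPred_eq, not_or, not_exists, not_and, not_lt, not_not] at hc
  refine hg ⟨hc.1.1, fun E hE k => hc.1.2 E hE k (Finset.mem_univ k), fun E hE E' hE' s hs a b => ?_⟩
  exact hc.2 E hE E' hE' s (Finset.mem_range.mpr (by omega)) (a, b) (Finset.mem_univ _)

end

open Filter in
lemma eventually_le_natCast_rpow {τ : ℝ} (hτ : 0 < τ) (c : ℝ) :
    ∀ᶠ N : ℕ in atTop, c ≤ (N : ℝ) ^ τ :=
  ((tendsto_rpow_atTop hτ).comp tendsto_natCast_atTop_atTop).eventually_ge_atTop c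

open Filter in
lemma eventually_mul_log_le_natCast_rpow {τ : ℝ} (hτ : 0 < τ) {c : ℝ} (hc : 0 < c) :
    ∀ᶠ N : ℕ in atTop, c * Real.log (N : ℝ) ≤ (N : ℝ) ^ τ := by
  have h := ((isLittleO_log_rpow_atTop hτ).comp_tendsto
    tendsto_natCast_atTop_atTop).def (inv_pos.2 hc)
  filter_upwards [h] with N hN
  have hN' : Real.log (N : ℝ) ≤ c⁻¹ * (N : ℝ) ^ τ := by
    refine (le_abs_self _).trans ?_
    have h0 : (0 : ℝ) ≤ (N : ℝ) ^ τ := by positivity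
    simpa [Real.norm_eq_abs, abs_of_nonneg h0] using hN
  calc c * Real.log (N : ℝ) ≤ c * (c⁻¹ * (N : ℝ) ^ τ) := by gcongr
    _ = (N : ℝ) ^ τ := by field_simp

lemma scaleParams_rpow {N : ℕ} {τ : ℝ} (hN : 1 ≤ N) (hτ : τ ≤ 1 / 1000)
    (hT : 10 ^ 6 ≤ (N : ℝ) ^ τ) (hlog : 1 + 4 * Real.log (N : ℝ) ≤ (N : ℝ) ^ τ) :
    ScaleParams N ((N : ℝ) ^ (-(1 : ℝ) / 10)) ((N : ℝ) ^ τ) := by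
  have hN1 : (1 : ℝ) ≤ N := by exact_mod_cast hN
  have hN0 : (0 : ℝ) < N := by linarith
  refine ⟨by positivity, ?_, hT, ?_, hlog⟩
  · rw [← Real.rpow_mul_natCast hN0.le]
    norm_num
    rw [Real.rpow_neg_one]
    exact mul_inv_cancel₀ hN0.ne'
  · rw [← Real.rpow_mul_natCast hN0.le, ← Real.rpow_add hN0]
    refine Real.rpow_le_one_of_one_le_of_nonpos hN1 ?_
    push_cast
    linarith

lemma tail_sum_le {x e tm tn : ℝ} (hx : 9 ≤ x) {p K : ℕ}
    (he : e ≤ x⁻¹ ^ (p + K + 9)) (htm : tm ≤ x⁻¹ ^ (p + K + 9)) (htn : tn ≤ x⁻¹ ^ (K + 9)) :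
    x ^ 2 * (2 * e) + x ^ 2 * tm ≤ x⁻¹ ^ p ∧
      x ^ 2 * (2 * e) + x ^ 2 * tm + x ^ 2 * (x * (2 * tn))
        + x ^ 2 * (x ^ 2 * (2 * x ^ 2 * (x ^ 2 * (2 * e)))) ≤ x⁻¹ ^ K := by
  have hx0 : 0 < x := by linarith
  have hx1 : 1 ≤ x := by linarith
  have hy0 : 0 < x⁻¹ := by positivity
  have hy1 : x⁻¹ ≤ 1 := inv_le_one_of_one_le₀ hx1
  have key : ∀ q : ℕ, x ^ 8 * x⁻¹ ^ (q + 9) * 9 ≤ x⁻¹ ^ q := fun q => by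
    have h : x ^ 8 * x⁻¹ ^ (q + 9) * 9 = x⁻¹ ^ q * (9 / x) := by
      rw [pow_add]; field_simp
    rw [h]
    exact mul_le_of_le_one_right (by positivity) ((div_le_one hx0).2 hx)
  have up : ∀ {s w : ℝ} (j : ℕ), s ≤ w → 0 ≤ w → j ≤ 8 → x ^ j * s ≤ x ^ 8 * w :=
    fun {s w} j hs hw hj => calc
      x ^ j * s ≤ x ^ j * w := by gcongr
      _ ≤ x ^ 8 * w := by gcongr
  have hle : ∀ q : ℕ, q ≤ p + K → x⁻¹ ^ (p + K + 9) ≤ x⁻¹ ^ (q + 9) := fun q hq =>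
    pow_le_pow_of_le_one hy0.le hy1 (by omega)
  have hw : ∀ q : ℕ, 0 ≤ x⁻¹ ^ (q + 9) := fun q => by positivity
  have hp := hle p (by omega)
  have hK := hle K (by omega)
  constructor
  · have a1 := up 2 (he.trans hp) (hw p) (by norm_num)
    have a2 := up 2 (htm.trans hp) (hw p) (by norm_num)
    have := mul_nonneg (pow_nonneg hx0.le 8) (hw p)
    linarith [key p]
  · have a1 := up 2 (he.trans hK) (hw K) (by norm_num)
    have a2 := up 2 (htm.trans hK) (hw K) (by norm_num)
    have a3 := up 3 htn (hw K) (by norm_num)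
    have a4 := up 8 (he.trans hK) (hw K) (by norm_num)
    have := mul_nonneg (pow_nonneg hx0.le 8) (hw K)
    linarith [key K]

lemma exp_neg_half_le {N : ℕ} (hN : 1 ≤ N) {T : ℝ} {L : ℕ}
    (h : (2 * L + 1 : ℝ) * Real.log (N : ℝ) ≤ T) : Real.exp (-T / 2) ≤ (N : ℝ)⁻¹ ^ L := by
  have hN0 : (0 : ℝ) < N := by exact_mod_cast hN
  have hlog : 0 ≤ Real.log (N : ℝ) := Real.log_natCast_nonneg N
  have h1 : (N : ℝ)⁻¹ ^ L = Real.exp (-(L * Real.log (N : ℝ))) := by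
    rw [Real.exp_neg, Real.exp_nat_mul, Real.exp_log hN0, inv_pow]
  rw [h1]
  exact Real.exp_le_exp.2 (by linarith)

lemma inv_rpow_pow_le {N : ℕ} (hN : 1 ≤ N) {τ : ℝ} {j k : ℕ} (h : (k : ℝ) ≤ τ * j) :
    ((N : ℝ) ^ τ)⁻¹ ^ j ≤ (N : ℝ)⁻¹ ^ k := by
  have hN1 : (1 : ℝ) ≤ N := by exact_mod_cast hN
  have hN0 : (0 : ℝ) < N := by linarith
  rw [inv_pow, inv_pow, ← Real.rpow_mul_natCast hN0.le]
  refine inv_anti₀ (by positivity) ?_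
  rw [← Real.rpow_natCast]
  exact Real.rpow_le_rpow_of_exponent_le hN1 h

lemma eventually_measureReal_not_typical_le {τ : ℝ} (hτ0 : 0 < τ) (hτ : τ ≤ 1 / 1000) (D : ℝ) :
    ∀ᶠ N : ℕ in Filter.atTop,
      (gMeasure N).real {g | ¬Typical N ((N : ℝ) ^ (-(1 : ℝ) / 10)) ((N : ℝ) ^ τ) g}
        ≤ (N : ℝ) ^ (-D) := by
  set K : ℕ := ⌈D⌉₊ with hK
  have hcover : ∀ k : ℕ, ∃ n : ℕ, (k : ℝ) ≤ τ * ((2 * n + 2 : ℕ) : ℝ) := fun k => by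
    obtain ⟨n, hn⟩ := exists_nat_ge ((k : ℝ) / τ)
    refine ⟨n, ?_⟩
    rw [div_le_iff₀ hτ0] at hn
    push_cast
    nlinarith [Nat.cast_nonneg (α := ℝ) n]
  obtain ⟨n, hn⟩ := hcover (K + 9)
  obtain ⟨m, hm⟩ := hcover (6 * (n + 2) + K + 9)
  filter_upwards [Filter.eventually_ge_atTop 9, eventually_le_natCast_rpow hτ0 (10 ^ 6),
    eventually_le_natCast_rpow hτ0 2,
    eventually_mul_log_le_natCast_rpow hτ0 (c := 8) (by norm_num),
    eventually_le_natCast_rpow hτ0 (36 * (2 * m + 1)),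
    eventually_le_natCast_rpow hτ0 (1000 * (2 * n + 1)),
    eventually_mul_log_le_natCast_rpow hτ0
      (c := 2 * ((6 * (n + 2) + K + 9 : ℕ) : ℝ) + 1) (by positivity)]
    with N hN9 hT6 hT2 hlog hm36 hn1000 hexp
  have hN1 : 1 ≤ N := by omega
  have hN9' : (9 : ℝ) ≤ N := by exact_mod_cast hN9
  have hN0 : (0 : ℝ) < N := by linarith
  have hp := scaleParams_rpow hN1 hτ hT6 (by linarith)
  have hX : ((N : ℝ) ^ (-(1 : ℝ) / 10)) ^ (60 * (n + 2)) = (N : ℝ)⁻¹ ^ (6 * (n + 2)) := by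
    have h10 : ((N : ℝ) ^ (-(1 : ℝ) / 10)) ^ 10 = (N : ℝ)⁻¹ :=
      eq_inv_of_mul_eq_one_right hp.N_eq
    rw [show 60 * (n + 2) = 10 * (6 * (n + 2)) by ring, pow_mul, h10]
  obtain ⟨h1, h2⟩ := tail_sum_le hN9' (exp_neg_half_le hN1 hexp) (inv_rpow_pow_le hN1 hm)
    (inv_rpow_pow_le hN1 hn)
  refine (measureReal_not_typical_le hp hm36 hn1000 (by rw [hX]; exact h1)).trans
    (h2.trans ?_)
  rw [Real.rpow_neg hN0.le, inv_pow, ← Real.rpow_natCast]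
  exact inv_anti₀ (by positivity)
    (Real.rpow_le_rpow_of_exponent_le (by linarith) (Nat.le_ceil D))

lemma Typical.abs_trace_sub_le {N : ℕ} {X T : ℝ} {g : Fin N → Fin N → ℝ}
    (h : Typical N X T g) (hp : ScaleParams N X T) {f : ℝ → ℝ} (hf : Differentiable ℝ f)
    {K p q : ℝ} (hpl : 2 - X ^ 3 / 8 ≤ p) (hpq : q ≤ p + 3 * X ^ 9)
    (hsupp : ∀ x, x ∉ Set.Icc p q → f x = 0) (hK : ∀ x, |deriv f x| ≤ K) :
    |∑ i, f (evalsM N g i) - ∑ i, f (evalsH N g i)| ≤ 16 * T * (K * (T ^ 9 / N)) := by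
  obtain ⟨u, hu⟩ := exists_specData (Mmat_isHermitian N g)
  exact (h.perturbRegular hp hu).trace_diff_le (Hmat_isHermitian N g) (Hmat_eq_add N g)
    hf hpl hpq hsupp hK

/-- Lemma `lem:hs`: with overwhelming probability, traces of smoothed
indicator functions of `H` (GOE) and its zero-diagonal version `M` agree up to `N^{ε-δ_f}`. -/
theorem smoothed_trace_comparison
    (ε ε₁ δf Cf : ℝ) (hε : 0 < ε) (hε₁0 : 0 < ε₁) (hε₁ : ε₁ < 1/20)
    (hδf0 : 0 < δf) (hδf : δf < 1/20) (hCf : 0 < Cf) :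
    ∀ D : ℝ, 0 < D → ∃ N₀ : ℕ, ∀ N : ℕ, N₀ ≤ N →
      ((gMeasure N) {g : Fin N → Fin N → ℝ |
          ¬ ∀ (f : ℝ → ℝ) (a b : ℝ), ContDiff ℝ (⊤ : ℕ∞) f →
              2 - (N:ℝ) ^ (-(1:ℝ)/2) ≤ a →
              |a - b| ≤ (N:ℝ) ^ (δf + ε₁) / N →
              (∀ x ∈ Set.Icc a b, f x = 1) →
              (∀ x : ℝ, x ∉ Set.Icc (a - (N:ℝ) ^ (δf - 1)) (b + (N:ℝ) ^ (δf - 1)) → f x = 0) →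
              (∀ x : ℝ, |deriv f x| ≤ Cf * (N:ℝ) ^ (1 - δf)) →
              (∀ x : ℝ, |deriv (deriv f) x| ≤ Cf * ((N:ℝ) ^ (1 - δf)) ^ 2) →
              |(∑ i, f (evalsM N g i)) - ∑ i, f (evalsH N g i)|
                ≤ (N:ℝ) ^ (ε - δf)}).toReal
        ≤ (N:ℝ) ^ (-D) := by
  intro D _
  set τ : ℝ := min (1 / 1000) (ε / 12) with hτ_def
  have hτ0 : 0 < τ := lt_min (by norm_num) (by positivity)
  have hτ1 : τ ≤ 1 / 1000 := min_le_left _ _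
  have hτε : τ * 12 ≤ ε := by linarith [min_le_right (1 / 1000 : ℝ) (ε / 12)]
  refine Filter.eventually_atTop.1 ?_
  filter_upwards [Filter.eventually_ge_atTop 1, eventually_le_natCast_rpow hτ0 (10 ^ 6),
    eventually_le_natCast_rpow hτ0 2,
    eventually_mul_log_le_natCast_rpow hτ0 (c := 8) (by norm_num),
    eventually_le_natCast_rpow hτ0 (16 * Cf),
    eventually_measureReal_not_typical_le hτ0 hτ1 D]
    with N hN hT6 hT2 hlog hC hprob
  refine le_trans ?_ hprob
  refine measureReal_mono ?_
  intro g hg htyp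
  refine hg ?_
  intro f a b hf ha hab _ hsupp hderiv _
  have hN1 : (1 : ℝ) ≤ N := by exact_mod_cast hN
  have hN0 : (0 : ℝ) < N := by linarith
  have hp := scaleParams_rpow hN hτ1 hT6 (by linarith)
  have hXpow : ∀ j : ℕ, ((N : ℝ) ^ (-(1 : ℝ) / 10)) ^ j = (N : ℝ) ^ (-(1 : ℝ) / 10 * j) :=
    fun j => (Real.rpow_mul_natCast hN0.le _ _).symm
  have hmargin : (N : ℝ) ^ (δf - 1) ≤ ((N : ℝ) ^ (-(1 : ℝ) / 10)) ^ 9 := by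
    rw [hXpow]
    exact Real.rpow_le_rpow_of_exponent_le hN1 (by push_cast; linarith)
  have hwidth : (N : ℝ) ^ (δf + ε₁) / N ≤ ((N : ℝ) ^ (-(1 : ℝ) / 10)) ^ 9 := by
    rw [hXpow, ← Real.rpow_sub_one hN0.ne']
    exact Real.rpow_le_rpow_of_exponent_le hN1 (by push_cast; linarith)
  have hedge : (N : ℝ) ^ (-(1 : ℝ) / 2) = ((N : ℝ) ^ (-(1 : ℝ) / 10)) ^ 5 := by
    rw [hXpow]; norm_num
  rw [hedge] at ha
  have hX0 := hp.X_pos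
  have hXs := hp.X_small
  set X := (N : ℝ) ^ (-(1 : ℝ) / 10) with hX_def
  set T := (N : ℝ) ^ τ with hT_def
  have hX6 : X ≤ 1 / 10 ^ 6 := by
    have hT1 : (1 : ℝ) ≤ T := by linarith
    have h1 : T ≤ T ^ 100 := le_self_pow₀ hT1 (by norm_num)
    rw [le_div_iff₀ (by norm_num)]
    nlinarith
  have hedge' : X ^ 5 + X ^ 9 ≤ X ^ 3 / 8 := by
    have h3 : 0 < X ^ 3 := by positivity
    have h2 : X ^ 2 + X ^ 6 ≤ 1 / 8 := by
      have h6 : X ^ 6 ≤ X := pow_le_of_le_one hX0.le (by linarith) (by norm_num)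
      have h2' : X ^ 2 ≤ X := pow_le_of_le_one hX0.le (by linarith) (by norm_num)
      linarith
    nlinarith
  have hbd := htyp.abs_trace_sub_le hp (hf.differentiable (by simp)) (by linarith)
    (by linarith [neg_abs_le (a - b)]) hsupp hderiv
  refine hbd.trans ?_
  have hsplit : (N : ℝ) ^ (1 - δf) = N * (N : ℝ) ^ (-δf) := by
    rw [sub_eq_add_neg, Real.rpow_add hN0, Real.rpow_one]
  have hδ0 : 0 ≤ (N : ℝ) ^ (-δf) := by positivity
  have hT0 : 0 ≤ T := by positivity
  calc 16 * T * (Cf * (N : ℝ) ^ (1 - δf) * (T ^ 9 / N))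
      = 16 * Cf * (T ^ 10 * (N : ℝ) ^ (-δf)) := by rw [hsplit]; field_simp
    _ ≤ T * (T ^ 10 * (N : ℝ) ^ (-δf)) := by gcongr
    _ = T ^ 11 * (N : ℝ) ^ (-δf) := by ring
    _ ≤ (N : ℝ) ^ ε * (N : ℝ) ^ (-δf) := by
        gcongr
        rw [hT_def, ← Real.rpow_mul_natCast hN0.le]
        exact Real.rpow_le_rpow_of_exponent_le hN1 (by push_cast; linarith)
    _ = (N : ℝ) ^ (ε - δf) := by rw [← Real.rpow_add hN0, sub_eq_add_neg]

end
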